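/- arXiv:2003.11322 — 2 statements merged into one kernel-verified Lean document; each statement's English description precedes it below -/
import Mathlib

section
/- For any positive integers m and n, there are only finitely many n-exceptional sets of size m; that is, the collection of sets S of isometry classes of positive definite integral lattices of rank n with |S| = m such that S = E_n(L) for some positive definite integral lattice L (where E_n(L) is the set of classes of rank-n integral lattices not represented by L) is finite. -/
open Matrix

/-- Square integer matrices of size `n`, used as Gram matrices of lattices. -/
abbrev Mat (n : ℕ) := Matrix (Fin n) (Fin n) ℤ

/-- `G` is the Gram matrix of a positive definite integral lattice:
it is symmetric and `vᵀ G v > 0` for every nonzero integer vector `v`. -/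
def PosDefInt {n : ℕ} (G : Mat n) : Prop :=
  G.IsSymm ∧ ∀ v : Fin n → ℤ, v ≠ 0 → 0 < v ⬝ᵥ G.mulVec v

/-- The lattice with Gram matrix `L` represents the lattice with Gram matrix `N`:
there is an integral matrix `T` (whose rows are the coordinates of the images of
the basis vectors) with `T L Tᵀ = N`. -/
def Represents {m n : ℕ} (L : Mat m) (N : Mat n) : Prop :=
  ∃ T : Matrix (Fin n) (Fin m) ℤ, T * L * T.transpose = N

/-- Isometry of (positive definite) lattices, expressed as mutual representation. -/
def Isom {m n : ℕ} (A : Mat m) (B : Mat n) : Prop :=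
  Represents A B ∧ Represents B A

theorem Represents.rfl' {n : ℕ} (A : Mat n) : Represents A A :=
  ⟨1, by simp⟩

theorem Represents.trans' {a b c : ℕ} {A : Mat a} {B : Mat b} {C : Mat c}
    (h1 : Represents A B) (h2 : Represents B C) : Represents A C := by
  obtain ⟨T1, h1⟩ := h1
  obtain ⟨T2, h2⟩ := h2
  refine ⟨T2 * T1, ?_⟩
  rw [← h2, ← h1]
  simp [Matrix.mul_assoc, Matrix.transpose_mul]

/-- A positive definite integral lattice of rank `n`, given by a Gram matrix. -/
def QLat (n : ℕ) := {G : Mat n // PosDefInt G}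

instance latSetoid (n : ℕ) : Setoid (QLat n) where
  r A B := Isom A.1 B.1
  iseqv := ⟨fun A => ⟨Represents.rfl' _, Represents.rfl' _⟩,
    fun h => ⟨h.2, h.1⟩,
    fun h1 h2 => ⟨h1.1.trans' h2.1, h2.2.trans' h1.2⟩⟩

/-- Isometry classes of positive definite integral lattices of rank `n` (`Φ_n`). -/
def Cls (n : ℕ) := Quotient (latSetoid n)

/-- The isometry class of a lattice. -/
def cls {n : ℕ} (L : QLat n) : Cls n := Quotient.mk _ L

/-- A lattice represents an isometry class. -/
def RepCls {m n : ℕ} (L : QLat m) (c : Cls n) : Prop :=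
  ∃ N : QLat n, cls N = c ∧ Represents L.1 N.1

/-- The `n`-exceptional set of `L`: the classes of rank-`n` positive definite
integral lattices not represented by `L`. -/
def ExcSet (n : ℕ) {m : ℕ} (L : QLat m) : Set (Cls n) :=
  {c : Cls n | ¬ RepCls L c}

set_option maxHeartbeats 400000


/-- Reduced class of integral symmetric matrices with heights `h`. -/
def RedCl {n : ℕ} (A : ℝ) (h : Fin n → ℝ) (N : Fin n → Fin n → ℤ) : Prop :=
  (∀ i j, N i j = N j i) ∧ (∀ i, 0 < h i) ∧ Monotone h ∧
  (∀ i j, i ≤ j → |(N i j : ℝ)| ≤ A * h i) ∧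
  ∀ x : Fin n → ℤ, ∑ i, h i * (x i : ℝ) ^ 2 ≤ ∑ i, ∑ j, (N i j : ℝ) * x i * x j

lemma exists_q (ε D : ℝ) (hε : 0 < ε) (hε1 : ε ≤ 1/4) (hD : 4 / ε ^ 2 ≤ D) :
    ∃ q : ℕ, (q : ℝ) ^ 2 ≤ (1 - ε) * D ∧ (1 - 2 * ε) * D ≤ (q : ℝ) ^ 2 := by
  have hD0 : 0 < D := lt_of_lt_of_le (by positivity) hD
  set X := (1 - ε) * D with hX
  have hX0 : 0 ≤ X := by apply mul_nonneg <;> linarith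
  refine ⟨⌊Real.sqrt X⌋₊, ?_, ?_⟩
  · have h1 := Nat.floor_le (Real.sqrt_nonneg X)
    calc _ ≤ (Real.sqrt X)^2 := by gcongr
      _ = X := Real.sq_sqrt hX0
  · have h1 := Nat.lt_floor_add_one (Real.sqrt X)
    have h2 : Real.sqrt X ^ 2 = X := Real.sq_sqrt hX0
    have h3 : 2 * Real.sqrt X ≤ ε * D := by
      have : Real.sqrt X ≤ ε * D / 2 := by
        apply Real.sqrt_le_iff.mpr
        constructor
        · positivity
        · have : 4 ≤ D * ε^2 := by
            rw [div_le_iff₀ (by positivity)] at hD; exact hD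
          have : 4 * D ≤ D * ε^2 * D := by gcongr
          have : X ≤ D := by rw [hX]; nlinarith
          nlinarith
      linarith
    set q : ℝ := (⌊Real.sqrt X⌋₊ : ℝ)
    have hq : 0 ≤ q := Nat.cast_nonneg _
    have hs := Real.sqrt_nonneg X
    have : X - 2 * Real.sqrt X ≤ q^2 := by
      rcases le_or_gt (Real.sqrt X) 1 with hc | hc
      · nlinarith [sq_nonneg q]
      · have h5 : (Real.sqrt X - 1)^2 ≤ q^2 := by
          apply pow_le_pow_left₀ <;> linarith
        nlinarith
    nlinarith

lemma four_sq (n : ℤ) (hn : 0 ≤ n) : ∃ s : Fin 4 → ℤ, ∑ i, s i * s i = n := by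
  obtain ⟨a, b, c, d, h⟩ := Nat.sum_four_squares n.toNat
  refine ⟨![a, b, c, d], ?_⟩
  simp [Fin.sum_univ_four]
  have : (n.toNat : ℤ) = n := Int.toNat_of_nonneg hn
  rw [← this, ← h]; push_cast; ring

set_option maxHeartbeats 4000000 in
/-- the key estimate of the peeling step -/
lemma peel_est (n : ℕ) (A : ℝ) : ∃ T : ℝ, ∀ (N : Fin (n+1) → Fin (n+1) → ℤ) (h : Fin (n+1) → ℝ),
    RedCl A h N → T ≤ h 0 → ∃ (q : ℤ) (t E : Fin n → ℤ),
      (∀ i, N 0 i.succ = q * t i + E i) ∧ (∀ i, 0 ≤ E i) ∧ 0 ≤ N 0 0 - q * q - ∑ i, E i ∧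
      RedCl (4 * A + 16 * A ^ 2) (fun i => h i.succ / 2)
        (fun i j => N i.succ j.succ - t i * t j - if i = j then E i else 0) := by
  by_cases hA1 : 1 ≤ A
  swap
  · refine ⟨0, fun N h hN _ => ?_⟩
    exfalso
    obtain ⟨-, hpos, -, hb, hq⟩ := hN
    have h1 := hb 0 0 le_rfl
    have h2 := hq (Pi.single 0 1)
    simp [Fin.sum_univ_succ, Pi.single_apply] at h2
    have h3 := le_abs_self (N 0 0 : ℝ)
    have := hpos 0
    nlinarith
  set ε : ℝ := 1 / (64 * (n+1) * A^2) with hε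
  have hA0 : 0 < A := by linarith
  have hε0 : 0 < ε := by positivity
  have hεn : ε * (64 * (n+1) * A^2) = 1 := by rw [hε]; field_simp
  have hn0 : (0:ℝ) ≤ n := Nat.cast_nonneg _
  have hA2 : 1 ≤ A^2 := by nlinarith
  have hε64 : ε ≤ 1/64 := by
    rw [hε]; apply one_div_le_one_div_of_le (by norm_num)
    nlinarith
  refine ⟨max (max (4/ε^2) (n^2/ε^2 + 1)) (max (8 * (1 + 1/ε) * n) (64 * A)), fun N h hN hT => ?_⟩
  obtain ⟨hsym, hpos, hmono, hb, hq⟩ := hN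
  simp only [max_le_iff] at hT
  obtain ⟨⟨hT1, hT2⟩, hT3, hT4⟩ := hT
  set D : ℝ := (N 0 0 : ℝ) with hD
  set h0 := h 0 with hh0
  have hh0p : 0 < h0 := hpos 0
  have hD1 : h0 ≤ D := by
    have h2 := hq (Pi.single 0 1)
    simpa [Fin.sum_univ_succ, Pi.single_apply] using h2
  have hD2 : D ≤ A * h0 := (le_abs_self _).trans (hb 0 0 le_rfl)
  have hDp : 0 < D := by linarith
  have hh01 : 1 ≤ h0 := by linarith [show 0 ≤ (n:ℝ)^2/ε^2 by positivity]
  obtain ⟨q, hq1, hq2⟩ := exists_q ε D hε0 (by linarith) (by linarith)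
  have hqpos : 0 < (q:ℝ) := by
    by_contra hc
    have : (q:ℝ) = 0 := le_antisymm (not_lt.mp hc) (Nat.cast_nonneg _)
    rw [this] at hq2
    nlinarith
  have hqD : (q:ℝ)^2 ≤ D := by nlinarith
  have hqposN : 0 < q := by exact_mod_cast hqpos
  have hqposZ : (0:ℤ) < q := by exact_mod_cast hqpos
  -- n q ≤ ε D
  have hnq : n * (q:ℝ) ≤ ε * D := by
    have : (n * (q:ℝ))^2 ≤ (ε * D)^2 := by
      have h5 : (n:ℝ)^2 ≤ ε^2 * D := by
        have : (n:ℝ)^2/ε^2 ≤ D := by linarith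
        rwa [div_le_iff₀' (by positivity)] at this
      calc (n * (q:ℝ))^2 = n^2 * q^2 := by ring
        _ ≤ (ε^2 * D) * D := by gcongr
        _ = _ := by ring
    exact abs_le_of_sq_le_sq' this (by positivity) |>.2
  have hqh : (q:ℝ) ≤ h0 / 8 := by
    have : (q:ℝ)^2 ≤ (h0/8)^2 := by nlinarith
    exact abs_le_of_sq_le_sq' this (by positivity) |>.2
  set E : Fin n → ℤ := fun i => N 0 i.succ % q
  set t : Fin n → ℤ := fun i => N 0 i.succ / q
  have hE0 : ∀ i, 0 ≤ E i := fun i => Int.emod_nonneg _ hqposZ.ne'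
  have hEq : ∀ i, E i < q := fun i => Int.emod_lt_of_pos _ hqposZ
  have hE0R : ∀ i, (0:ℝ) ≤ E i := fun i => by exact_mod_cast hE0 i
  have hEqR : ∀ i, (E i : ℝ) ≤ q := fun i => by exact_mod_cast (hEq i).le
  have hdec : ∀ i, N 0 i.succ = q * t i + E i := fun i => (Int.mul_ediv_add_emod _ _).symm
  have hdecR : ∀ i, (N 0 i.succ : ℝ) = q * t i + E i := fun i => by
    rw [hdec i]; push_cast; ring
  have hl : ∀ i, |(N 0 (Fin.succ i) : ℝ)| ≤ A * h0 := fun i => hb 0 i.succ (Fin.zero_le _)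
  refine ⟨q, t, E, hdec, hE0, ?_, ?_, ?_, ?_, ?_, ?_⟩
  · have : (0:ℝ) ≤ ((N 0 0 - q * q - ∑ i, E i : ℤ) : ℝ) := by
      push_cast
      have : ∑ i, (E i : ℝ) ≤ n * q := by
        calc ∑ i, (E i : ℝ) ≤ ∑ i : Fin n, (q:ℝ) := Finset.sum_le_sum fun i _ => hEqR i
          _ = _ := by simp
      nlinarith
    exact_mod_cast this
  · intro i j
    simp only []
    rw [hsym i.succ j.succ, mul_comm (t i)]
    congr 1
    by_cases hij : i = j
    · subst hij; simp
    · simp [hij, Ne.symm hij]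
  · intro i; have := hpos i.succ; simp only []; linarith
  · intro i j hij
    have := hmono (Fin.succ_le_succ_iff.mpr hij)
    simp only []; linarith
  · intro i j hij
    have ht : ∀ i, |(t i : ℝ)| * q ≤ 2 * A * h0 := by
      intro i
      have : |(t i : ℝ)| * q = |(N 0 i.succ : ℝ) - E i| := by
        rw [hdecR i, add_sub_cancel_right, abs_mul, mul_comm, abs_of_pos hqpos]
      rw [this]
      calc _ ≤ |(N 0 i.succ : ℝ)| + |(E i:ℝ)| := abs_sub _ _
        _ ≤ A * h0 + q := by
          gcongr
          · exact hl i
          · rw [abs_of_nonneg (hE0R i)]; exact hEqR i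
        _ ≤ _ := by nlinarith
    have hq2h : h0 ≤ 2 * (q:ℝ)^2 := by nlinarith
    have htt : |(t i : ℝ)| * |(t j : ℝ)| ≤ 8 * A^2 * h0 := by
      have h1 : (|(t i : ℝ)| * q) * (|(t j : ℝ)| * q) ≤ (2 * A * h0) * (2 * A * h0) :=
        mul_le_mul (ht i) (ht j) (by positivity) (by positivity)
      have h2 : |(t i : ℝ)| * |(t j : ℝ)| * h0 ≤ 8 * A^2 * h0 * h0 := by
        have : |(t i : ℝ)| * |(t j : ℝ)| * h0 ≤ |(t i : ℝ)| * |(t j : ℝ)| * (2 * (q:ℝ)^2) := by gcongr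
        nlinarith
      exact le_of_mul_le_mul_right h2 hh0p
    have hhi : h0 ≤ h i.succ := hmono (Fin.zero_le _)
    have hif : |((if i = j then E i else 0 : ℤ) : ℝ)| ≤ q := by
      split_ifs
      · rw [abs_of_nonneg (hE0R i)]; exact hEqR i
      · simp
    push_cast [-Int.cast_ite]
    calc _ ≤ |(N i.succ j.succ : ℝ)| + |(t i : ℝ)| * |(t j : ℝ)| + |((if i = j then E i else 0 : ℤ) : ℝ)| := by
            rw [← abs_mul]
            exact (abs_sub _ _).trans (by gcongr; exact abs_sub _ _)
      _ ≤ A * h i.succ + 8 * A^2 * h0 + q := by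
            gcongr
            exact hb _ _ (Fin.succ_le_succ_iff.mpr hij)
      _ ≤ _ := by nlinarith
  · intro y
    set S := ∑ i, (y i : ℝ)^2 with hS
    have hS0 : 0 ≤ S := by positivity
    set ℓ : ℝ := ∑ i, (N 0 (Fin.succ i) : ℝ) * y i with hℓ
    set e : ℝ := ∑ i, (E i : ℝ) * y i with he
    set ty : ℝ := ∑ i, (t i : ℝ) * y i with hty
    set NY : ℝ := ∑ i : Fin n, ∑ j : Fin n, (N i.succ j.succ : ℝ) * y i * y j with hNY
    have hℓe : ℓ = q * ty + e := by
      rw [hℓ, hty, he, Finset.mul_sum, ← Finset.sum_add_distrib]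
      refine Finset.sum_congr rfl fun i _ => ?_
      rw [hdecR i]; ring
    have hℓ2 : ℓ^2 ≤ n * A^2 * h0^2 * S := by
      calc ℓ^2 ≤ (∑ i, (N 0 (Fin.succ i) : ℝ)^2) * S := Finset.sum_mul_sq_le_sq_mul_sq _ _ _
        _ ≤ (∑ i : Fin n, (A * h0)^2) * S := by
            refine mul_le_mul_of_nonneg_right (Finset.sum_le_sum fun i _ => ?_) hS0
            rw [← sq_abs]; exact pow_le_pow_left₀ (abs_nonneg _) (hl i) 2
        _ = _ := by rw [Finset.sum_const, Finset.card_univ, Fintype.card_fin, nsmul_eq_mul]; ring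
    have he2 : e^2 ≤ n * q^2 * S := by
      calc e^2 ≤ (∑ i, (E i : ℝ)^2) * S := Finset.sum_mul_sq_le_sq_mul_sq _ _ _
        _ ≤ (∑ i : Fin n, (q:ℝ)^2) * S := by
            gcongr with i
            · exact hE0R i
            · exact hEqR i
        _ = _ := by simp
    -- Schur
    have hschur : ∑ i : Fin n, h i.succ * (y i:ℝ)^2 ≤ NY - ℓ^2 / D := by
      have h1 := hq (Fin.cons (-(∑ i, N 0 (Fin.succ i) * y i)) (fun i => N 0 0 * y i))
      simp only [Fin.sum_univ_succ, Fin.cons_zero, Fin.cons_succ, Finset.sum_add_distrib] at h1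
      push_cast at h1
      rw [← hℓ] at h1
      have e1 : ∑ i : Fin n, h i.succ * ((N 0 0 : ℝ) * y i)^2 = D^2 * ∑ i : Fin n, h i.succ * (y i:ℝ)^2 := by
        rw [Finset.mul_sum]; exact Finset.sum_congr rfl fun i _ => by ring
      have e2 : ∑ i : Fin n, (N 0 i.succ : ℝ) * (-ℓ) * ((N 0 0 : ℝ) * y i) = -(D * ℓ^2) := by
        have : -(D * ℓ^2) = (-(D * ℓ)) * ∑ i, (N 0 (Fin.succ i) : ℝ) * y i := by rw [← hℓ]; ring
        rw [this, Finset.mul_sum]; exact Finset.sum_congr rfl fun i _ => by ring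
      have e3 : ∑ i : Fin n, (N i.succ 0 : ℝ) * ((N 0 0 : ℝ) * y i) * (-ℓ)  = -(D * ℓ^2) := by
        rw [← e2]; exact Finset.sum_congr rfl fun i _ => by rw [hsym i.succ 0]; ring
      have e4 : ∑ i : Fin n, ∑ j : Fin n, (N i.succ j.succ : ℝ) * ((N 0 0 : ℝ) * y i) * ((N 0 0 : ℝ) * y j) = D^2 * NY := by
        rw [hNY, Finset.mul_sum]; refine Finset.sum_congr rfl fun i _ => ?_
        rw [Finset.mul_sum]; exact Finset.sum_congr rfl fun j _ => by ring
      rw [e1, e2, e3, e4] at h1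
      have h2 : D^2 * ∑ i : Fin n, h i.succ * (y i:ℝ)^2 ≤ D^2 * NY - D * ℓ^2 := by
        have : 0 ≤ h 0 * (-ℓ)^2 := by positivity
        linarith
      have h3 : D^2 * ∑ i : Fin n, h i.succ * (y i:ℝ)^2 ≤ D^2 * (NY - ℓ^2 / D) := by
        have : D^2 * (NY - ℓ^2 / D) = D^2 * NY - D * ℓ^2 := by field_simp
        rw [this]; exact h2
      exact le_of_mul_le_mul_left h3 (by positivity)
    -- ty bound
    have hty2 : ty^2 ≤ ℓ^2 / D + h0/8 * S + h0/8 * S := by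
      have hy1 : (q * ty)^2 ≤ (1+ε) * ℓ^2 + (1 + 1/ε) * e^2 := by
        have : q * ty = ℓ - e := by linarith
        rw [this]
        have h6 : 0 ≤ ε * (ℓ + 1/ε * e)^2 := by positivity
        have h7 : ε * (ℓ + 1/ε * e)^2 = ε * ℓ^2 + 2 * ℓ * e + 1/ε * e^2 := by field_simp; ring
        nlinarith
      have hy2 : (1+ε) * ℓ^2 ≤ q^2 * (ℓ^2/D + h0/8 * S) := by
        have : (1 + ε) * D ≤ (1 + 8 * ε) * q^2 := by
          have : (1+8*ε) * ((1 - 2*ε) * D) ≤ (1 + 8 * ε) * q^2 := by gcongr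
          nlinarith [mul_pos hε0 hDp]
        have h8 : (1+ε) * ℓ^2 ≤ (1 + 8*ε) * q^2 * (ℓ^2/D) := by
          rw [← mul_div_assoc, le_div_iff₀ hDp]
          nlinarith [sq_nonneg ℓ]
        have h9 : 8 * ε * (ℓ^2/D) ≤ h0/8 * S := by
          rw [← mul_div_assoc, div_le_iff₀ hDp]
          calc 8 * ε * ℓ^2 ≤ 8 * ε * (n * A^2 * h0^2 * S) := by gcongr
            _ = (ε * (64 * n * A^2)) / 8 * h0 * S * h0 := by ring
            _ ≤ 1/8 * h0 * S * h0 := by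
                gcongr
                nlinarith [mul_pos hε0 (pow_pos hA0 2)]
            _ ≤ 1/8 * h0 * S * D := by gcongr
            _ = _ := by ring
        have : q^2 * (8 * ε * (ℓ^2/D)) ≤ q^2 * (h0/8*S) := by gcongr
        nlinarith
      have hy3 : (1 + 1/ε) * e^2 ≤ q^2 * (h0/8 * S) := by
        calc (1 + 1/ε) * e^2 ≤ (1 + 1/ε) * (n * q^2 * S) := by gcongr
          _ = q^2 * ((8 * (1 + 1/ε) * n)/8 * S) := by ring
          _ ≤ _ := by gcongr
      have : (q:ℝ)^2 * ty^2 ≤ q^2 * (ℓ^2 / D + h0/8 * S + h0/8 * S) := by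
        calc _ = (q * ty)^2 := by ring
          _ ≤ _ := by linarith
      exact le_of_mul_le_mul_left this (by positivity)
    have hEy : ∑ i, (E i : ℝ) * (y i:ℝ)^2 ≤ h0/8 * S := by
      rw [hS, Finset.mul_sum]
      gcongr with i
      exact (hEqR i).trans hqh
    have hSh : h0 * S ≤ ∑ i : Fin n, h i.succ * (y i:ℝ)^2 := by
      rw [hS, Finset.mul_sum]
      gcongr with i
      exact hmono (Fin.zero_le _)
    have hfin : ∑ i : Fin n, ∑ j : Fin n, ((N i.succ j.succ - t i * t j - if i = j then E i else 0 : ℤ) : ℝ) * y i * y j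
        = NY - ty^2 - ∑ i, (E i : ℝ) * (y i:ℝ)^2 := by
      have h1 : ty^2 = ∑ i, ∑ j, ((t i : ℝ) * t j) * y i * y j := by
        rw [hty, sq, Finset.sum_mul_sum]
        exact Finset.sum_congr rfl fun i _ => Finset.sum_congr rfl fun j _ => by ring
      have h2 : ∑ i, (E i : ℝ) * (y i:ℝ)^2 = ∑ i, ∑ j, (if i = j then (E i:ℝ) else 0) * y i * y j := by
        refine Finset.sum_congr rfl fun i _ => ?_
        simp [Finset.sum_ite_eq, ite_mul]
        ring
      rw [h1, h2, hNY, ← Finset.sum_sub_distrib, ← Finset.sum_sub_distrib]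
      refine Finset.sum_congr rfl fun i _ => ?_
      rw [← Finset.sum_sub_distrib, ← Finset.sum_sub_distrib]
      refine Finset.sum_congr rfl fun j _ => ?_
      push_cast
      ring
    rw [hfin]
    have : ∑ i : Fin n, h i.succ / 2 * (y i:ℝ)^2 = (∑ i : Fin n, h i.succ * (y i:ℝ)^2)/2 := by
      rw [Finset.sum_div]; exact Finset.sum_congr rfl fun i _ => by ring
    rw [this]
    have := mul_nonneg hh0p.le hS0
    linarith

theorem sumsq (n : ℕ) : ∃ (κ : Type) (_ : Fintype κ), ∀ A : ℝ, ∃ T : ℝ,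
    ∀ (N : Fin n → Fin n → ℤ) (h : Fin n → ℝ), RedCl A h N → (∀ i, T ≤ h i) →
      ∃ Y : Fin n → κ → ℤ, ∀ i j, N i j = ∑ k, Y i k * Y j k := by
  induction n with
  | zero => exact ⟨Unit, inferInstance, fun A => ⟨0, fun N h _ _ => ⟨fun i => i.elim0, fun i => i.elim0⟩⟩⟩
  | succ n ih =>
    obtain ⟨κ, hκ, ih⟩ := ih
    refine ⟨κ ⊕ (Unit ⊕ ((Fin n × Fin 4) ⊕ Fin 4)), inferInstance, fun A => ?_⟩
    obtain ⟨T1, hT1⟩ := peel_est n A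
    obtain ⟨T2, hT2⟩ := ih (4 * A + 16 * A ^ 2)
    refine ⟨max T1 (2 * T2), fun N h hN hT => ?_⟩
    obtain ⟨q, t, E, hdec, hE, hrest, hcl⟩ := hT1 N h hN ((le_max_left _ _).trans (hT 0))
    obtain ⟨Y, hY⟩ := hT2 _ _ hcl (fun i => by
      have := (le_max_right _ _).trans (hT i.succ)
      linarith)
    choose s hs using fun i => four_sq (E i) (hE i)
    obtain ⟨u, hu⟩ := four_sq _ hrest
    refine ⟨Fin.cons (Sum.elim 0 (Sum.elim (fun _ => q) (Sum.elim (fun p => s p.1 p.2) u)))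
      (fun i => Sum.elim (Y i) (Sum.elim (fun _ => t i) (Sum.elim (fun p => if p.1 = i then s p.1 p.2 else 0) 0))), ?_⟩
    intro i j
    refine Fin.cases ?_ (fun i => ?_) i <;> refine Fin.cases ?_ (fun j => ?_) j
    · simp [Fintype.sum_sum_type, Fintype.sum_prod_type, hs, hu]
    · simp [Fintype.sum_sum_type, Fintype.sum_prod_type, hs, hdec]
    · rw [hN.1, hdec]
      simp [Fintype.sum_sum_type, Fintype.sum_prod_type, hs, ite_mul, mul_comm]
    · have := hY i j
      simp only [Fintype.sum_sum_type, Fintype.sum_prod_type, Fin.cons_succ, Sum.elim_inl, Sum.elim_inr, ← this]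
      by_cases hij : i = j
      · subst hij; simp [hs]
      · have : ∀ x, ¬ (x = i ∧ x = j) := fun x hx => hij (hx.1.symm.trans hx.2)
        simp [hij, Ne.symm hij]


def bm {n : ℕ} (c : Fin n → ℤ) (V : Matrix (Fin n) (Fin n) ℤ) : Matrix (Fin (n+1)) (Fin (n+1)) ℤ :=
  Fin.cons (Fin.cons 1 0) (fun i => Fin.cons (c i) (V i))

lemma bm_00 {n : ℕ} (c : Fin n → ℤ) (V : Matrix (Fin n) (Fin n) ℤ) : bm c V 0 0 = 1 := rfl
lemma bm_0s {n : ℕ} (c : Fin n → ℤ) (V : Matrix (Fin n) (Fin n) ℤ) (j : Fin n) : bm c V 0 j.succ = 0 := rfl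
lemma bm_s0 {n : ℕ} (c : Fin n → ℤ) (V : Matrix (Fin n) (Fin n) ℤ) (i : Fin n) : bm c V i.succ 0 = c i := rfl
lemma bm_ss {n : ℕ} (c : Fin n → ℤ) (V : Matrix (Fin n) (Fin n) ℤ) (i j : Fin n) : bm c V i.succ j.succ = V i j := rfl

lemma bm_mul {n : ℕ} (c c' : Fin n → ℤ) (V V' : Matrix (Fin n) (Fin n) ℤ) :
    bm c V * bm c' V' = bm (c + V *ᵥ c') (V * V') := by
  ext i j
  refine Fin.cases ?_ (fun i => ?_) i <;> refine Fin.cases ?_ (fun j => ?_) j <;>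
  simp [bm_00, bm_0s, bm_s0, bm_ss, Matrix.mul_apply, Fin.sum_univ_succ, Matrix.mulVec, dotProduct]

lemma bm_one {n : ℕ} : bm (0 : Fin n → ℤ) 1 = 1 := by
  ext i j
  refine Fin.cases ?_ (fun i => ?_) i <;> refine Fin.cases ?_ (fun j => ?_) j <;>
  simp [bm_00, bm_0s, bm_s0, bm_ss, Matrix.one_apply, Fin.ext_iff]

lemma bm_unit {n : ℕ} (c : Fin n → ℤ) (V : Matrix (Fin n) (Fin n) ℤ) (hV : IsUnit V) : IsUnit (bm c V) := by
  obtain ⟨u, rfl⟩ := hV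
  refine ⟨⟨bm c u, bm (-((u⁻¹ : (Matrix (Fin n) (Fin n) ℤ)ˣ).1 *ᵥ c)) (u⁻¹ : (Matrix (Fin n) (Fin n) ℤ)ˣ).1, ?_, ?_⟩, rfl⟩
  · rw [bm_mul, ← bm_one]
    congr 1
    · rw [Matrix.mulVec_neg, Matrix.mulVec_mulVec, Units.mul_inv]; simp
    · rw [Units.mul_inv]
  · rw [bm_mul, ← bm_one]
    congr 1
    · simp
    · rw [Units.inv_mul]

def PDM {n : ℕ} (N : Matrix (Fin n) (Fin n) ℤ) : Prop :=
  (∀ i j, N i j = N j i) ∧ ∀ x : Fin n → ℤ, x ≠ 0 → 0 < ∑ i, ∑ j, N i j * x i * x j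

lemma quad_eq {n : ℕ} (N : Matrix (Fin n) (Fin n) ℤ) (x : Fin n → ℤ) :
    ∑ i, ∑ j, N i j * x i * x j = x ⬝ᵥ (N *ᵥ x) := by
  simp only [dotProduct, mulVec, Finset.mul_sum]
  exact Finset.sum_congr rfl fun i _ => Finset.sum_congr rfl fun j _ => by ring

lemma PDM.conj {n : ℕ} {N : Matrix (Fin n) (Fin n) ℤ} (hN : PDM N) {U : Matrix (Fin n) (Fin n) ℤ} (hU : IsUnit U) :
    PDM (U * N * Uᵀ) := by
  have hs : Nᵀ = N := by ext i j; exact hN.1 j i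
  constructor
  · intro i j
    have : (U * N * Uᵀ)ᵀ = U * N * Uᵀ := by
      rw [transpose_mul, transpose_mul, transpose_transpose, hs, Matrix.mul_assoc]
    exact (congrFun (congrFun this j) i)
  · intro x hx
    have h0 : Uᵀ *ᵥ x ≠ 0 := by
      intro h
      apply hx
      obtain ⟨u, rfl⟩ := hU
      have : ((u⁻¹ : (Matrix (Fin n) (Fin n) ℤ)ˣ).1ᵀ) *ᵥ (u.1ᵀ *ᵥ x) = x := by
        rw [Matrix.mulVec_mulVec, ← transpose_mul, Units.mul_inv]; simp
      rw [← this, h]; simp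
    have := hN.2 _ h0
    rw [quad_eq] at this ⊢
    rw [← Matrix.mulVec_mulVec, ← Matrix.mulVec_mulVec, Matrix.dotProduct_mulVec, ← Matrix.mulVec_transpose]
    exact this

/-- Schur complement -/
def schur {n : ℕ} (N : Matrix (Fin (n+1)) (Fin (n+1)) ℤ) : Matrix (Fin n) (Fin n) ℤ :=
  fun i j => N 0 0 * N i.succ j.succ - N 0 i.succ * N 0 j.succ

lemma PDM.pos {n : ℕ} {N : Matrix (Fin (n+1)) (Fin (n+1)) ℤ} (hN : PDM N) : 0 < N 0 0 := by
  have := hN.2 (Pi.single 0 1) (by simp)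
  simpa [Pi.single_apply] using this

lemma schur_bm {n : ℕ} (N : Matrix (Fin (n+1)) (Fin (n+1)) ℤ) (hN : ∀ i j, N i j = N j i)
   (c : Fin n → ℤ) (V : Matrix (Fin n) (Fin n) ℤ) :
    (bm c V * N * (bm c V)ᵀ) 0 0 = N 0 0 ∧
    (∀ i, (bm c V * N * (bm c V)ᵀ) 0 (Fin.succ i) = ∑ j, V i j * N 0 j.succ + c i * N 0 0) ∧
    schur (bm c V * N * (bm c V)ᵀ) = V * schur N * Vᵀ := by
  have h0 : (bm c V * N * (bm c V)ᵀ) 0 0 = N 0 0 := by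
    simp [bm_00, bm_0s, bm_s0, bm_ss, Matrix.mul_apply, Fin.sum_univ_succ]
  have h1 : ∀ i, (bm c V * N * (bm c V)ᵀ) 0 (Fin.succ i) = ∑ j, V i j * N 0 j.succ + c i * N 0 0 := by
    intro i
    simp [bm_00, bm_0s, bm_s0, bm_ss, Matrix.mul_apply, Fin.sum_univ_succ, mul_comm, add_comm]
  refine ⟨h0, h1, ?_⟩
  ext i j
  have h2 : (bm c V * N * (bm c V)ᵀ) i.succ j.succ = ∑ k, ∑ l, V i l * N l.succ k.succ * V j k
     + c i * ∑ k, V j k * N 0 k.succ + c j * ∑ k, V i k * N 0 k.succ + c i * c j * N 0 0 := by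
    simp [bm_00, bm_0s, bm_s0, bm_ss, Matrix.mul_apply, Fin.sum_univ_succ, add_mul, Finset.sum_add_distrib, Finset.sum_mul, Finset.mul_sum, hN _ 0]
    have e1 : ∀ x : Fin n, c i * N 0 x.succ * V j x = c i * (V j x * N 0 x.succ) := fun x => by ring
    have e2 : ∀ x : Fin n, V i x * N 0 x.succ * c j = c j * (V i x * N 0 x.succ) := fun x => by ring
    simp only [e1, e2]
    ring
  have h3 : (V * schur N * Vᵀ) i j = N 0 0 * ∑ k, ∑ l, V i l * N l.succ k.succ * V j k
     - (∑ k, V i k * N 0 k.succ) * ∑ k, V j k * N 0 k.succ := by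
    simp only [Matrix.mul_apply, schur, Finset.sum_mul, Matrix.transpose_apply, Finset.mul_sum]
    rw [← Finset.sum_sub_distrib]
    refine Finset.sum_congr rfl fun k _ => ?_
    rw [← Finset.sum_sub_distrib]
    exact Finset.sum_congr rfl fun l _ => by ring
  rw [h3]
  simp only [schur]
  rw [h0, h1, h1, h2]
  ring

lemma PDM.schur {n : ℕ} {N : Matrix (Fin (n+1)) (Fin (n+1)) ℤ} (hN : PDM N) : PDM (schur N) := by
  constructor
  · intro i j; simp only [_root_.schur]; rw [hN.1 i.succ j.succ]; ring
  intro x hx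
  have h1 := hN.2 (Fin.cons (-(∑ i, N 0 (Fin.succ i) * x i)) (fun i => N 0 0 * x i)) (by
    intro h
    apply hx
    ext i
    have := congrFun h i.succ
    simp at this
    rcases this with h | h
    · exact absurd h hN.pos.ne'
    · exact h)
  set ℓ := ∑ i, N 0 (Fin.succ i) * x i with hℓ
  simp only [Fin.sum_univ_succ, Fin.cons_zero, Fin.cons_succ, Finset.sum_add_distrib] at h1
  have e2 : ∑ i : Fin n, (N 0 i.succ) * (-ℓ) * (N 0 0 * x i) = -(N 0 0 * ℓ^2) := by
    have : -(N 0 0 * ℓ^2) = (-(N 0 0 * ℓ)) * ∑ i, N 0 (Fin.succ i) * x i := by rw [← hℓ]; ring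
    rw [this, Finset.mul_sum]; exact Finset.sum_congr rfl fun i _ => by ring
  have e3 : ∑ i : Fin n, (N i.succ 0) * (N 0 0 * x i) * (-ℓ)  = -(N 0 0 * ℓ^2) := by
    rw [← e2]; exact Finset.sum_congr rfl fun i _ => by rw [hN.1 i.succ 0]; ring
  have e4 : ∑ i : Fin n, ∑ j : Fin n, (N i.succ j.succ) * (N 0 0 * x i) * (N 0 0 * x j) =
      N 0 0 * (N 0 0 * ∑ i : Fin n, ∑ j : Fin n, N i.succ j.succ * x i * x j) := by
    simp only [Finset.mul_sum]
    refine Finset.sum_congr rfl fun i _ => ?_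
    exact Finset.sum_congr rfl fun j _ => by ring
  rw [e2, e3, e4] at h1
  have e5 : ∑ i, ∑ j, _root_.schur N i j * x i * x j = N 0 0 * (∑ i : Fin n, ∑ j : Fin n, N i.succ j.succ * x i * x j) - ℓ^2 := by
    rw [hℓ, sq, Finset.sum_mul_sum, Finset.mul_sum, ← Finset.sum_sub_distrib]
    refine Finset.sum_congr rfl fun i _ => ?_
    rw [Finset.mul_sum, ← Finset.sum_sub_distrib]
    exact Finset.sum_congr rfl fun j _ => by simp only [_root_.schur]; ring
  rw [e5]
  have := hN.pos
  have h6 : 0 < N 0 0 * (N 0 0 * (∑ i : Fin n, ∑ j : Fin n, N i.succ j.succ * x i * x j) - ℓ^2) := by linarith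
  exact (mul_pos_iff_of_pos_left this).mp h6

lemma size_red (a D : ℤ) (hD : 0 < D) : ∃ c : ℤ, 2 * |a + c * D| ≤ D := by
  refine ⟨-((2 * a + D) / (2 * D)), ?_⟩
  have h1 := Int.emod_nonneg (2 * a + D) (show 2 * D ≠ 0 by omega)
  have h2 := Int.emod_lt_of_pos (2 * a + D) (show 0 < 2 * D by omega)
  have h3 := Int.mul_ediv_add_emod (2*a+D) (2*D)
  set m := (2 * a + D) / (2 * D)
  have h4 : 2 * (a + -m * D) = (2 * a + D) % (2 * D) - D := by linarith
  have : |2 * (a + -m * D)| ≤ D := by rw [h4, abs_le]; constructor <;> linarith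
  rw [abs_mul] at this
  simpa using this

lemma swap_mat {n : ℕ} (i : Fin (n+1)) : ∃ P : Matrix (Fin (n+1)) (Fin (n+1)) ℤ, IsUnit P ∧
    ∀ M : Matrix (Fin (n+1)) (Fin (n+1)) ℤ, (P * M * Pᵀ) 0 0 = M i i := by
  have key : ∀ M : Matrix (Fin (n+1)) (Fin (n+1)) ℤ, ∀ a b,
    ((Matrix.of (fun a b => if Equiv.swap 0 i a = b then (1:ℤ) else 0) : Matrix (Fin (n+1)) (Fin (n+1)) ℤ) * M) a b = M (Equiv.swap 0 i a) b := by
    intro M a b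
    rw [Matrix.mul_apply]
    simp
  refine ⟨Matrix.of (fun a b => if Equiv.swap 0 i a = b then 1 else 0), ?_, ?_⟩
  · refine ⟨⟨_, Matrix.of (fun a b => if Equiv.swap 0 i a = b then 1 else 0), ?_, ?_⟩, rfl⟩ <;>
    · ext a b; rw [key]; simp [Matrix.one_apply]
  · intro M
    rw [Matrix.mul_apply]
    simp only [key, Matrix.transpose_apply, Matrix.of_apply]
    simp

theorem red (n : ℕ) : ∃ A : ℝ, 1 ≤ A ∧ ∀ N : Matrix (Fin n) (Fin n) ℤ, PDM N →
    ∃ (U : Matrix (Fin n) (Fin n) ℤ) (h : Fin n → ℝ), IsUnit U ∧ RedCl A h (U * N * Uᵀ) := by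
  induction n with
  | zero => exact ⟨1, le_rfl, fun N _ => ⟨1, 0, isUnit_one, ⟨fun i => i.elim0, fun i => i.elim0, fun i => i.elim0, fun i => i.elim0, by simp⟩⟩⟩
  | succ n ih =>
    obtain ⟨A, hA, ih⟩ := ih
    have hn0 : (0:ℝ) ≤ n := Nat.cast_nonneg _
    refine ⟨8 * A * (n+1) / 3, by nlinarith, fun N hN => ?_⟩
    -- minimal
    obtain ⟨U0, hU0, hmin⟩ : ∃ U0 : Matrix (Fin (n+1)) (Fin (n+1)) ℤ, IsUnit U0 ∧ ∀ U : Matrix (Fin (n+1)) (Fin (n+1)) ℤ, IsUnit U →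
        (U0 * N * U0ᵀ) 0 0 ≤ (U * N * Uᵀ) 0 0 := by
      have hne : {U : Matrix (Fin (n+1)) (Fin (n+1)) ℤ | IsUnit U}.Nonempty := ⟨1, isUnit_one⟩
      obtain ⟨U0, hU0, h⟩ := exists_minimalFor_of_wellFoundedLT (fun U : Matrix (Fin (n+1)) (Fin (n+1)) ℤ => IsUnit U)
        (fun U => ((U * N * Uᵀ) 0 0).toNat) hne
      refine ⟨U0, hU0, fun U hU => ?_⟩
      have h1 := (hN.conj hU0).pos
      have h2 := (hN.conj hU).pos
      by_contra hc
      have h3 := h hU (by simp only []; omega)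
      simp only [] at h3
      omega
    set N1 := U0 * N * U0ᵀ with hN1
    have hN1' : PDM N1 := hN.conj hU0
    obtain ⟨V, h', hV, hred⟩ := ih _ hN1'.schur
    have hD := hN1'.pos
    choose c hc using fun i => size_red (∑ j, V i j * N1 0 j.succ) (N1 0 0) hD
    obtain ⟨hb0, hb1, hb2⟩ := schur_bm N1 hN1'.1 c V
    rw [← hb2] at hred
    have hU1 : IsUnit (bm c V) := bm_unit c V hV
    have hN2 : PDM (bm c V * N1 * (bm c V)ᵀ) := hN1'.conj hU1
    have hN2e : bm c V * N1 * (bm c V)ᵀ = (bm c V * U0) * N * (bm c V * U0)ᵀ := by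
      rw [hN1, transpose_mul]; simp only [Matrix.mul_assoc]
    have hmin2 : ∀ i, N1 0 0 ≤ (bm c V * N1 * (bm c V)ᵀ) i i := by
      intro i
      obtain ⟨P, hPu, hP⟩ := swap_mat i
      have := hmin (P * (bm c V * U0)) (hPu.mul (hU1.mul hU0))
      have e : P * (bm c V * U0) * N * (P * (bm c V * U0))ᵀ = P * (bm c V * N1 * (bm c V)ᵀ) * Pᵀ := by
        rw [hN2e, transpose_mul P]; simp only [Matrix.mul_assoc]
      rw [e] at this
      refine this.trans_eq ?_
      exact hP _
    refine ⟨bm c V * U0, ?_, hU1.mul hU0, ?_⟩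
    · exact Fin.cons (3 / (8 * A * (n+1)) * (N1 0 0 : ℝ)) (fun i => h' i / (2 * (N1 0 0 : ℝ)))
    rw [← hN2e]
    have hl : ∀ i, 2 * |(bm c V * N1 * (bm c V)ᵀ) 0 (Fin.succ i)| ≤ N1 0 0 := fun i => by rw [hb1]; exact hc i
    set M := bm c V * N1 * (bm c V)ᵀ with hM
    rw [← hb0] at hl hmin2 hD ⊢
    clear_value M
    clear hb2 hN2e hb1 hU1 hb0
    obtain ⟨hs1, hs2, hs3, hs4, hs5⟩ := hred
    set D : ℝ := (M 0 0 : ℝ) with hDd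
    have hD0 : 0 < D := by rw [hDd]; exact_mod_cast hD
    have hlR : ∀ i : Fin n, |(M 0 i.succ : ℝ)| ≤ D / 2 := fun i => by
      have := hl i
      have : (2:ℝ) * |(M 0 i.succ : ℝ)| ≤ D := by rw [hDd]; exact_mod_cast this
      linarith
    have hl2 : ∀ i : Fin n, (M 0 i.succ : ℝ)^2 ≤ D^2/4 := fun i => by
      rw [← sq_abs]
      calc _ ≤ (D/2)^2 := pow_le_pow_left₀ (abs_nonneg _) (hlR i) 2
        _ = _ := by ring
    have hh' : ∀ i, 3/4 * D^2 ≤ A * h' i := by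
      intro i
      have h1 := (le_abs_self _).trans (hs4 i i le_rfl)
      simp only [schur] at h1
      push_cast at h1
      have h2 : D ≤ M i.succ i.succ := by rw [hDd]; exact_mod_cast hmin2 i.succ
      have h3 := hl2 i
      nlinarith
    have hA0 : 0 < A := by linarith
    have hH : ∀ i, D * (3 / (8 * A)) ≤ h' i / (2 * D) := by
      intro i
      rw [le_div_iff₀ (by positivity)]
      have := hh' i
      have e : D * (3 / (8 * A)) * (2 * D) = (3/4 * D^2) / A := by field_simp; ring
      rw [e, div_le_iff₀ hA0]; linarith
    have hδ : 3 / (8 * A * (n+1)) ≤ 3 / (8 * A) := by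
      apply div_le_div_of_nonneg_left (by norm_num) (by positivity)
      nlinarith
    refine ⟨hN2.1, ?_, ?_, ?_, ?_⟩
    · intro i
      refine Fin.cases ?_ (fun i => ?_) i
      · simp; positivity
      · have := hs2 i
        simp; positivity
    · intro i j
      refine Fin.cases ?_ (fun i => ?_) i <;> refine Fin.cases ?_ (fun j => ?_) j
      · simp
      · intro _
        simp only [Fin.cons_zero, Fin.cons_succ]
        have := hH j
        nlinarith
      · intro h; simp at h
      · intro hij
        have := hs3 (Fin.succ_le_succ_iff.mp hij)
        simp only [Fin.cons_succ]
        gcongr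
    · intro i j
      refine Fin.cases ?_ (fun i => ?_) i
      · intro _
        simp only [Fin.cons_zero]
        have e : 8 * A * (n+1) / 3 * (3 / (8 * A * (n+1)) * D) = D := by field_simp
        rw [e]
        refine Fin.cases ?_ (fun j => ?_) j
        · rw [← hDd, abs_of_pos hD0]
        · linarith [hlR j]
      · refine Fin.cases ?_ (fun j => ?_) j
        · intro h; simp at h
        · intro hij
          simp only [Fin.cons_succ]
          have h1 := hs4 i j (Fin.succ_le_succ_iff.mp hij)
          simp only [schur] at h1
          push_cast at h1
          have h2 : |(M 0 i.succ : ℝ) * M 0 j.succ| ≤ D^2/4 := by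
            rw [abs_mul]
            calc _ ≤ (D/2) * (D/2) := mul_le_mul (hlR i) (hlR j) (abs_nonneg _) (by positivity)
              _ = _ := by ring
          have h3 : D * |(M i.succ j.succ : ℝ)| ≤ A * h' i + D^2/4 := by
            have : D * |(M i.succ j.succ : ℝ)| = |(D * M i.succ j.succ - (M 0 i.succ : ℝ) * M 0 j.succ) + (M 0 i.succ : ℝ) * M 0 j.succ| := by
              rw [sub_add_cancel, abs_mul, abs_of_pos hD0]
            rw [this]
            exact (abs_add_le _ _).trans (add_le_add h1 h2)
          have h4 := hh' i
          rw [← mul_div_assoc, le_div_iff₀ (by positivity)]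
          have h5 : 0 ≤ n * (A * h' i) := by have := hs2 i; positivity
          nlinarith
    · intro x
      set y : Fin n → ℤ := fun i => x i.succ with hy
      set S := ∑ i, (y i : ℝ)^2 with hS
      set ℓ : ℝ := ∑ i, (M 0 (Fin.succ i) : ℝ) * y i with hℓ
      set NY : ℝ := ∑ i : Fin n, ∑ j : Fin n, (M i.succ j.succ : ℝ) * y i * y j with hNY
      have hS0 : 0 ≤ S := by positivity
      have hℓ2 : ℓ^2 ≤ n * D^2 /4 * S := by
        calc ℓ^2 ≤ (∑ i, (M 0 (Fin.succ i) : ℝ)^2) * S := Finset.sum_mul_sq_le_sq_mul_sq _ _ _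
          _ ≤ (∑ i : Fin n, D^2/4) * S := by
              refine mul_le_mul_of_nonneg_right (Finset.sum_le_sum fun i _ => hl2 i) hS0
          _ = _ := by rw [Finset.sum_const, Finset.card_univ, Fintype.card_fin, nsmul_eq_mul]; ring
      have hq := hs5 y
      have hq' : ∑ i, ∑ j, ((schur M i j : ℤ) : ℝ) * y i * y j = D * NY - ℓ^2 := by
        rw [hℓ, sq, Finset.sum_mul_sum, hNY, Finset.mul_sum, ← Finset.sum_sub_distrib]
        refine Finset.sum_congr rfl fun i _ => ?_
        rw [Finset.mul_sum, ← Finset.sum_sub_distrib]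
        exact Finset.sum_congr rfl fun j _ => by simp only [schur]; push_cast; ring
      rw [hq'] at hq
      have hlow : D * (3 / (8*A)) * S ≤ ∑ i, h' i / (2 * D) * (y i:ℝ)^2 := by
        rw [hS, Finset.mul_sum]
        exact Finset.sum_le_sum fun i _ => mul_le_mul_of_nonneg_right (hH i) (sq_nonneg _)
      have hsum : ∑ i, h' i * (y i:ℝ)^2 = 2 * D * ∑ i, h' i / (2 * D) * (y i:ℝ)^2 := by
        rw [Finset.mul_sum]; exact Finset.sum_congr rfl fun i _ => by field_simp
      rw [hsum] at hq
      have e1 : ∑ i, ∑ j, (M i j : ℝ) * x i * x j = D * (x 0:ℝ)^2 + 2 * x 0 * ℓ + NY := by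
        simp only [Fin.sum_univ_succ, Finset.sum_add_distrib]
        have e2 : ∑ i : Fin n, (M 0 i.succ : ℝ) * x 0 * x i.succ = x 0 * ℓ := by
          rw [hℓ, Finset.mul_sum]; exact Finset.sum_congr rfl fun i _ => by simp only [hy]; ring
        have e3 : ∑ i : Fin n, (M i.succ 0 : ℝ) * x i.succ * x 0 = x 0 * ℓ := by
          rw [hℓ, Finset.mul_sum]; exact Finset.sum_congr rfl fun i _ => by rw [hN2.1 i.succ 0]; simp only [hy]; ring
        rw [e2, e3, ← hDd, ← hNY]; ring
      rw [e1, Fin.sum_univ_succ]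
      simp only [Fin.cons_zero, Fin.cons_succ]
      set Q := ∑ i, h' i / (2 * D) * (y i:ℝ)^2 with hQ
      change 3 / (8 * A * (n+1)) * D * (x 0:ℝ)^2 + Q ≤ _
      set δ := 3 / (8 * A * (n+1)) with hδd
      have hδn : δ * (n+1) = 3 / (8*A) := by rw [hδd]; field_simp
      have hδ0 : 0 < δ := by positivity
      have hδ1 : δ ≤ 1/2 := by
        refine hδ.trans ?_
        rw [div_le_div_iff₀ (by positivity) (by norm_num)]; linarith
      -- x0^2 D^2 ≤ 2 (D x0 + ℓ)^2 + 2 ℓ^2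
      have h7 : δ * (D * x 0)^2 ≤ (D * x 0 + ℓ)^2 + 2 * δ * ℓ^2 := by
        have h8 : (D * x 0)^2 ≤ 2 * (D * x 0 + ℓ)^2 + 2 * ℓ^2 := by nlinarith [sq_nonneg (D * x 0 + 2 * ℓ)]
        nlinarith [sq_nonneg (D * x 0 + ℓ)]
      have h9 : 2 * δ * ℓ^2 ≤ D * Q := by
        calc 2 * δ * ℓ^2 ≤ 2 * δ * (n * D^2 /4 * S) := by gcongr
          _ = (δ * n / 2) * D^2 * S := by ring
          _ ≤ (δ * (n+1)) * D^2 * S := by gcongr; nlinarith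
          _ = D * (D * (3 / (8*A)) * S) := by rw [hδn]; ring
          _ ≤ _ := by gcongr
      have h10 : D * (δ * D * (x 0:ℝ)^2 + Q) ≤ D * (D * (x 0:ℝ)^2 + 2 * x 0 * ℓ + NY) := by nlinarith
      exact le_of_mul_le_mul_left h10 hD0


lemma jac_cond (a b p : ℕ) [Fact p.Prime] (hab : Nat.Coprime a b) (ha4 : a % 4 = 1) (hb4 : b % 4 = 1)
    (hp4 : p % 4 = 1) (hpa : p ≡ b [MOD a]) (hpb : p ≡ a [MOD b]) :
    ∃ r : ZMod p, r * r = -((a : ZMod p) * b) := by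
  have hp : p.Prime := Fact.out
  have ha2 : Odd a := Nat.odd_iff.mpr (by omega)
  have hb2 : Odd b := Nat.odd_iff.mpr (by omega)
  have hp2 : Odd p := Nat.odd_iff.mpr (by omega)
  have h1 : jacobiSym a p = jacobiSym b a := by
    rw [jacobiSym.quadratic_reciprocity_one_mod_four ha4 hp2]
    rw [jacobiSym.mod_left, jacobiSym.mod_left (b:ℤ)]
    congr 1
    exact_mod_cast hpa
  have h2 : jacobiSym b p = jacobiSym a b := by
    rw [jacobiSym.quadratic_reciprocity_one_mod_four hb4 hp2]
    rw [jacobiSym.mod_left, jacobiSym.mod_left (a:ℤ)]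
    congr 1
    exact_mod_cast hpb
  have h3 : jacobiSym b a = jacobiSym a b := jacobiSym.quadratic_reciprocity_one_mod_four hb4 ha2
  have h4 : jacobiSym (-1) p = 1 := by
    rw [jacobiSym.at_neg_one hp2, ZMod.χ₄_nat_one_mod_four hp4]
  have h5 : jacobiSym (-((a:ℤ) * b)) p = 1 := by
    rw [neg_eq_neg_one_mul, jacobiSym.mul_left, jacobiSym.mul_left, h4, h1, h2, h3, one_mul]
    rw [← sq]
    exact jacobiSym.sq_one (by simpa [Int.gcd] using hab)
  rw [← jacobiSym.legendreSym.to_jacobiSym] at h5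
  have h6 : ((-((a:ℤ) * b) : ℤ) : ZMod p) ≠ 0 := by
    intro h
    rw [legendreSym.eq_zero_iff _ _ |>.mpr h] at h5
    norm_num at h5
  rw [legendreSym.eq_one_iff p h6] at h5
  obtain ⟨r, hr⟩ := h5
  exact ⟨r, by rw [← hr]; push_cast; rfl⟩

lemma legendre_solve (a b p : ℕ) (hab : Nat.Coprime a b) (ha4 : a % 4 = 1) (hb4 : b % 4 = 1)
    (hp : p.Prime) (hp4 : p % 4 = 1) (hpa : p ≡ b [MOD a]) (hpb : p ≡ a [MOD b])
    (hpa' : ¬ p ∣ a) (hpb' : ¬ p ∣ b) :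
    ∃ x y z : ℤ, z ≠ 0 ∧ a * x^2 + b * y^2 = p * z^2 := by
  haveI : Fact p.Prime := ⟨hp⟩
  obtain ⟨r, hr⟩ := jac_cond a b p hab ha4 hb4 hp4 hpa hpb
  have ha : 0 < a := by omega
  have hb : 0 < b := by omega
  have hp0 := hp.pos
  haveI : NeZero a := ⟨ha.ne'⟩
  haveI : NeZero b := ⟨hb.ne'⟩
  set X := Nat.sqrt (b * p)
  set Y := Nat.sqrt (a * p)
  set Z := Nat.sqrt (a * b - 1) + 1
  have hX1 : b * p < (X+1)*(X+1) := Nat.lt_succ_sqrt _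
  have hX2 : X * X ≤ b * p := Nat.sqrt_le _
  have hY1 : a * p < (Y+1)*(Y+1) := Nat.lt_succ_sqrt _
  have hY2 : Y * Y ≤ a * p := Nat.sqrt_le _
  have hZ1 : a * b ≤ Z * Z := by
    have : a * b - 1 < Z * Z := Nat.lt_succ_sqrt _
    omega
  have hZ2 : (Z-1) * (Z-1) < a * b := by
    have : (Z-1) * (Z-1) ≤ a * b - 1 := Nat.sqrt_le _
    have : 0 < a * b := by positivity
    omega
  have hcard : a * b * p < (X+1) * ((Y+1) * Z) := by
    have h1 : (a * b * p)^2 < ((X+1) * ((Y+1) * Z))^2 := by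
      calc (a * b * p)^2 = (b * p) * (a * p) * (a * b) := by ring
        _ < ((X+1)*(X+1)) * ((Y+1)*(Y+1)) * (Z * Z) := by
            apply Nat.mul_lt_mul_of_lt_of_le _ hZ1 (by positivity)
            exact Nat.mul_lt_mul'' hX1 hY1
        _ = _ := by ring
    exact lt_of_pow_lt_pow_left₀ 2 (by positivity) h1
  let φ : Fin (X+1) × Fin (Y+1) × Fin Z → ZMod a × ZMod b × ZMod p := fun w =>
    (((w.2.1:ℕ):ZMod a) - ((w.2.2 : ℕ) : ZMod a), ((w.1:ℕ):ZMod b) - ((w.2.2 : ℕ) : ZMod b),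
      (a : ZMod p) * ((w.1:ℕ) : ZMod p) - r * ((w.2.1 : ℕ) : ZMod p))
  obtain ⟨w, w', hne, heq⟩ := Fintype.exists_ne_map_eq_of_card_lt φ (by
    simp only [Fintype.card_prod, ZMod.card, Fintype.card_fin]
    rw [← mul_assoc]; exact hcard)
  obtain ⟨x1, y1, z1⟩ := w
  obtain ⟨x2, y2, z2⟩ := w'
  simp only [φ, Prod.mk.injEq] at heq
  obtain ⟨e1, e2, e3⟩ := heq
  set x : ℤ := (x1 : ℕ) - (x2 : ℕ) with hx
  set y : ℤ := (y1 : ℕ) - (y2 : ℕ) with hy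
  set z : ℤ := (z1 : ℕ) - (z2 : ℕ) with hz
  have hxb : x^2 ≤ b * p := by
    have h1 : |x| ≤ X := by
      rw [abs_le]; have := x1.2; have := x2.2; constructor <;> omega
    calc x^2 = |x|^2 := (sq_abs x).symm
      _ ≤ (X:ℤ)^2 := pow_le_pow_left₀ (abs_nonneg _) h1 2
      _ ≤ _ := by rw [sq]; exact_mod_cast hX2
  have hyb : y^2 ≤ a * p := by
    have h1 : |y| ≤ Y := by
      rw [abs_le]; have := y1.2; have := y2.2; constructor <;> omega
    calc y^2 = |y|^2 := (sq_abs y).symm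
      _ ≤ (Y:ℤ)^2 := pow_le_pow_left₀ (abs_nonneg _) h1 2
      _ ≤ _ := by rw [sq]; exact_mod_cast hY2
  have hzb : z^2 < a * b := by
    have h1 : |z| ≤ (Z-1 : ℕ) := by
      rw [abs_le]; have := z1.2; have := z2.2; constructor <;> omega
    calc z^2 = |z|^2 := (sq_abs z).symm
      _ ≤ ((Z-1 : ℕ):ℤ)^2 := pow_le_pow_left₀ (abs_nonneg _) h1 2
      _ < _ := by rw [sq]; exact_mod_cast hZ2
  have hxb' : x^2 ≠ b * p := by
    intro h
    have h1 : (p:ℤ) ∣ x := by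
      have : (p:ℤ) ∣ x^2 := ⟨b, by rw [h]; ring⟩
      exact (Nat.prime_iff_prime_int.mp hp).dvd_of_dvd_pow this
    obtain ⟨k, hk⟩ := h1
    apply hpb'
    have : (b:ℤ) = p * k^2 := by
      have h2 : (p:ℤ) * b = p * (p * k^2) := by rw [mul_comm, ← h, hk]; ring
      exact mul_left_cancel₀ (by exact_mod_cast hp0.ne') h2
    exact Int.natCast_dvd_natCast.mp ⟨_, this⟩
  have m1 : ((y:ℤ) : ZMod a) = z := by
    rw [hy, hz]; push_cast
    linear_combination e1
  have m2 : ((x:ℤ) : ZMod b) = z := by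
    rw [hx, hz]; push_cast
    linear_combination e2
  have m3 : (a : ZMod p) * ((x:ℤ) : ZMod p) = r * y := by
    rw [hx, hy]; push_cast
    linear_combination e3
  set Q : ℤ := a * x^2 + b * y^2 - p * z^2 with hQ
  have pa : ((p:ℕ) : ZMod a) = b := (ZMod.natCast_eq_natCast_iff _ _ _).mpr hpa
  have pb : ((p:ℕ) : ZMod b) = a := (ZMod.natCast_eq_natCast_iff _ _ _).mpr hpb
  have d1 : (a:ℤ) ∣ Q := by
    rw [← ZMod.intCast_zmod_eq_zero_iff_dvd, hQ]
    push_cast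
    rw [m1, pa]; simp
  have d2 : (b:ℤ) ∣ Q := by
    rw [← ZMod.intCast_zmod_eq_zero_iff_dvd, hQ]
    push_cast
    rw [m2, pb]; simp
  have d3 : (p:ℤ) ∣ Q := by
    rw [← ZMod.intCast_zmod_eq_zero_iff_dvd]
    have h1 : (a : ZMod p) * (Q : ZMod p) = 0 := by
      rw [hQ]; push_cast
      have : (a : ZMod p) * (a * (x:ZMod p)^2 + b * (y : ZMod p)^2 - (p : ZMod p) * (z:ZMod p)^2)
        = (a * (x:ZMod p))^2 + a * b * (y : ZMod p)^2 - a * (p : ZMod p) * (z:ZMod p)^2 := by ring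
      rw [this, m3]
      have h2 : ((p:ℕ) : ZMod p) = 0 := ZMod.natCast_self p
      rw [h2]
      linear_combination (y : ZMod p)^2 * hr
    rcases mul_eq_zero.mp h1 with h | h
    · exact absurd ((ZMod.natCast_eq_zero_iff _ _).mp h) hpa'
    · exact h
  have cop1 : IsCoprime (a:ℤ) b := Nat.isCoprime_iff_coprime.mpr hab
  have cop2 : IsCoprime ((a:ℤ) * b) p := by
    have : Nat.Coprime (a * b) p := by
      apply Nat.Coprime.mul_left
      · exact ((Nat.Prime.coprime_iff_not_dvd hp).mpr hpa').symm
      · exact ((Nat.Prime.coprime_iff_not_dvd hp).mpr hpb').symm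
    have := Nat.isCoprime_iff_coprime.mpr this
    simpa using this
  have d4 : ((a:ℤ) * b * p) ∣ Q := cop2.mul_dvd (cop1.mul_dvd d1 d2) d3
  obtain ⟨k, hk⟩ := d4
  have haZ : (0:ℤ) < a := by exact_mod_cast ha
  have hbZ : (0:ℤ) < b := by exact_mod_cast hb
  have hpZ : (0:ℤ) < p := by exact_mod_cast hp0
  have habp : (0:ℤ) < (a:ℤ) * b * p := by positivity
  have hlt : Q < (a:ℤ) * b * p * 2 := by
    have h1 : a * x^2 < (a:ℤ) * (b * p) := mul_lt_mul_of_pos_left (lt_of_le_of_ne hxb hxb') haZ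
    have h2 : b * y^2 ≤ (b:ℤ) * (a * p) := mul_le_mul_of_nonneg_left hyb hbZ.le
    have h3 : 0 ≤ (p:ℤ) * z^2 := by positivity
    rw [hQ]; nlinarith
  have hgt : (a:ℤ) * b * p * (-1) < Q := by
    have h1 : p * z^2 < (p:ℤ) * (a * b) := mul_lt_mul_of_pos_left hzb hpZ
    have h3 : 0 ≤ (a:ℤ) * x^2 := by positivity
    have h4 : 0 ≤ (b:ℤ) * y^2 := by positivity
    rw [hQ]; nlinarith
  rw [hk] at hlt hgt
  have hk1 := lt_of_mul_lt_mul_left hlt habp.le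
  have hk2 := lt_of_mul_lt_mul_left hgt habp.le
  have : k = 0 ∨ k = 1 := by omega
  rcases this with rfl | rfl
  · refine ⟨x, y, z, ?_, by linarith⟩
    intro hz0
    have h0 : a * x^2 + b * y^2 = 0 := by rw [hz0] at hQ; linarith
    have h1 : 0 ≤ (a:ℤ) * x^2 := by positivity
    have h2 : 0 ≤ (b:ℤ) * y^2 := by positivity
    have hx0 : x = 0 := by
      have : (a:ℤ) * x^2 = 0 := by linarith
      simpa [ha.ne'] using this
    have hy0 : y = 0 := by
      have : (b:ℤ) * y^2 = 0 := by linarith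
      simpa [hb.ne'] using this
    apply hne
    have hx' : x1 = x2 := Fin.ext (by omega)
    have hy' : y1 = y2 := Fin.ext (by omega)
    have hz' : z1 = z2 := Fin.ext (by omega)
    rw [hx', hy', hz']
  · refine ⟨x * z + b * y, y * z - a * x, z^2 + a * b, by positivity, ?_⟩
    have h1 : a * x^2 + b * y^2 = p * (z^2 + a * b) := by linarith
    linear_combination (z^2 + (a:ℤ) * b) * h1


section frames
variable {L : Type*} [AddCommGroup L] (B : LinearMap.BilinForm ℤ L)

lemma bil_sum {ι κ : Type*} (s : Finset ι) (t : Finset κ) (c : ι → ℤ) (d : κ → ℤ) (g : ι → L) (g' : κ → L) :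
    B (∑ k ∈ s, c k • g k) (∑ l ∈ t, d l • g' l) = ∑ k ∈ s, ∑ l ∈ t, c k * d l * B (g k) (g' l) := by
  simp only [map_sum, LinearMap.sum_apply, map_smul, LinearMap.smul_apply, smul_eq_mul, Finset.mul_sum]
  rw [Finset.sum_comm]
  refine Finset.sum_congr rfl fun i _ => Finset.sum_congr rfl fun j _ => by ring

lemma bil_sum_orth {ι : Type*} [Fintype ι] (c d : ι → ℤ) (g : ι → L) (hg : ∀ i j, i ≠ j → B (g i) (g j) = 0) :
    B (∑ k, c k • g k) (∑ l, d l • g l) = ∑ k, c k * d k * B (g k) (g k) := by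
  rw [bil_sum]
  refine Finset.sum_congr rfl fun i _ => ?_
  rw [Finset.sum_eq_single i]
  · intro j _ hj; rw [hg i j hj.symm, mul_zero]
  · simp

lemma span_orth (S T : Set L) (h : ∀ x ∈ S, ∀ y ∈ T, B x y = 0) {x y : L}
    (hx : x ∈ Submodule.span ℤ S) (hy : y ∈ Submodule.span ℤ T) : B x y = 0 := by
  have h1 : ∀ x ∈ S, B x y = 0 := by
    intro x hxS
    have : Submodule.span ℤ T ≤ LinearMap.ker (B x) := by
      rw [Submodule.span_le]; intro z hz; exact h x hxS z hz
    exact this hy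
  have : Submodule.span ℤ S ≤ LinearMap.ker (B.flip y) := by
    rw [Submodule.span_le]; intro z hz; exact h1 z hz
  exact this hx

lemma b1_step (e : ℕ → L) (ho : ∀ i j, i ≠ j → B (e i) (e j) = 0) (hp : ∀ i, 0 < B (e i) (e i))
    (R N0 : ℕ) (hR : 0 < R) : ∃ (N1 : ℕ) (v : L) (s α : ℕ), N0 ≤ N1 ∧ v ∈ Submodule.span ℤ (e '' Set.Ico N0 N1) ∧
      0 < s ∧ B v v = s^2 * α ∧ α % 4 = 1 ∧ Nat.Coprime α R := by
  have hsf : ∀ i, ∃ b a : ℕ, B (e i) (e i) = (b:ℤ)^2 * a ∧ Squarefree a ∧ 0 < b := by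
    intro i
    obtain ⟨a, b, hab, ha⟩ := Nat.sq_mul_squarefree (B (e i) (e i)).toNat
    have h1 : ((B (e i) (e i)).toNat : ℤ) = B (e i) (e i) := Int.toNat_of_nonneg (hp i).le
    refine ⟨b, a, ?_, ha, ?_⟩
    · rw [← h1, ← hab]; push_cast; ring
    · rcases Nat.eq_zero_or_pos b with h | h
      · subst h; have := hp i; rw [← h1, ← hab] at this; simp at this
      · exact h
  choose b a hab hsq hb using hsf
  set R2 := 2 * R with hR2
  let h : ℕ → ℕ := fun i => Nat.gcd (a i) R2
  let u : ℕ → ℕ := fun i => a i / h i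
  have hhu : ∀ i, a i = h i * u i := fun i => (Nat.mul_div_cancel' (Nat.gcd_dvd_left _ _)).symm
  have hhR : ∀ i, h i ∣ R2 := fun i => Nat.gcd_dvd_right _ _
  have huR : ∀ i, Nat.Coprime (u i) R2 := by
    intro i
    have h1 : Nat.Coprime (h i) (u i) := by
      have := hsq i; rw [hhu i, Nat.squarefree_mul_iff] at this; exact this.1
    have h2 : Nat.gcd (u i) R2 ∣ h i := Nat.dvd_gcd ((Nat.gcd_dvd_left _ _).trans ⟨h i, by rw [hhu i]; ring⟩) (Nat.gcd_dvd_right _ _)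
    have h3 : Nat.gcd (u i) R2 ∣ Nat.gcd (h i) (u i) := Nat.dvd_gcd h2 (Nat.gcd_dvd_left _ _)
    rw [h1] at h3
    exact Nat.dvd_one.mp h3
  haveI : NeZero (4 * R2^2) := ⟨by positivity⟩
  let φ : ℕ → Fin (R2+1) × ZMod (4 * R2^2) := fun i =>
    (⟨h (N0 + i), Nat.lt_succ_of_le (Nat.le_of_dvd (by omega) (hhR _))⟩, (u (N0+i) : ZMod (4 * R2^2)))
  obtain ⟨c, hc⟩ := Finite.exists_infinite_fiber φ
  have hc' : (φ ⁻¹' {c}).Infinite := Set.infinite_coe_iff.mp hc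
  let f : ℕ → ℕ := fun k => N0 + Nat.nth (· ∈ φ ⁻¹' {c}) k
  have hf : ∀ k, φ (Nat.nth (· ∈ φ ⁻¹' {c}) k) = c := fun k => Nat.nth_mem_of_infinite hc' k
  have hfinj : ∀ k l, k ≠ l → f k ≠ f l := fun k l hkl h => hkl (Nat.nth_injective hc' (by simpa [f] using h))
  have hfh : ∀ k, h (f k) = h (f 0) := by
    intro k
    have := (congrArg (fun t => (t.1 : ℕ)) ((hf k).trans (hf 0).symm))
    exact this
  have hfu : ∀ k, (4 * R2^2 : ℤ) ∣ (u (f k) : ℤ) - u (f 0) := by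
    intro k
    have : ((u (f k) : ℕ) : ZMod (4 * R2^2)) = (u (f 0) : ℕ) := congrArg (fun t => t.2) ((hf k).trans (hf 0).symm)
    have h2 := (ZMod.intCast_eq_intCast_iff_dvd_sub (u (f 0)) (u (f k)) (4 * R2^2)).mp (by push_cast; exact this.symm)
    push_cast at h2; exact h2
  set u0 := u (f 0) with hu0
  set h0 := h (f 0) with hh0
  have hh0pos : 0 < h0 := Nat.pos_of_dvd_of_pos (hhR _) (by omega)
  obtain ⟨x, hx⟩ := four_sq ((u0 * h0 : ℕ) : ℤ) (by positivity)
  choose t ht using hfu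
  obtain ⟨R', hR'⟩ : h0 ∣ R2 := hhR _
  let bb : Fin 4 → ℤ := fun k => b (f k)
  let cc : Fin 4 → ℤ := fun k => ∏ j ∈ Finset.univ.erase k, bb j
  have hcb : ∀ k, cc k * bb k = ∏ j, bb j := fun k => Finset.prod_erase_mul _ _ (Finset.mem_univ k)
  set P : ℤ := ∏ j, bb j with hP
  have hPpos : 0 < P := Finset.prod_pos fun j _ => by have := hb (f j); simp only [bb]; exact_mod_cast this
  set αZ : ℤ := u0^2 + 4 * R2 * (R' * ∑ k : Fin 4, x k * x k * t k) with hα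
  have hnorm : B (∑ k : Fin 4, (x k * cc k) • e (f k)) (∑ k : Fin 4, (x k * cc k) • e (f k)) = (P * h0)^2 * αZ := by
    rw [bil_sum_orth B _ _ (fun k : Fin 4 => e (f k)) (fun i j hij => ho _ _ (hfinj _ _ (fun h => hij (Fin.ext h))))]
    have e1 : ∀ k : Fin 4, x k * cc k * (x k * cc k) * B (e (f k)) (e (f k)) =
        P^2 * h0 * (x k * x k) * u0 + P^2 * h0 * (4 * R2^2) * (x k * x k * t k) := by
      intro k
      rw [hab, hhu, hfh k, ← hcb k]
      have : (u (f k) : ℤ) = u0 + 4 * R2^2 * t k := by have := ht k; linarith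
      push_cast
      rw [this]; simp only [bb]; ring
    rw [Finset.sum_congr rfl fun k _ => e1 k, Finset.sum_add_distrib, ← Finset.mul_sum, ← Finset.sum_mul, ← Finset.mul_sum, hx, hα]
    push_cast
    have : (R2:ℤ) = h0 * R' := by exact_mod_cast hR'
    rw [this]
    ring
  have hαpos : 0 < αZ := by
    by_contra hcon
    have h1 : αZ % 4 = 1 := by
      have hodd : u0 % 2 = 1 := by
        have := huR (f 0)
        rw [hR2] at this
        have := Nat.Coprime.coprime_mul_right_right this
        exact Nat.odd_iff.mp (Nat.coprime_two_right.mp this)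
      have h2 : ((u0:ℤ)^2) % 4 = 1 := by
        have : ((u0 : ℤ)) % 4 = 1 ∨ (u0:ℤ) % 4 = 3 := by omega
        rcases this with h | h <;> simp [pow_two, Int.mul_emod, h]
      rw [hα];
      have : ((u0:ℤ)^2 + 4 * R2 * (R' * ∑ k : Fin 4, x k * x k * t k)) % 4 = (u0:ℤ)^2 % 4 := by
        rw [mul_assoc]; exact Int.add_mul_emod_self_left _ _ _
      rw [this, h2]
    have h0' : αZ ≠ 0 := by intro h; rw [h] at h1; norm_num at h1
    have h3 : αZ < 0 := lt_of_le_of_ne (not_lt.mp hcon) h0'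
    have h4 : B (∑ k : Fin 4, (x k * cc k) • e (f k)) (∑ k : Fin 4, (x k * cc k) • e (f k)) < 0 := by
      rw [hnorm]
      have : (0:ℤ) < h0 := by exact_mod_cast hh0pos
      have : 0 < (P * h0)^2 := by positivity
      exact mul_neg_of_pos_of_neg this h3
    rw [bil_sum_orth B _ _ (fun k : Fin 4 => e (f k)) (fun i j hij => ho _ _ (hfinj _ _ (fun h => hij (Fin.ext h))))] at h4
    apply absurd h4 (not_lt.mpr _)
    exact Finset.sum_nonneg fun k _ => mul_nonneg (mul_self_nonneg _) (hp _).le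
  have hαZ : ((αZ.toNat : ℕ) : ℤ) = αZ := Int.toNat_of_nonneg hαpos.le
  have hPZ : ((P.toNat : ℕ) : ℤ) = P := Int.toNat_of_nonneg hPpos.le
  refine ⟨(∑ k : Fin 4, f k) + 1 + N0, ∑ k : Fin 4, (x k * cc k) • e (f k), P.toNat * h0, αZ.toNat, by omega, ?_, ?_, ?_, ?_, ?_⟩
  · refine Submodule.sum_mem _ fun k _ => Submodule.smul_mem _ _ (Submodule.subset_span ⟨f k, ?_, rfl⟩)
    refine ⟨Nat.le_add_right _ _, ?_⟩
    have := Finset.single_le_sum (f := fun k : Fin 4 => f k) (fun i _ => Nat.zero_le _) (Finset.mem_univ k)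
    omega
  · have : 0 < P.toNat := by omega
    positivity
  · rw [hnorm]; push_cast; rw [hαZ, hPZ]
  · have hodd : u0 % 2 = 1 := by
      have := huR (f 0)
      rw [hR2] at this
      have := Nat.Coprime.coprime_mul_right_right this
      exact Nat.odd_iff.mp (Nat.coprime_two_right.mp this)
    have h2 : ((u0:ℤ)^2) % 4 = 1 := by
      have : ((u0 : ℤ)) % 4 = 1 ∨ (u0:ℤ) % 4 = 3 := by omega
      rcases this with h | h <;> simp [pow_two, Int.mul_emod, h]
    have : αZ % 4 = 1 := by
      rw [hα, mul_assoc, Int.add_mul_emod_self_left, h2]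
    omega
  · have h1 : IsCoprime αZ (R2 : ℤ) := by
      have h2 : IsCoprime ((u0:ℤ)^2) (R2:ℤ) := (Nat.isCoprime_iff_coprime.mpr (huR (f 0))).pow_left
      rw [hα]
      have : (u0:ℤ)^2 + 4 * R2 * (R' * ∑ k : Fin 4, x k * x k * t k) = (u0:ℤ)^2 + R2 * (4 * (R' * ∑ k : Fin 4, x k * x k * t k)) := by ring
      rw [this]
      exact IsCoprime.add_mul_left_left h2 _
    rw [← hαZ] at h1
    have := Nat.isCoprime_iff_coprime.mp h1
    rw [hR2] at this
    exact Nat.Coprime.coprime_mul_left_right this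

lemma b1_seq (e : ℕ → L) (ho : ∀ i j, i ≠ j → B (e i) (e j) = 0) (hp : ∀ i, 0 < B (e i) (e i)) (K : ℕ) :
    ∃ (N : ℕ) (v : ℕ → L) (s α : ℕ → ℕ), (∀ i < K, v i ∈ Submodule.span ℤ (e '' Set.Iio N)) ∧
      (∀ i < K, 0 < s i ∧ B (v i) (v i) = (s i)^2 * α i ∧ α i % 4 = 1) ∧
      (∀ i < K, ∀ j < K, i ≠ j → B (v i) (v j) = 0 ∧ Nat.Coprime (α i) (α j)) := by
  induction K with
  | zero => exact ⟨0, fun _ => 0, fun _ => 0, fun _ => 0, by simp, by simp, by simp⟩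
  | succ K ih =>
    obtain ⟨N, v, s, α, h1, h2, h3⟩ := ih
    have hR : 0 < ∏ i ∈ Finset.range K, α i := Finset.prod_pos fun i hi => by
      have := (h2 i (Finset.mem_range.mp hi)).2.2; omega
    obtain ⟨N1, w, s', α', hN, hw, hs', hn, hα4, hcop⟩ := b1_step B e ho hp _ N hR
    have hcop' : ∀ i < K, Nat.Coprime α' (α i) := fun i hi =>
      Nat.Coprime.coprime_dvd_right (Finset.dvd_prod_of_mem _ (Finset.mem_range.mpr hi)) hcop
    have horth : ∀ i < K, B (v i) w = 0 ∧ B w (v i) = 0 := by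
      intro i hi
      constructor
      · refine span_orth B _ _ ?_ (h1 i hi) hw
        rintro _ ⟨a, ha, rfl⟩ _ ⟨b, hb, rfl⟩
        exact ho _ _ (by simp at ha hb; omega)
      · refine span_orth B _ _ ?_ hw (h1 i hi)
        rintro _ ⟨a, ha, rfl⟩ _ ⟨b, hb, rfl⟩
        exact ho _ _ (by simp at ha hb; omega)
    refine ⟨N1, fun i => if i < K then v i else w, fun i => if i < K then s i else s', fun i => if i < K then α i else α', ?_, ?_, ?_⟩
    · intro i hi
      by_cases h : i < K
      · simp only [h, if_true]
        exact Submodule.span_mono (Set.image_mono (Set.Iio_subset_Iio hN)) (h1 i h)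
      · simp only [h, if_false]
        exact Submodule.span_mono (Set.image_mono Set.Ico_subset_Iio_self) hw
    · intro i hi
      by_cases h : i < K
      · simp only [h, if_true]; exact h2 i h
      · simp only [h, if_false]; exact ⟨hs', hn, hα4⟩
    · intro i hi j hj hij
      by_cases h : i < K <;> by_cases h' : j < K
      · simp only [h, h', if_true]; exact h3 i h j h' hij
      · simp only [h, h', if_true, if_false]; exact ⟨(horth i h).1, (hcop' i h).symm⟩
      · simp only [h, h', if_true, if_false]; exact ⟨(horth j h').2, hcop' j h'⟩
      · omega

/-- Existence of frames -/
theorem frames (e : ℕ → L) (ho : ∀ i j, i ≠ j → B (e i) (e j) = 0) (hp : ∀ i, 0 < B (e i) (e i)) (K : ℕ) :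
    ∃ (c : ℕ) (f : Fin K → L), 0 < c ∧ (∀ i, B (f i) (f i) = c) ∧ ∀ i j, i ≠ j → B (f i) (f j) = 0 := by
  obtain ⟨N, v, s, α, -, h2, h3⟩ := b1_seq B e ho hp (2 * K)
  let β : ℕ → ℕ := fun i => α (if i % 2 = 0 then i + 1 else i - 1)
  have hα0 : ∀ i < 2 * K, 0 < α i := fun i hi => by have := (h2 i hi).2.2; omega
  have hpart : ∀ i < 2 * K, (if i % 2 = 0 then i + 1 else i - 1) < 2 * K ∧ (if i % 2 = 0 then i + 1 else i - 1) ≠ i := by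
    intro i hi
    split_ifs with h <;> omega
  obtain ⟨k, hk⟩ := Nat.chineseRemainderOfFinset β α (Finset.range (2*K))
    (fun i hi => (hα0 i (Finset.mem_range.mp hi)).ne')
    (fun i hi j hj hij => (h3 i (by simpa using hi) j (by simpa using hj) hij).2)
  set Q := ∏ i ∈ Finset.range (2*K), α i with hQ
  have hQ0 : 0 < Q := Finset.prod_pos fun i hi => hα0 i (Finset.mem_range.mp hi)
  have hQ4 : Nat.Coprime Q 4 := by
    apply Nat.Coprime.prod_left
    intro i hi
    have := (h2 i (Finset.mem_range.mp hi)).2.2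
    have h' : Nat.Coprime (α i) (2^2) := Nat.Coprime.pow_right _ (Nat.coprime_two_right.mpr (Nat.odd_iff.mpr (by omega)))
    exact h'
  obtain ⟨m, hm1, hm2⟩ := Nat.chineseRemainder hQ4 k 1
  have hmcop : Nat.Coprime m (Q * 4) := by
    apply Nat.Coprime.mul_right
    · apply Nat.Coprime.prod_right
      intro i hi
      have hi' := Finset.mem_range.mp hi
      have e1 : m ≡ β i [MOD α i] := (hm1.of_dvd (Finset.dvd_prod_of_mem _ hi)).trans (hk i hi)
      have : Nat.Coprime (β i) (α i) := (h3 _ (hpart i hi').1 i hi' (hpart i hi').2).2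
      rw [Nat.Coprime, e1.gcd_eq]; exact this
    · rw [Nat.Coprime, hm2.gcd_eq]; norm_num
  haveI : NeZero (Q * 4) := ⟨by positivity⟩
  obtain ⟨p, hpQ, hpp, hpm⟩ := Nat.forall_exists_prime_gt_and_modEq Q (by positivity : Q * 4 ≠ 0) hmcop
  have hp4 : p % 4 = 1 := by
    have := (hpm.of_dvd (Dvd.intro_left _ rfl)).trans hm2
    simpa [Nat.ModEq] using this
  have hpβ : ∀ i < 2 * K, p ≡ β i [MOD α i] := fun i hi =>
    (hpm.of_dvd ((Finset.dvd_prod_of_mem _ (Finset.mem_range.mpr hi)).mul_right 4)).trans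
      ((hm1.of_dvd (Finset.dvd_prod_of_mem _ (Finset.mem_range.mpr hi))).trans (hk i (Finset.mem_range.mpr hi)))
  have hpnd : ∀ i < 2 * K, ¬ p ∣ α i := fun i hi h => by
    have h1 := Nat.le_of_dvd (hα0 i hi) h
    have h2 := Nat.le_of_dvd hQ0 (Finset.dvd_prod_of_mem α (Finset.mem_range.mpr hi))
    omega
  have hsolve : ∀ i : Fin K, ∃ x y z : ℤ, z ≠ 0 ∧ α (2*i) * x^2 + α (2*i+1) * y^2 = p * z^2 := by
    intro i
    have hi := i.2
    have b1 := hpβ (2*i) (by omega)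
    have b2 := hpβ (2*i+1) (by omega)
    simp only [β] at b1 b2
    rw [if_pos (by omega)] at b1
    rw [if_neg (by omega)] at b2
    exact legendre_solve _ _ p (h3 (2*i) (by omega) (2*i+1) (by omega) (by omega)).2 (h2 _ (by omega)).2.2 (h2 _ (by omega)).2.2 hpp hp4
      b1 b2 (hpnd _ (by omega)) (hpnd _ (by omega))
  choose x y z hz hxyz using hsolve
  let w : Fin K → L := fun i => (x i * s (2*i+1)) • v (2*i) + (y i * s (2*i)) • v (2*i+1)
  let τ : Fin K → ℤ := fun i => s (2*i) * s (2*i+1) * z i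
  have hτ : ∀ i, τ i ≠ 0 := fun i => by
    have h1 := (h2 (2*i) (by omega)).1
    have h2 := (h2 (2*i+1) (by omega)).1
    have := hz i
    simp only [τ]
    refine mul_ne_zero (mul_ne_zero ?_ ?_) this <;> exact_mod_cast (by omega)
  have hwn : ∀ i, B (w i) (w i) = τ i ^2 * p := by
    intro i
    have hi := i.2
    have e1 := (h2 (2*i) (by omega)).2.1
    have e2 := (h2 (2*i+1) (by omega)).2.1
    have e3 := (h3 (2*i) (by omega) (2*i+1) (by omega) (by omega)).1
    have e4 := (h3 (2*i+1) (by omega) (2*i) (by omega) (by omega)).1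
    simp only [w, map_add, LinearMap.add_apply, map_smul, LinearMap.smul_apply, smul_eq_mul, e1, e2, e3, e4, τ]
    linear_combination ((s (2*i) : ℤ) * s (2*i+1))^2 * hxyz i
  have hwo : ∀ i j, i ≠ j → B (w i) (w j) = 0 := by
    intro i j hij
    have hi := i.2
    have hj := j.2
    have hij' : (i:ℕ) ≠ j := fun h => hij (Fin.ext h)
    have e1 := (h3 (2*i) (by omega) (2*j) (by omega) (by omega)).1
    have e2 := (h3 (2*i) (by omega) (2*j+1) (by omega) (by omega)).1
    have e3 := (h3 (2*i+1) (by omega) (2*j) (by omega) (by omega)).1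
    have e4 := (h3 (2*i+1) (by omega) (2*j+1) (by omega) (by omega)).1
    simp only [w, map_add, LinearMap.add_apply, map_smul, LinearMap.smul_apply, smul_eq_mul, e1, e2, e3, e4]
    ring
  let cc : Fin K → ℤ := fun k => ∏ j ∈ Finset.univ.erase k, τ j
  have hcb : ∀ k, cc k * τ k = ∏ j, τ j := fun k => Finset.prod_erase_mul _ _ (Finset.mem_univ k)
  set P : ℤ := ∏ j, τ j with hP
  have hP0 : P ≠ 0 := Finset.prod_ne_zero_iff.mpr fun i _ => hτ i
  have hpos : (0:ℤ) < P^2 * p := by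
    have : (0:ℤ) < p := by exact_mod_cast hpp.pos
    positivity
  refine ⟨(P^2 * p).toNat, fun i => cc i • w i, by omega, ?_, ?_⟩
  · intro i
    rw [Int.toNat_of_nonneg hpos.le, ← hcb i]
    simp only [map_smul, LinearMap.smul_apply, smul_eq_mul, hwn]
    ring
  · intro i j hij
    simp only [map_smul, LinearMap.smul_apply, smul_eq_mul, hwo i j hij, mul_zero]

end frames


theorem hr_mat (r : ℕ) : ∃ (ι : Type) (_ : Fintype ι) (_ : DecidableEq ι) (J : Fin r → Matrix ι ι ℤ),
    Fintype.card ι = 2^r ∧ (∀ k, (J k)ᵀ = - J k) ∧ (∀ k, J k * J k = -1) ∧ ∀ k l, k ≠ l → J k * J l = - (J l * J k) := by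
  induction r with
  | zero => exact ⟨Unit, inferInstance, inferInstance, fun i => i.elim0, by simp, fun i => i.elim0, fun i => i.elim0, fun i => i.elim0⟩
  | succ r ih =>
    obtain ⟨ι, _, _, J, hc, h1, h2, h3⟩ := ih
    refine ⟨ι ⊕ ι, inferInstance, inferInstance,
      Fin.cons (fromBlocks 0 (-1) 1 0) (fun k => fromBlocks (J k) 0 0 (-(J k))), ?_, ?_, ?_, ?_⟩
    · rw [Fintype.card_sum, hc]; ring
    · intro k
      refine Fin.cases ?_ (fun k => ?_) k
      · simp [fromBlocks_transpose, fromBlocks_neg]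
      · simp [fromBlocks_transpose, fromBlocks_neg, h1]
    · intro k
      have h1' : (-1 : Matrix (ι ⊕ ι) (ι ⊕ ι) ℤ) = fromBlocks (-1) 0 0 (-1) := by
        rw [← fromBlocks_one, fromBlocks_neg]; simp
      refine Fin.cases ?_ (fun k => ?_) k
      · simp [fromBlocks_multiply, h1']
      · simp [fromBlocks_multiply, h1', h2]
    · intro k l
      refine Fin.cases ?_ (fun k => ?_) k <;> refine Fin.cases ?_ (fun l => ?_) l
      · simp
      · intro _; simp [fromBlocks_multiply, fromBlocks_neg]
      · intro _; simp [fromBlocks_multiply, fromBlocks_neg]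
      · intro hkl
        have := h3 k l (fun h => hkl (by rw [h]))
        simp [fromBlocks_multiply, fromBlocks_neg, this]

theorem hr (r : ℕ) : ∃ (ι : Type) (_ : Fintype ι) (_ : DecidableEq ι) (J : Fin r → Matrix ι ι ℤ),
    Fintype.card ι = 2^r ∧ ∀ (x : ι → ℤ) k l, (J k *ᵥ x) ⬝ᵥ (J l *ᵥ x) = if k = l then x ⬝ᵥ x else 0 := by
  obtain ⟨ι, i1, i2, J, hc, h1, h2, h3⟩ := hr_mat r
  refine ⟨ι, i1, i2, J, hc, fun x k l => ?_⟩
  have e : ∀ k l, (J k *ᵥ x) ⬝ᵥ (J l *ᵥ x) = - (x ⬝ᵥ ((J k * J l) *ᵥ x)) := by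
    intro k l
    rw [← Matrix.vecMul_transpose, ← Matrix.dotProduct_mulVec, Matrix.mulVec_mulVec, h1 k, Matrix.neg_mul, Matrix.neg_mulVec, dotProduct_neg]
  split_ifs with h
  · subst h
    rw [e, h2, Matrix.neg_mulVec, Matrix.one_mulVec, dotProduct_neg, neg_neg]
  · have a1 := e k l
    have a2 := e l k
    rw [dotProduct_comm] at a2
    rw [h3 k l h, Matrix.neg_mulVec, dotProduct_neg] at a1
    omega

/-- kernel not totally isotropic mod ℓ -/
lemma ker_not_iso {ν ι : Type} [Fintype ν] [Fintype ι] [DecidableEq ι] (C : Matrix ν ι ℤ)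
    (hc : 2 * Fintype.card ν < Fintype.card ι) (ℓ : ℕ) (hℓ : ℓ.Prime) :
    ∃ x y : ι → ℤ, C *ᵥ x = 0 ∧ C *ᵥ y = 0 ∧ ¬ (ℓ:ℤ) ∣ x ⬝ᵥ y := by
  by_contra hcon
  push Not at hcon
  haveI : Fact ℓ.Prime := ⟨hℓ⟩
  set M := LinearMap.ker (Matrix.mulVecLin C) with hM
  have hfr : Fintype.card ι ≤ Module.finrank ℤ M + Fintype.card ν := by
    have h1 := Submodule.finrank_quotient_add_finrank (LinearMap.ker (Matrix.mulVecLin C))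
    rw [LinearEquiv.finrank_eq (Matrix.mulVecLin C).quotKerEquivRange] at h1
    have h2 : Module.finrank ℤ (LinearMap.range (Matrix.mulVecLin C)) ≤ Fintype.card ν := by
      have := Submodule.finrank_le (LinearMap.range (Matrix.mulVecLin C))
      simpa using this
    rw [Module.finrank_fintype_fun_eq_card, ← hM] at h1
    omega
  set k := Module.finrank ℤ M with hk
  let b := Module.finBasis ℤ M
  let D : Matrix (Fin k) ι (ZMod ℓ) := fun i j => (((b i : ι → ℤ) j : ℤ) : ZMod ℓ)
  have hD0 : D * Dᵀ = 0 := by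
    ext i j
    rw [Matrix.mul_apply]
    have h1 := hcon (b i : ι → ℤ) (b j : ι → ℤ) (b i).2 (b j).2
    rw [← ZMod.intCast_zmod_eq_zero_iff_dvd] at h1
    simp only [dotProduct] at h1
    push_cast at h1
    exact h1
  have hli : LinearIndependent (ZMod ℓ) D := by
    rw [Fintype.linearIndependent_iff]
    intro g hg
    choose g' hg' using fun i => ZMod.intCast_surjective (g i)
    have h1 : ∀ j, ∃ z : ℤ, (∑ i, g' i • (b i : ι → ℤ)) j = ℓ * z := by
      intro j
      have h2 := congrFun hg j
      have : (((∑ i, g' i • (b i : ι → ℤ)) j : ℤ) : ZMod ℓ) = 0 := by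
        refine Eq.trans ?_ h2
        simp only [Finset.sum_apply, Pi.smul_apply, smul_eq_mul]
        push_cast
        simp only [hg']
      rw [ZMod.intCast_zmod_eq_zero_iff_dvd] at this
      exact this
    choose z hz using h1
    have hzM : z ∈ M := by
      rw [hM, LinearMap.mem_ker, Matrix.mulVecLin_apply]
      have h3 : (∑ i, g' i • (b i : ι → ℤ)) = (ℓ:ℤ) • z := by ext j; rw [hz j]; rfl
      have h4 : (∑ i, g' i • (b i : ι → ℤ)) ∈ M := Submodule.sum_mem _ fun i _ => Submodule.smul_mem _ _ (b i).2
      rw [h3, hM, LinearMap.mem_ker, Matrix.mulVecLin_apply, Matrix.mulVec_smul] at h4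
      rcases smul_eq_zero.mp h4 with h | h
      · exact absurd h (by exact_mod_cast hℓ.ne_zero)
      · exact h
    have h5 : ∑ i, g' i • b i = (ℓ:ℤ) • (⟨z, hzM⟩ : M) := by
      apply Subtype.ext
      ext j
      simp only [Submodule.coe_sum, Submodule.coe_smul]
      rw [hz j]; rfl
    intro i
    have h6 := congrArg (fun t => b.repr t i) h5
    simp only [map_smul, Finsupp.smul_apply] at h6
    rw [b.repr_sum_self] at h6
    rw [← hg' i, h6]
    simp
  have hrank : D.rank = k := by
    rw [LinearIndependent.rank_matrix hli]; simp
  have := Matrix.rank_add_rank_le_card_of_mul_eq_zero hD0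
  rw [Matrix.rank_transpose, hrank] at this
  omega

lemma ker_prime {ν ι : Type} [Fintype ν] [Fintype ι] [DecidableEq ι] (C : Matrix ν ι ℤ)
    (hc : 2 * Fintype.card ν < Fintype.card ι) (ℓ : ℕ) (hℓ : ℓ.Prime) :
    ∃ x : ι → ℤ, C *ᵥ x = 0 ∧ ¬ (ℓ:ℤ)^2 ∣ x ⬝ᵥ x := by
  by_contra hcon
  push Not at hcon
  obtain ⟨x, y, hx, hy, hxy⟩ := ker_not_iso C hc ℓ hℓ
  have h1 := hcon x hx
  have h2 := hcon y hy
  have h3 := hcon (x + y) (by rw [Matrix.mulVec_add, hx, hy, add_zero])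
  have h4 : (ℓ:ℤ)^2 ∣ 2 * (x ⬝ᵥ y) := by
    have e : 2 * (x ⬝ᵥ y) = (x+y) ⬝ᵥ (x+y) - x ⬝ᵥ x - y ⬝ᵥ y := by
      simp only [add_dotProduct, dotProduct_add]; rw [dotProduct_comm y x]; ring
    rw [e]; exact dvd_sub (dvd_sub h3 h1) h2
  apply hxy
  have hpr : Prime (ℓ:ℤ) := Nat.prime_iff_prime_int.mp hℓ
  obtain ⟨m, hm⟩ := h4
  rcases hpr.dvd_or_dvd (show (ℓ:ℤ) ∣ 2 * (x ⬝ᵥ y) from ⟨ℓ * m, by rw [hm]; ring⟩) with h | h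
  · have : ℓ = 2 := by
      have : ℓ ∣ 2 := by exact_mod_cast h
      exact (Nat.prime_dvd_prime_iff_eq hℓ Nat.prime_two).mp this
    subst this
    push_cast at hm ⊢
    exact ⟨m, by linarith⟩
  · exact h

lemma x_lemma {ν ι : Type} [Fintype ν] [Fintype ι] [DecidableEq ι] (C : Matrix ν ι ℤ)
    (hc : 2 * Fintype.card ν < Fintype.card ι) (c : ℕ) (hc0 : 0 < c) :
    ∃ x : ι → ℤ, 0 < x ⬝ᵥ x ∧ C *ᵥ x = 0 ∧ ∀ ℓ : ℕ, ℓ.Prime → ℓ ∣ c → ¬ (ℓ:ℤ)^2 ∣ x ⬝ᵥ x := by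
  have hex : ∀ ℓ : ℕ, ∃ x : ι → ℤ, ℓ.Prime → (C *ᵥ x = 0 ∧ ¬ (ℓ:ℤ)^2 ∣ x ⬝ᵥ x) := by
    intro ℓ
    by_cases h : ℓ.Prime
    · obtain ⟨x, hx⟩ := ker_prime C hc ℓ h; exact ⟨x, fun _ => hx⟩
    · exact ⟨0, fun h' => absurd h' h⟩
  choose X hX using hex
  set P := (2 * c).primeFactors with hP
  have hmem : ∀ ℓ : ℕ, ℓ ∈ P ↔ ℓ.Prime ∧ ℓ ∣ 2 * c := fun ℓ => by
    rw [hP, Nat.mem_primeFactors]; constructor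
    · rintro ⟨a, b, _⟩; exact ⟨a, b⟩
    · rintro ⟨a, b⟩; exact ⟨a, b, by omega⟩
  let Q : ℕ → ℤ := fun ℓ => ∏ m ∈ P.erase ℓ, (m:ℤ)^2
  let x : ι → ℤ := ∑ ℓ ∈ P, Q ℓ • X ℓ
  have hx0 : C *ᵥ x = 0 := by
    simp only [x, Matrix.mulVec_sum, Matrix.mulVec_smul]
    refine Finset.sum_eq_zero fun ℓ hℓ => ?_
    rw [(hX ℓ ((hmem ℓ).mp hℓ).1).1, smul_zero]
  have hxs : ∀ ℓ ∈ P, ¬ (ℓ:ℤ)^2 ∣ x ⬝ᵥ x := by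
    intro ℓ hℓ hd
    have hℓp := ((hmem ℓ).mp hℓ).1
    have h1 : ∃ z : ι → ℤ, x = Q ℓ • X ℓ + (ℓ:ℤ)^2 • z := by
      have h2 : ∀ m ∈ P.erase ℓ, ∃ z : ι → ℤ, Q m • X m = (ℓ:ℤ)^2 • z := by
        intro m hm
        have : (ℓ:ℤ)^2 ∣ Q m := Finset.dvd_prod_of_mem (fun m : ℕ => (m:ℤ)^2) (Finset.mem_erase.mpr ⟨(Finset.mem_erase.mp hm).1.symm, hℓ⟩)
        obtain ⟨t, ht⟩ := this
        exact ⟨t • X m, by rw [ht, mul_smul]⟩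
      choose! z hz using h2
      refine ⟨∑ m ∈ P.erase ℓ, z m, ?_⟩
      rw [Finset.smul_sum, ← Finset.sum_congr rfl hz]
      exact (Finset.add_sum_erase _ _ hℓ).symm
    obtain ⟨z, hz⟩ := h1
    have h3 : (ℓ:ℤ)^2 ∣ Q ℓ ^ 2 * (X ℓ ⬝ᵥ X ℓ) := by
      have e : Q ℓ ^ 2 * (X ℓ ⬝ᵥ X ℓ) = x ⬝ᵥ x - (ℓ:ℤ)^2 * (2 * Q ℓ * (X ℓ ⬝ᵥ z) + (ℓ:ℤ)^2 * (z ⬝ᵥ z)) := by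
        rw [hz]
        simp only [add_dotProduct, dotProduct_add, smul_dotProduct, dotProduct_smul, smul_eq_mul]
        rw [dotProduct_comm z (X ℓ)]; ring
      rw [e]; exact dvd_sub hd (dvd_mul_right _ _)
    have hcop : IsCoprime ((ℓ:ℤ)^2) (Q ℓ ^ 2) := by
      apply IsCoprime.pow
      apply IsCoprime.prod_right
      intro m hm
      have hm' := Finset.mem_erase.mp hm
      apply IsCoprime.pow_right
      exact Nat.isCoprime_iff_coprime.mpr ((Nat.coprime_primes hℓp ((hmem m).mp hm'.2).1).mpr hm'.1.symm)
    exact (hX ℓ hℓp).2 (hcop.dvd_of_dvd_mul_left h3)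
  refine ⟨x, ?_, hx0, fun ℓ hℓ hd => hxs ℓ ((hmem ℓ).mpr ⟨hℓ, hd.mul_left 2⟩)⟩
  have h2 := hxs 2 ((hmem 2).mpr ⟨Nat.prime_two, dvd_mul_right _ _⟩)
  have h3 : 0 ≤ x ⬝ᵥ x := Finset.sum_nonneg fun i _ => mul_self_nonneg _
  rcases h3.lt_or_eq with h | h
  · exact h
  · rw [← h] at h2; simp at h2


lemma symmod (n : ℕ) : ∃ (κ : Type) (_ : Fintype κ), ∀ (d : ℕ), 0 < d → ∀ E : Fin n → Fin n → ℤ,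
    (∀ i j, E i j = E j i) → ∃ τ : Fin n → κ → ℤ, ∀ i j, (d:ℤ) ∣ E i j - ∑ k, τ i k * τ j k := by
  obtain ⟨κ, hκ, H⟩ := sumsq n
  refine ⟨κ, hκ, fun d hd E hE => ?_⟩
  obtain ⟨T, hT⟩ := H 4
  obtain ⟨H0, hH0⟩ := exists_nat_ge (2 * T)
  set H1 : ℕ := H0 + 2 * n + 1 with hH1
  have hdR : (1:ℝ) ≤ d := by exact_mod_cast hd
  let N : Fin n → Fin n → ℤ := fun i j => E i j % d + if i = j then (d * H1 : ℤ) else 0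
  have hmod : ∀ i j, 0 ≤ E i j % d ∧ E i j % d < d := fun i j =>
    ⟨Int.emod_nonneg _ (by omega), Int.emod_lt_of_pos _ (by omega)⟩
  have hred : RedCl 4 (fun _ => (d * H1 / 2 : ℝ)) N := by
    refine ⟨?_, ?_, ?_, ?_, ?_⟩
    · intro i j
      simp only [N, hE i j, eq_comm]
    · intro i
      have : (0:ℝ) < H1 := by rw [hH1]; positivity
      positivity
    · exact monotone_const
    · intro i j _
      have h1 := hmod i j
      have h2 : |N i j| ≤ d + d * H1 := by
        have h3 : (0:ℤ) ≤ d * H1 := by positivity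
        simp only [N]
        rw [abs_le]; split_ifs <;> constructor <;> linarith
      have h3 : ((|N i j| : ℤ) : ℝ) ≤ d + d * H1 := by exact_mod_cast h2
      have h4 : (1:ℝ) ≤ H1 := by rw [hH1]; push_cast; linarith [(Nat.cast_nonneg H0 : (0:ℝ) ≤ H0), (Nat.cast_nonneg n : (0:ℝ) ≤ n)]
      have h5 : (d:ℝ) ≤ d * H1 := by nlinarith
      push_cast at h3
      linarith
    · intro x
      have h1 : ∑ i, ∑ j, N i j * x i * x j = ∑ i, ∑ j, (E i j % d) * x i * x j + d * H1 * ∑ i, x i ^ 2 := by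
        simp only [N, add_mul, Finset.sum_add_distrib, ite_mul, zero_mul, Finset.sum_ite_eq, Finset.mem_univ, if_true, Finset.mul_sum]
        congr 1
        exact Finset.sum_congr rfl fun i _ => by ring
      have h2 : -(d * n * ∑ i, x i ^ 2) ≤ ∑ i, ∑ j, (E i j % d) * x i * x j := by
        have h3 : ∀ i j, -(d * ((x i)^2 + (x j)^2)) ≤ 2 * ((E i j % d) * x i * x j) := by
          intro i j
          have h4 := hmod i j
          have h5 : (0:ℤ) ≤ (E i j % d) * (x i + x j)^2 := mul_nonneg h4.1 (sq_nonneg _)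
          have h6 : (0:ℤ) ≤ (d - E i j % d) * ((x i)^2 + (x j)^2) := mul_nonneg (by linarith) (by positivity)
          nlinarith
        have h7 := Finset.sum_le_sum fun i (_ : i ∈ Finset.univ) => Finset.sum_le_sum fun j (_ : j ∈ (Finset.univ : Finset (Fin n))) => h3 i j
        simp only [Finset.sum_neg_distrib, ← Finset.mul_sum, Finset.sum_add_distrib, Finset.sum_const, Finset.card_univ, Fintype.card_fin, nsmul_eq_mul] at h7
        linarith
      have h3 : (0:ℤ) ≤ ∑ i, x i ^2 := Finset.sum_nonneg fun i _ => sq_nonneg _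
      have h4 : d * H1 * ∑ i, x i ^ 2 ≤ 2 * ∑ i, ∑ j, N i j * x i * x j := by
        rw [h1]
        have h5 : (2 * n : ℤ) ≤ H1 := by rw [hH1]; push_cast; linarith
        have h6 : 0 ≤ (d:ℤ) * (H1 - 2 * n) * ∑ i, x i ^2 := mul_nonneg (mul_nonneg (by positivity) (by linarith)) h3
        nlinarith
      have h5 : ((d * H1 * ∑ i, x i ^ 2 : ℤ) : ℝ) ≤ ((2 * ∑ i, ∑ j, N i j * x i * x j : ℤ) : ℝ) := by exact_mod_cast h4
      push_cast at h5 ⊢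
      rw [← Finset.mul_sum]
      linarith
  obtain ⟨Y, hY⟩ := hT N _ hred (fun i => by
    have h4 : 2 * T ≤ H1 := by rw [hH1]; push_cast; linarith [(Nat.cast_nonneg n : (0:ℝ) ≤ n)]
    have : (H1:ℝ) ≤ d * H1 := by nlinarith [(Nat.cast_nonneg H1 : (0:ℝ) ≤ H1)]
    linarith)
  refine ⟨Y, fun i j => ?_⟩
  rw [← hY i j]
  have : E i j - N i j = d * (E i j / d) - if i = j then (d * H1 : ℤ) else 0 := by
    simp only [N]; have := Int.emod_add_mul_ediv (E i j) d; linarith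
  rw [this]
  refine dvd_sub (dvd_mul_right _ _) ?_
  split_ifs
  · exact dvd_mul_right _ _
  · exact dvd_zero _

lemma hr_pack (k R : ℕ) : ∃ (ι : Type) (_ : Fintype ι) (_ : DecidableEq ι) (J : Fin R → Matrix ι ι ℤ),
    (∀ (x : ι → ℤ) k l, (J k *ᵥ x) ⬝ᵥ (J l *ᵥ x) = if k = l then x ⬝ᵥ x else 0) ∧
    ∀ (a : Fin k → ι → ℤ) (c : ℕ), 0 < c → ∃ x : ι → ℤ, 0 < x ⬝ᵥ x ∧ (∀ i l, a i ⬝ᵥ (J l *ᵥ x) = 0) ∧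
      ∀ ℓ : ℕ, ℓ.Prime → ℓ ∣ c → ¬ (ℓ:ℤ)^2 ∣ x ⬝ᵥ x := by
  set t := 4 * k + R with ht
  obtain ⟨ι, i1, i2, J, hc, hJ⟩ := hr (2 * t)
  have hRt : R ≤ 2 * t := by omega
  have hcard : 2 * (k * R) < Fintype.card ι := by
    rw [hc, mul_comm 2 t, pow_mul]
    have h1 : t + 1 ≤ 2 ^ t := Nat.lt_two_pow_self
    have h2 : (t+1)^2 ≤ (2^t)^2 := Nat.pow_le_pow_left h1 2
    nlinarith
  refine ⟨ι, i1, i2, fun l => J (Fin.castLE hRt l), ?_, ?_⟩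
  · intro x p q
    rw [hJ]; simp [Fin.ext_iff]
  · intro a c hc0
    let C : Matrix (Fin k × Fin R) ι ℤ := fun p => (a p.1) ᵥ* (J (Fin.castLE hRt p.2))
    obtain ⟨x, h1, h2, h3⟩ := x_lemma C (by simpa using hcard) c hc0
    refine ⟨x, h1, fun i l => ?_, h3⟩
    have := congrFun h2 (i, l)
    rw [Matrix.dotProduct_mulVec]
    exact this

section
variable {L : Type*} [AddCommGroup L] (B : LinearMap.BilinForm ℤ L)

def IsFrame {ι : Type*} (q : ℕ) (f : ι → L) : Prop :=
  0 < q ∧ (∀ i, B (f i) (f i) = q) ∧ ∀ i j, i ≠ j → B (f i) (f j) = 0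

lemma bil_right {ι : Type*} [Fintype ι] (x : L) (c : ι → ℤ) (g : ι → L) :
    B x (∑ k, c k • g k) = ∑ k, c k * B x (g k) := by
  simp [map_sum]

lemma bil_left {ι : Type*} [Fintype ι] (x : L) (c : ι → ℤ) (g : ι → L) :
    B (∑ k, c k • g k) x = ∑ k, c k * B (g k) x := by
  simp [map_sum]

lemma bil_bound (hs : ∀ x y, B x y = B y x) (hp : ∀ x, 0 ≤ B x x) (x y : L) : |B x y| ≤ B x x + B y y := by
  have h1 := hp (x + y)
  have h2 := hp (x - y)
  have h3 := hp x
  have h4 := hp y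
  simp only [map_add, map_sub, LinearMap.add_apply, LinearMap.sub_apply] at h1 h2
  rw [hs y x] at h1 h2
  rw [abs_le]; constructor <;> linarith

lemma frame_hr {ι : Type*} [Fintype ι] {R : ℕ} (J : Fin R → Matrix ι ι ℤ)
    (hJ : ∀ (x : ι → ℤ) k l, (J k *ᵥ x) ⬝ᵥ (J l *ᵥ x) = if k = l then x ⬝ᵥ x else 0)
    (c : ℕ) (e : ι → L) (he : IsFrame B c e) (x : ι → ℤ) (hx : 0 < x ⬝ᵥ x) :
    IsFrame B (c * (x ⬝ᵥ x).toNat) (fun l => ∑ m, (J l *ᵥ x) m • e m) := by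
  obtain ⟨h0, h1, h2⟩ := he
  have key : ∀ k l, B (∑ m, (J k *ᵥ x) m • e m) (∑ m, (J l *ᵥ x) m • e m) = c * (if k = l then x ⬝ᵥ x else 0) := by
    intro k l
    rw [bil_sum_orth B _ _ e h2, ← hJ, dotProduct, Finset.mul_sum]
    exact Finset.sum_congr rfl fun i _ => by rw [h1]; ring
  refine ⟨Nat.mul_pos h0 (by omega), ?_, ?_⟩
  · intro l; rw [key]; push_cast; rw [Int.toNat_of_nonneg hx.le]; simp
  · intro k l hkl; rw [key]; simp [hkl]

lemma stepA1 (hs : ∀ x y, B x y = B y x) (hp : ∀ x, 0 ≤ B x x)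
    (hfr : ∀ K, ∃ (c : ℕ) (f : Fin K → L), IsFrame B c f) (k R : ℕ) (τ : ℤ) :
    ∃ F : Set (ℕ × (Fin R → L)), F.Finite ∧ (∀ p ∈ F, IsFrame B p.1 p.2) ∧
      ∀ s : Fin k → L, (∀ i, B (s i) (s i) ≤ τ) → ∃ p ∈ F, ∀ i j, B (s i) (p.2 j) = 0 := by
  obtain ⟨ι, i1, i2, J, hJ, hX⟩ := hr_pack k R
  obtain ⟨c, f0, hf0⟩ := hfr (Fintype.card ι)
  let e : ι → L := fun m => f0 (Fintype.equivFin ι m)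
  have he : IsFrame B c e := ⟨hf0.1, fun i => hf0.2.1 _, fun i j hij => hf0.2.2 _ _ (fun h => hij ((Fintype.equivFin ι).injective h))⟩
  choose X hX1 hX2 hX3 using fun a : Fin k → ι → ℤ => hX a 1 one_pos
  let G : (Fin k → ι → ℤ) → ℕ × (Fin R → L) := fun a => (c * (X a ⬝ᵥ X a).toNat, fun l => ∑ m, (J l *ᵥ X a) m • e m)
  refine ⟨G '' Set.Icc (fun _ _ => -(τ + c)) (fun _ _ => τ + c), (Set.finite_Icc _ _).image _, ?_, ?_⟩
  · rintro _ ⟨a, -, rfl⟩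
    exact frame_hr B J hJ c e he (X a) (hX1 a)
  · intro s hsn
    let a : Fin k → ι → ℤ := fun i j => B (s i) (e j)
    have hb : ∀ i j, |a i j| ≤ τ + c := fun i j => by
      have h1 := bil_bound B hs hp (s i) (e j)
      rw [he.2.1] at h1
      have := hsn i
      simp only [a]; linarith
    refine ⟨G a, ⟨a, ⟨fun i j => (abs_le.mp (hb i j)).1, fun i j => (abs_le.mp (hb i j)).2⟩, rfl⟩, fun i l => ?_⟩
    simp only [G]
    rw [bil_right]
    have := hX2 a i l
    rw [← this, dotProduct]
    exact Finset.sum_congr rfl fun j _ => mul_comm _ _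

end


section
variable {L : Type*} [AddCommGroup L] (B : LinearMap.BilinForm ℤ L)

lemma a2_core (hs : ∀ x y, B x y = B y x) {n R : ℕ} {ι κ : Type} [Fintype ι] [Fintype κ]
    (hκ : ∀ (d : ℕ), 0 < d → ∀ E : Fin n → Fin n → ℤ,
      (∀ i j, E i j = E j i) → ∃ τ : Fin n → κ → ℤ, ∀ i j, (d:ℤ) ∣ E i j - ∑ k, τ i k * τ j k)
    (c : ℕ) (e : ι ⊕ κ → L) (he : IsFrame B c e) (v : Fin n → L) (s d : ℕ) (hd : 0 < d) (c' : ℤ)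
    (hc' : (c:ℤ) = s * c') (hcop : IsCoprime ((c:ℤ)^2 * s) (d:ℤ))
    (β : Fin R → ι → ℤ) (hf : IsFrame B (c * (s * d)) (fun l => ∑ m, β l m • e (Sum.inl m)))
    (hdiv : ∀ i l, (c:ℤ)^2 ∣ ∑ m, β l m * B (v i) (e (Sum.inl m))) :
    ∃ w : Fin n → L, (∀ i, w i - v i ∈ Submodule.span ℤ (Set.range e)) ∧
      (∀ i l, B (w i) (∑ m, β l m • e (Sum.inl m)) = 0) ∧
      ∀ i j, ((c * (s * d) : ℕ) : ℤ) ∣ B (w i) (w j) - B (v i) (v j) := by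
  classical
  obtain ⟨h0, h1, h2⟩ := he
  obtain ⟨u, t, hut⟩ := hcop
  choose z hz using hdiv
  set f : Fin R → L := fun l => ∑ m, β l m • e (Sum.inl m) with hfdef
  let a : Fin n → ι ⊕ κ → ℤ := fun i m => B (v i) (e m)
  let y : Fin n → ι ⊕ κ → ℤ := fun i m => -u * a i m
  let η : Fin n → L := fun i => ∑ m, y i m • e m
  let v1 : Fin n → L := fun i => v i + ((c:ℤ) * s) • η i
  have hηe : ∀ i m, B (η i) (e m) = c * y i m := by
    intro i m
    simp only [η]
    rw [bil_left, Finset.sum_eq_single m]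
    · rw [h1]; ring
    · intro b _ hb; rw [h2 b m hb, mul_zero]
    · simp
  have hv1e : ∀ i m, B (v1 i) (e m) = d * t * a i m := by
    intro i m
    simp only [v1, map_add, LinearMap.add_apply, map_smul, LinearMap.smul_apply, smul_eq_mul]
    rw [hηe]
    simp only [y]
    change a i m + _ = _
    linear_combination (-a i m) * hut
  have hv1f : ∀ i l, B (v1 i) (f l) = d * t * c^2 * z i l := by
    intro i l
    simp only [f]
    rw [bil_right, mul_assoc (d * t : ℤ), ← hz, Finset.mul_sum]
    refine Finset.sum_congr rfl fun m _ => ?_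
    rw [hv1e]; simp only [a]; ring
  let b : Fin n → Fin R → ℤ := fun i l => t * c' * z i l
  let w1 : Fin n → L := fun i => v1 i - ∑ l, b i l • f l
  have hv1f' : ∀ i l, B (v1 i) (f l) = (c * (s * d)) * b i l := by
    intro i l; rw [hv1f]; simp only [b]
    linear_combination (d * t * c * z i l : ℤ) * hc'
  have hff : ∀ i l, B (∑ l, b i l • f l) (f l) = (c * (s * d)) * b i l := by
    intro i l
    rw [bil_left, Finset.sum_eq_single l]
    · rw [hf.2.1 l]; push_cast; ring
    · intro k _ hk; rw [hf.2.2 k l hk, mul_zero]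
    · simp
  have hw1f : ∀ i l, B (w1 i) (f l) = 0 := by
    intro i l
    simp only [w1, map_sub, LinearMap.sub_apply]
    rw [hff, hv1f', sub_self]
  have hfe : ∀ l m, B (f l) (e (Sum.inr m)) = 0 := by
    intro l m
    simp only [f]
    rw [bil_left]
    refine Finset.sum_eq_zero fun k _ => ?_
    rw [h2 _ _ (by simp), mul_zero]
  have hw1e : ∀ i m, B (w1 i) (e (Sum.inr m)) = d * t * a i (Sum.inr m) := by
    intro i m
    simp only [w1, map_sub, LinearMap.sub_apply]
    rw [bil_left, hv1e, Finset.sum_eq_zero (fun l _ => by rw [hfe, mul_zero]), sub_zero]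
  have hg1 : ∀ i j, B (w1 i) (w1 j) = B (v1 i) (v1 j) - (c * (s * d)) * ∑ l, b i l * b j l := by
    intro i j
    have e1 : B (w1 i) (w1 j) = B (w1 i) (v1 j) := by
      have : w1 j = v1 j - ∑ l, b j l • f l := rfl
      rw [this, map_sub, bil_right, Finset.sum_eq_zero (fun l _ => by rw [hw1f, mul_zero]), sub_zero]
    rw [e1, hs]
    have : w1 i = v1 i - ∑ l, b i l • f l := rfl
    rw [this, map_sub, bil_right, hs, Finset.mul_sum]
    congr 1
    refine Finset.sum_congr rfl fun l _ => ?_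
    rw [hv1f']; ring
  let E : Fin n → Fin n → ℤ := fun i j => B (v i) (η j) + B (η i) (v j) + (c * s) * B (η i) (η j)
  have hE : ∀ i j, E i j = E j i := by
    intro i j
    simp only [E]
    rw [hs (v i), hs (η i) (v j), hs (η i) (η j)]; ring
  have hg2 : ∀ i j, B (v1 i) (v1 j) = B (v i) (v j) + (c * s) * E i j := by
    intro i j
    simp only [v1, E, map_add, LinearMap.add_apply, map_smul, LinearMap.smul_apply, smul_eq_mul]
    ring
  obtain ⟨τ, hτ⟩ := hκ d hd (fun i j => -u * E i j) (fun i j => by rw [hE])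
  choose τ' hτ' using hτ
  let θ : Fin n → L := fun i => ∑ m, τ i m • e (Sum.inr m)
  refine ⟨fun i => w1 i + ((c:ℤ) * s) • θ i, ?_, ?_, ?_⟩
  · intro i
    have hes : ∀ m, e m ∈ Submodule.span ℤ (Set.range e) := fun m => Submodule.subset_span ⟨m, rfl⟩
    have hη : η i ∈ Submodule.span ℤ (Set.range e) := Submodule.sum_mem _ fun m _ => Submodule.smul_mem _ _ (hes _)
    have hθ : θ i ∈ Submodule.span ℤ (Set.range e) := Submodule.sum_mem _ fun m _ => Submodule.smul_mem _ _ (hes _)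
    have hfs : ∀ l, f l ∈ Submodule.span ℤ (Set.range e) := fun l => Submodule.sum_mem _ fun m _ => Submodule.smul_mem _ _ (hes _)
    have hsm : ∑ l, b i l • f l ∈ Submodule.span ℤ (Set.range e) := Submodule.sum_mem _ fun m _ => Submodule.smul_mem _ _ (hfs _)
    have : w1 i + ((c:ℤ) * s) • θ i - v i = ((c:ℤ) * s) • η i - ∑ l, b i l • f l + ((c:ℤ) * s) • θ i := by
      simp only [w1, v1]; abel
    rw [this]
    exact Submodule.add_mem _ (Submodule.sub_mem _ (Submodule.smul_mem _ _ hη) hsm) (Submodule.smul_mem _ _ hθ)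
  · intro i l
    change B (w1 i + ((c:ℤ) * s) • θ i) (f l) = 0
    simp only [map_add, LinearMap.add_apply, map_smul, LinearMap.smul_apply, smul_eq_mul]
    rw [hw1f]
    simp only [θ]
    rw [bil_left, Finset.sum_eq_zero (fun m _ => by rw [hs, hfe, mul_zero])]
    ring
  · intro i j
    have hwθ : ∀ i j, B (w1 i) (θ j) = d * (t * ∑ m, τ j m * a i (Sum.inr m)) := by
      intro i j
      simp only [θ]
      rw [bil_right, Finset.mul_sum, Finset.mul_sum]
      refine Finset.sum_congr rfl fun m _ => ?_
      rw [hw1e]; ring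
    have hθθ : B (θ i) (θ j) = c * ∑ m, τ i m * τ j m := by
      simp only [θ]
      rw [bil_sum_orth B _ _ (fun m => e (Sum.inr m)) (fun p q hpq => h2 _ _ (by simpa using hpq)), Finset.mul_sum]
      refine Finset.sum_congr rfl fun m _ => ?_
      rw [h1]; ring
    simp only [map_add, LinearMap.add_apply, map_smul, LinearMap.smul_apply, smul_eq_mul]
    rw [hθθ, hwθ, hs (θ i) (w1 j), hwθ, hg1, hg2]
    have hτ2 := hτ' i j
    refine ⟨-(∑ l, b i l * b j l) + E i j * t + t * ∑ m, τ j m * a i (Sum.inr m) + t * (∑ m, τ i m * a j (Sum.inr m)) - (c^2 * s) * τ' i j, ?_⟩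
    push_cast
    linear_combination (-(c * s * E i j) : ℤ) * hut - (c^3 * s^2 : ℤ) * hτ2

lemma stepA2 (hs : ∀ x y, B x y = B y x) (n R : ℕ) : ∃ (I : Type) (_ : Fintype I), ∀ (c : ℕ) (e : I → L), IsFrame B c e →
    ∃ F : Set (ℕ × (Fin R → L)), F.Finite ∧
      (∀ p ∈ F, IsFrame B p.1 p.2 ∧ ∀ j, p.2 j ∈ Submodule.span ℤ (Set.range e)) ∧
      ∀ v : Fin n → L, ∃ p ∈ F, ∃ w : Fin n → L, (∀ i, w i - v i ∈ Submodule.span ℤ (Set.range e)) ∧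
        (∀ i j, B (w i) (p.2 j) = 0) ∧ ∀ i j, (p.1 : ℤ) ∣ B (w i) (w j) - B (v i) (v j) := by
  obtain ⟨κ, iκ, hκ⟩ := symmod n
  obtain ⟨ι, i1, i2, J, hJ, hX⟩ := hr_pack n R
  refine ⟨ι ⊕ κ, inferInstance, fun c e he => ?_⟩
  have hel : IsFrame B c (fun m => e (Sum.inl m)) := ⟨he.1, fun i => he.2.1 _, fun i j hij => he.2.2 _ _ (by simpa using hij)⟩
  choose X hX1 hX2 hX3 using fun a : Fin n → ι → ℤ => hX a c he.1
  let G : (Fin n → ι → ℤ) → ℕ × (Fin R → L) := fun a => (c * (X a ⬝ᵥ X a).toNat, fun l => ∑ m, (J l *ᵥ X a) m • e (Sum.inl m))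
  have hGf : ∀ a, IsFrame B (G a).1 (G a).2 := fun a => frame_hr B J hJ c _ hel (X a) (hX1 a)
  have hc0 : (0:ℤ) < c := by exact_mod_cast he.1
  refine ⟨G '' Set.Icc (fun _ _ => 0) (fun _ _ => (c:ℤ)^2), (Set.finite_Icc _ _).image _, ?_, ?_⟩
  · rintro _ ⟨a, -, rfl⟩
    exact ⟨hGf a, fun j => Submodule.sum_mem _ fun m _ => Submodule.smul_mem _ _ (Submodule.subset_span ⟨_, rfl⟩)⟩
  · intro v
    let a : Fin n → ι → ℤ := fun i j => B (v i) (e (Sum.inl j)) % (c:ℤ)^2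
    have hcsq : (0:ℤ) < (c:ℤ)^2 := by positivity
    refine ⟨G a, ⟨a, ⟨fun i j => Int.emod_nonneg _ hcsq.ne', fun i j => (Int.emod_lt_of_pos _ hcsq).le⟩, rfl⟩, ?_⟩
    set g : ℕ := (X a ⬝ᵥ X a).toNat with hg
    have hgZ : (g : ℤ) = X a ⬝ᵥ X a := Int.toNat_of_nonneg (hX1 a).le
    have hg0 : 0 < g := by have := hX1 a; omega
    set s := Nat.gcd g c with hsdef
    obtain ⟨d, hd⟩ : s ∣ g := Nat.gcd_dvd_left _ _
    obtain ⟨c1, hc1⟩ : s ∣ c := Nat.gcd_dvd_right _ _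
    have hd0 : 0 < d := by rcases Nat.eq_zero_or_pos d with h | h; · rw [h] at hd; omega
                           · exact h
    have hcopcd : Nat.Coprime c d := by
      apply Nat.Coprime.symm
      apply Nat.coprime_of_dvd
      intro ℓ hℓ h1 h2
      have h3 : ℓ ∣ s := Nat.dvd_gcd (by rw [hd]; exact h1.mul_left _) h2
      apply hX3 a ℓ hℓ h2
      rw [← hgZ]
      have : ℓ ^ 2 ∣ g := by rw [hd, pow_two]; exact mul_dvd_mul h3 h1
      exact_mod_cast this
    have hcop : IsCoprime ((c:ℤ)^2 * s) (d:ℤ) := by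
      have h1 : IsCoprime (c:ℤ) (d:ℤ) := Nat.isCoprime_iff_coprime.mpr hcopcd
      refine IsCoprime.mul_left h1.pow_left ?_
      exact Nat.isCoprime_iff_coprime.mpr (Nat.Coprime.coprime_dvd_left (Nat.gcd_dvd_right _ _) hcopcd)
    have hGa : (G a).1 = c * (s * d) := by simp only [G]; rw [← hg, hd]
    have := a2_core B hs hκ c e he v s d hd0 c1 (by exact_mod_cast hc1) hcop (fun l => J l *ᵥ X a)
      (by rw [← hGa]; exact hGf a) ?_
    · rw [hGa]; exact this
    · intro i l
      have h1 := hX2 a i l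
      have h2 : ∑ m, (J l *ᵥ X a) m * B (v i) (e (Sum.inl m)) = ∑ m, (J l *ᵥ X a) m * ((c:ℤ)^2 * (B (v i) (e (Sum.inl m)) / (c:ℤ)^2)) + a i ⬝ᵥ (J l *ᵥ X a) := by
        rw [dotProduct, ← Finset.sum_add_distrib]
        refine Finset.sum_congr rfl fun m _ => ?_
        have := Int.emod_add_mul_ediv (B (v i) (e (Sum.inl m))) ((c:ℤ)^2)
        simp only [a]
        rw [mul_comm (_ % _), ← mul_add, add_comm, this]
      rw [h2, h1, add_zero]
      exact Finset.dvd_sum fun m _ => (dvd_mul_right _ _).mul_left _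

end


lemma RedCl.large {k l : ℕ} {A : ℝ} {h : Fin (k+l) → ℝ} {N : Fin (k+l) → Fin (k+l) → ℤ} (H : RedCl A h N) :
    RedCl A (fun i => h (Fin.natAdd k i)) (fun i j => N (Fin.natAdd k i) (Fin.natAdd k j)) := by
  obtain ⟨h1, h2, h3, h4, h5⟩ := H
  refine ⟨fun i j => h1 _ _, fun i => h2 _, fun i j hij => h3 (by simpa using hij), fun i j hij => h4 _ _ (by simpa using hij), ?_⟩
  intro x
  have := h5 (Fin.append (fun _ => 0) x)
  simpa [Fin.sum_univ_add] using this

lemma RedCl.sub_large {l : ℕ} {A : ℝ} (hA : 0 ≤ A) {h : Fin l → ℝ} {N W P : Fin l → Fin l → ℤ} (H : RedCl A h N)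
    (q : ℕ) (hq : 0 < q) (hW : ∀ i j, W i j = W j i) (hP : ∀ i j, N i j - W i j = q * P i j) (M : ℝ) (hM : 0 ≤ M) (hWM : ∀ i j, |(W i j : ℝ)| ≤ M)
    (hh : ∀ i, M ≤ h i) (hh2 : ∀ i, 2 * l * M ≤ h i) : RedCl (2 * (A + 1)) (fun i => h i / (2 * q)) P := by
  obtain ⟨h1, h2, h3, h4, h5⟩ := H
  have hqR : (0:ℝ) < q := by exact_mod_cast hq
  have hPR : ∀ i j, (N i j : ℝ) - W i j = q * P i j := fun i j => by exact_mod_cast hP i j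
  refine ⟨?_, ?_, ?_, ?_, ?_⟩
  · intro i j
    have a := hP i j
    have b := hP j i
    rw [h1 j i, hW j i, a] at b
    exact mul_left_cancel₀ (by exact_mod_cast hq.ne') b
  · intro i; have := h2 i; positivity
  · intro i j hij; have := h3 hij; exact div_le_div_of_nonneg_right this (by positivity)
  · intro i j hij
    have a : |(q:ℝ) * P i j| ≤ (A+1) * h i := by
      rw [← hPR]
      have b1 := h4 i j hij
      have b2 := hWM i j
      have b3 := hh i
      calc |(N i j : ℝ) - W i j| ≤ |(N i j : ℝ)| + |(W i j : ℝ)| := abs_sub _ _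
        _ ≤ (A+1) * h i := by linarith
    rw [abs_mul, abs_of_pos hqR] at a
    have e : 2 * (A+1) * (h i / (2 * q)) = ((A+1) * h i) / q := by field_simp
    rw [e, le_div_iff₀ hqR]
    linarith
  · intro x
    have a : ∑ i, ∑ j, (W i j : ℝ) * x i * x j ≤ M * l * ∑ i, (x i:ℝ)^2 := by
      have b : ∀ i j, (W i j : ℝ) * x i * x j ≤ M / 2 * ((x i:ℝ)^2 + (x j:ℝ)^2) := by
        intro i j
        have b2 := abs_le.mp (hWM i j)
        have c1 : 0 ≤ (M - W i j) * ((x i:ℝ) + x j)^2 := mul_nonneg (by linarith) (sq_nonneg _)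
        have c2 : 0 ≤ (M + W i j) * ((x i:ℝ) - x j)^2 := mul_nonneg (by linarith) (sq_nonneg _)
        nlinarith
      have b7 := Finset.sum_le_sum fun i (_ : i ∈ Finset.univ) => Finset.sum_le_sum fun j (_ : j ∈ (Finset.univ : Finset (Fin l))) => b i j
      simp only [← Finset.mul_sum, Finset.sum_add_distrib, Finset.sum_const, Finset.card_univ, Fintype.card_fin, nsmul_eq_mul] at b7
      linarith
    have b : M * l * ∑ i, (x i:ℝ)^2 ≤ ∑ i, h i / 2 * (x i:ℝ)^2 := by
      rw [Finset.mul_sum]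
      refine Finset.sum_le_sum fun i _ => mul_le_mul_of_nonneg_right ?_ (sq_nonneg _)
      have := hh2 i; linarith
    have c := h5 x
    have d : (q:ℝ) * ∑ i, ∑ j, (P i j : ℝ) * x i * x j = ∑ i, ∑ j, (N i j : ℝ) * x i * x j - ∑ i, ∑ j, (W i j : ℝ) * x i * x j := by
      rw [← Finset.sum_sub_distrib, Finset.mul_sum]
      refine Finset.sum_congr rfl fun i _ => ?_
      rw [← Finset.sum_sub_distrib, Finset.mul_sum]
      refine Finset.sum_congr rfl fun j _ => ?_
      linear_combination (-(x i:ℝ) * x j) * hPR i j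
    have e : ∑ i, h i * (x i:ℝ)^2 = 2 * ∑ i, h i / 2 * (x i:ℝ)^2 := by
      rw [Finset.mul_sum]; exact Finset.sum_congr rfl fun i _ => by ring
    have f : ∑ i, h i / (2 * q) * (x i:ℝ)^2 = (∑ i, h i / 2 * (x i:ℝ)^2) / (q:ℝ) := by
      rw [Finset.sum_div]; exact Finset.sum_congr rfl fun i _ => by field_simp
    rw [f, div_le_iff₀ hqR, mul_comm]
    linarith

section
variable {L : Type*} [AddCommGroup L] (B : LinearMap.BilinForm ℤ L)

lemma stepC1 (hs : ∀ x y, B x y = B y x) {k l : ℕ} {κ : Type} [Fintype κ] {A : ℝ} (hA : 0 ≤ A)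
    (hκ : ∀ A : ℝ, ∃ T : ℝ, ∀ (N : Fin l → Fin l → ℤ) (h : Fin l → ℝ), RedCl A h N → (∀ i, T ≤ h i) →
      ∃ Y : Fin l → κ → ℤ, ∀ i j, N i j = ∑ k, Y i k * Y j k)
    (q : ℕ) (f : κ → L) (hf : IsFrame B q f) (u : Fin (k+l) → L) (hu : ∀ i j, B (u i) (f j) = 0) :
    ∃ T : ℝ, ∀ (N : Fin (k+l) → Fin (k+l) → ℤ) (h : Fin (k+l) → ℝ), RedCl A h N → (∀ i : Fin l, T ≤ h (Fin.natAdd k i)) →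
      (∀ (i : Fin k) j, N (Fin.castAdd l i) j = B (u (Fin.castAdd l i)) (u j)) →
      (∀ i j : Fin l, (q:ℤ) ∣ N (Fin.natAdd k i) (Fin.natAdd k j) - B (u (Fin.natAdd k i)) (u (Fin.natAdd k j))) →
      ∃ w : Fin (k+l) → L, (∀ i, w i ∈ Submodule.span ℤ (Set.range u ∪ Set.range f)) ∧ ∀ i j, B (w i) (w j) = N i j := by
  obtain ⟨T, hT⟩ := hκ (2 * (A + 1))
  obtain ⟨M, hM⟩ := (Set.finite_range (fun p : Fin l × Fin l => |(B (u (Fin.natAdd k p.1)) (u (Fin.natAdd k p.2)) : ℝ)|)).bddAbove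
  have hq : (0:ℝ) < q := by exact_mod_cast hf.1
  set M' := max M 0 with hM'
  have hM0 : 0 ≤ M' := le_max_right _ _
  refine ⟨max (max M' (2 * l * M')) (2 * q * T), fun N h H hh hN1 hN2 => ?_⟩
  choose P hP using hN2
  have hred := RedCl.sub_large (W := fun i j => B (u (Fin.natAdd k i)) (u (Fin.natAdd k j))) hA H.large q hf.1
    (fun i j => hs _ _) hP M' hM0 (fun i j => (hM ⟨(i,j), rfl⟩).trans (le_max_left _ _))
    (fun i => ((le_max_left _ _).trans (le_max_left _ _)).trans (hh i))
    (fun i => ((le_max_right _ _).trans (le_max_left _ _)).trans (hh i))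
  obtain ⟨Y, hY⟩ := hT _ _ hred (fun i => by
    have := (le_max_right _ _).trans (hh i)
    rw [le_div_iff₀ (by positivity)]; linarith)
  let Z : Fin (k+l) → κ → ℤ := Fin.append (fun _ => 0) Y
  have hg : ∀ i j, B (u i + ∑ m, Z i m • f m) (u j + ∑ m, Z j m • f m) = B (u i) (u j) + q * ∑ m, Z i m * Z j m := by
    intro i j
    have e1 : B (u i) (∑ m, Z j m • f m) = 0 := by
      rw [bil_right]; exact Finset.sum_eq_zero fun m _ => by rw [hu, mul_zero]
    have e2 : B (∑ m, Z i m • f m) (u j) = 0 := by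
      rw [bil_left]; exact Finset.sum_eq_zero fun m _ => by rw [hs, hu, mul_zero]
    have e3 : B (∑ m, Z i m • f m) (∑ m, Z j m • f m) = q * ∑ m, Z i m * Z j m := by
      rw [bil_sum_orth B _ _ f hf.2.2, Finset.mul_sum]
      exact Finset.sum_congr rfl fun m _ => by rw [hf.2.1]; ring
    simp only [map_add, LinearMap.add_apply, e1, e2, e3]; ring
  refine ⟨fun i => u i + ∑ m, Z i m • f m, fun i => ?_, fun i j => ?_⟩
  · refine Submodule.add_mem _ (Submodule.subset_span (Or.inl ⟨i, rfl⟩)) (Submodule.sum_mem _ fun m _ => Submodule.smul_mem _ _ (Submodule.subset_span (Or.inr ⟨m, rfl⟩)))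
  · rw [hg]
    refine Fin.addCases (fun i => ?_) (fun i => ?_) i
    · rw [hN1]; simp [Z]
    · refine Fin.addCases (fun j => ?_) (fun j => ?_) j
      · rw [H.1, hN1, hs]; simp [Z]
      · have := hP i j
        rw [hY] at this
        simp only [Z, Fin.append_right]
        linarith

lemma stepC0 (hs : ∀ x y, B x y = B y x) (hp : ∀ x, 0 ≤ B x x)
    (hfr : ∀ K, ∃ (c : ℕ) (f : Fin K → L), IsFrame B c f) (k l R : ℕ) (τ : ℤ) :
    ∃ F : Set (ℕ × (Fin R → L)), F.Finite ∧ (∀ p ∈ F, IsFrame B p.1 p.2) ∧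
      ∀ v : Fin (k+l) → L, (∀ i : Fin k, B (v (Fin.castAdd l i)) (v (Fin.castAdd l i)) ≤ τ) → ∃ p ∈ F, ∃ u : Fin (k+l) → L,
        (∀ i j, B (u i) (p.2 j) = 0) ∧ (∀ (i : Fin k) j, B (u (Fin.castAdd l i)) (u j) = B (v (Fin.castAdd l i)) (v j)) ∧
        ∀ i j : Fin l, (p.1:ℤ) ∣ B (u (Fin.natAdd k i)) (u (Fin.natAdd k j)) - B (v (Fin.natAdd k i)) (v (Fin.natAdd k j)) := by
  obtain ⟨I, iI, hA2⟩ := stepA2 B hs l R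
  obtain ⟨F1, hF1, hF1f, hA1⟩ := stepA1 B hs hp hfr k (Fintype.card I) τ
  have : ∀ p : ℕ × (Fin (Fintype.card I) → L), ∃ F : Set (ℕ × (Fin R → L)), p ∈ F1 → (F.Finite ∧
      (∀ p' ∈ F, IsFrame B p'.1 p'.2 ∧ ∀ j, p'.2 j ∈ Submodule.span ℤ (Set.range p.2)) ∧
      ∀ v : Fin l → L, ∃ p' ∈ F, ∃ w : Fin l → L, (∀ i, w i - v i ∈ Submodule.span ℤ (Set.range p.2)) ∧
        (∀ i j, B (w i) (p'.2 j) = 0) ∧ ∀ i j, (p'.1 : ℤ) ∣ B (w i) (w j) - B (v i) (v j)) := by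
    intro p
    by_cases h : p ∈ F1
    · have hf := hF1f p h
      obtain ⟨F, hF⟩ := hA2 p.1 (fun m => p.2 (Fintype.equivFin I m)) ⟨hf.1, fun i => hf.2.1 _, fun i j hij => hf.2.2 _ _ (fun h => hij ((Fintype.equivFin I).injective h))⟩
      refine ⟨F, fun _ => ?_⟩
      have e : Set.range (fun m => p.2 (Fintype.equivFin I m)) = Set.range p.2 := (Fintype.equivFin I).surjective.range_comp p.2
      rw [e] at hF
      exact hF
    · exact ⟨∅, fun h' => absurd h' h⟩
  choose F2 hF2 using this
  refine ⟨⋃ p ∈ F1, F2 p, hF1.biUnion fun p hp => (hF2 p hp).1, ?_, ?_⟩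
  · intro p' hp'
    simp only [Set.mem_iUnion] at hp'
    obtain ⟨p, hp1, hp2⟩ := hp'
    exact ((hF2 p hp1).2.1 p' hp2).1
  · intro v hv
    obtain ⟨p, hp1, hp2⟩ := hA1 (fun i => v (Fin.castAdd l i)) hv
    obtain ⟨-, hb, hc⟩ := hF2 p hp1
    obtain ⟨p', hp', w, hw1, hw2, hw3⟩ := hc (fun i => v (Fin.natAdd k i))
    have horth : ∀ (i : Fin k) z, z ∈ Submodule.span ℤ (Set.range p.2) → B (v (Fin.castAdd l i)) z = 0 := by
      intro i z hz
      refine span_orth B {v (Fin.castAdd l i)} (Set.range p.2) ?_ (Submodule.subset_span rfl) hz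
      rintro _ rfl _ ⟨m, rfl⟩
      exact hp2 i m
    refine ⟨p', Set.mem_biUnion hp1 hp', Fin.append (fun i => v (Fin.castAdd l i)) w, ?_, ?_, ?_⟩
    · intro i j
      refine Fin.addCases (fun i => ?_) (fun i => ?_) i
      · simp only [Fin.append_left]; exact horth i _ ((hb p' hp').2 j)
      · simp only [Fin.append_right]; exact hw2 i j
    · intro i j
      refine Fin.addCases (fun j => ?_) (fun j => ?_) j
      · simp only [Fin.append_left]
      · simp only [Fin.append_left, Fin.append_right]
        have := horth i _ (hw1 j)
        rw [map_sub, sub_eq_zero] at this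
        exact this
    · intro i j
      simp only [Fin.append_right]; exact hw3 i j

lemma stepC (hs : ∀ x y, B x y = B y x) (hp : ∀ x, 0 ≤ B x x)
    (hfr : ∀ K, ∃ (c : ℕ) (f : Fin K → L), IsFrame B c f) (k l : ℕ) (A : ℝ) (hA : 0 ≤ A) (τ : ℝ) :
    ∃ (T : ℝ) (Λ : Set L), Λ.Finite ∧ ∀ (v : Fin (k+l) → L) (h : Fin (k+l) → ℝ), RedCl A h (fun i j => B (v i) (v j)) →
      (∀ i : Fin k, h (Fin.castAdd l i) ≤ τ) → (∀ i : Fin l, T ≤ h (Fin.natAdd k i)) →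
      ∃ w : Fin (k+l) → L, (∀ i, w i ∈ Submodule.span ℤ Λ) ∧ ∀ i j, B (w i) (w j) = B (v i) (v j) := by
  classical
  obtain ⟨κ, iκ, hκ⟩ := sumsq l
  set C : ℤ := ⌈A * τ⌉ with hC
  obtain ⟨F, hF, hFf, hF0⟩ := stepC0 B hs hp hfr k l (Fintype.card κ) C
  let large : Fin (k+l) → Prop := fun i => k ≤ (i:ℕ)
  let typ : ℕ → (Fin (k+l) → L) → Fin (k+l) → Fin (k+l) → ℤ := fun q u i j =>
    if large i ∧ large j then B (u i) (u j) % q else B (u i) (u j)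
  have hex : ∀ t : (ℕ × (Fin (Fintype.card κ) → L)) × (Fin (k+l) → Fin (k+l) → ℤ), ∃ (u : Fin (k+l) → L) (T : ℝ),
      t.1 ∈ F → (∃ u : Fin (k+l) → L, (∀ i j, B (u i) (t.1.2 j) = 0) ∧ typ t.1.1 u = t.2) →
      (typ t.1.1 u = t.2 ∧ ∀ (N : Fin (k+l) → Fin (k+l) → ℤ) (h : Fin (k+l) → ℝ), RedCl A h N → (∀ i : Fin l, T ≤ h (Fin.natAdd k i)) →
      (∀ (i : Fin k) j, N (Fin.castAdd l i) j = B (u (Fin.castAdd l i)) (u j)) →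
      (∀ i j : Fin l, (t.1.1:ℤ) ∣ N (Fin.natAdd k i) (Fin.natAdd k j) - B (u (Fin.natAdd k i)) (u (Fin.natAdd k j))) →
      ∃ w : Fin (k+l) → L, (∀ i, w i ∈ Submodule.span ℤ (Set.range u ∪ Set.range t.1.2)) ∧ ∀ i j, B (w i) (w j) = N i j) := by
    intro t
    by_cases h1 : t.1 ∈ F
    · by_cases h2 : ∃ u : Fin (k+l) → L, (∀ i j, B (u i) (t.1.2 j) = 0) ∧ typ t.1.1 u = t.2
      · obtain ⟨u, hu1, hu2⟩ := h2
        have hf := hFf _ h1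
        obtain ⟨T, hT⟩ := stepC1 B hs (k := k) hA hκ t.1.1 (fun m => t.1.2 (Fintype.equivFin κ m))
          ⟨hf.1, fun i => hf.2.1 _, fun i j hij => hf.2.2 _ _ (fun h => hij ((Fintype.equivFin κ).injective h))⟩ u (fun i j => hu1 _ _)
        have e : Set.range (fun m => t.1.2 (Fintype.equivFin κ m)) = Set.range t.1.2 := (Fintype.equivFin κ).surjective.range_comp t.1.2
        rw [e] at hT
        exact ⟨u, T, fun _ _ => ⟨hu2, hT⟩⟩
      · exact ⟨fun _ => 0, 0, fun _ h => absurd h h2⟩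
    · exact ⟨fun _ => 0, 0, fun h => absurd h h1⟩
  choose U T hUT using hex
  obtain ⟨Q, hQ⟩ := (hF.image (fun p => (p.1 : ℤ))).bddAbove
  set D := max C Q with hD
  let S := F ×ˢ (Set.Icc (fun _ _ => -D) (fun _ _ => D) : Set (Fin (k+l) → Fin (k+l) → ℤ))
  have hS : S.Finite := hF.prod (Set.finite_Icc _ _)
  obtain ⟨T0, hT0⟩ := (hS.image T).bddAbove
  refine ⟨T0, ⋃ t ∈ S, (Set.range (U t) ∪ Set.range t.1.2), hS.biUnion fun t _ => (Set.finite_range _).union (Set.finite_range _), ?_⟩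
  intro v h H hsm hla
  have hbd : ∀ (i : Fin k) j, |B (v (Fin.castAdd l i)) (v j)| ≤ C := by
    have aux : ∀ (i j : Fin (k+l)), h i ≤ τ → i ≤ j → |B (v i) (v j)| ≤ C := by
      intro i j hi hij
      have h1 := H.2.2.2.1 i j hij
      have h2 : |(B (v i) (v j) : ℝ)| ≤ C := h1.trans ((mul_le_mul_of_nonneg_left hi hA).trans (Int.le_ceil _))
      exact_mod_cast h2
    intro i j
    rcases le_total (Fin.castAdd l i) j with h1 | h1
    · exact aux _ _ (hsm i) h1
    · rw [hs]; exact aux _ _ ((H.2.2.1 h1).trans (hsm i)) h1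
  obtain ⟨p, hpF, u, hu1, hu2, hu3⟩ := hF0 v (fun i => (le_abs_self _).trans (hbd i _))
  have hq0 : (0:ℤ) < p.1 := by exact_mod_cast (hFf p hpF).1
  have hlc : ∀ i : Fin k, ¬ large (Fin.castAdd l i) := fun i => by simp [large]
  have hln : ∀ i : Fin l, large (Fin.natAdd k i) := fun i => by simp [large]
  have hM : (fun i j => typ p.1 u i j) ∈ (Set.Icc (fun _ _ => -D) (fun _ _ => D) : Set (Fin (k+l) → Fin (k+l) → ℤ)) := by
    have : ∀ i j, |typ p.1 u i j| ≤ D := by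
      intro i j
      refine Fin.addCases (fun i => ?_) (fun i => ?_) i
      · simp only [typ, hlc, false_and, if_false]
        rw [hu2]; exact (hbd i j).trans (le_max_left _ _)
      · refine Fin.addCases (fun j => ?_) (fun j => ?_) j
        · simp only [typ, hlc, and_false, if_false]
          rw [hs, hu2]; exact (hbd j _).trans (le_max_left _ _)
        · simp only [typ, hln, and_self, if_true]
          rw [abs_of_nonneg (Int.emod_nonneg _ hq0.ne')]
          exact (Int.emod_lt_of_pos _ hq0).le.trans ((hQ ⟨p, hpF, rfl⟩).trans (le_max_right _ _))
    exact ⟨fun i j => (abs_le.mp (this i j)).1, fun i j => (abs_le.mp (this i j)).2⟩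
  set t : (ℕ × (Fin (Fintype.card κ) → L)) × (Fin (k+l) → Fin (k+l) → ℤ) := (p, typ p.1 u) with ht
  have htS : t ∈ S := ⟨hpF, hM⟩
  obtain ⟨hty, hmain⟩ := hUT t hpF ⟨u, hu1, rfl⟩
  have htyp : ∀ i j, typ p.1 (U t) i j = typ p.1 u i j := fun i j => congrFun (congrFun hty i) j
  have g1 : ∀ (i : Fin k) j, B (v (Fin.castAdd l i)) (v j) = B (U t (Fin.castAdd l i)) (U t j) := by
    intro i j
    have := htyp (Fin.castAdd l i) j
    simp only [typ, hlc, false_and, if_false] at this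
    rw [this, hu2]
  have g2 : ∀ i j : Fin l, (p.1:ℤ) ∣ B (v (Fin.natAdd k i)) (v (Fin.natAdd k j)) - B (U t (Fin.natAdd k i)) (U t (Fin.natAdd k j)) := by
    intro i j
    have h1 := htyp (Fin.natAdd k i) (Fin.natAdd k j)
    simp only [typ, hln, and_self, if_true] at h1
    have h2 := hu3 i j
    have h3 : (p.1:ℤ) ∣ B (u (Fin.natAdd k i)) (u (Fin.natAdd k j)) - B (U t (Fin.natAdd k i)) (U t (Fin.natAdd k j)) :=
      (Int.ModEq.dvd h1)
    have := dvd_sub h3 h2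
    have e : ∀ x y z : ℤ, x - y - (x - z) = z - y := fun x y z => by ring
    rw [e] at this
    exact this
  obtain ⟨w, hw1, hw2⟩ := hmain _ h H (fun i => (hT0 ⟨t, htS, rfl⟩).trans (hla i)) g1 g2
  refine ⟨w, fun i => ?_, hw2⟩
  exact Submodule.span_mono (Set.subset_biUnion_of_mem (u := fun t => Set.range (U t) ∪ Set.range t.1.2) htS) (hw1 i)

end


section
variable {L : Type*} [AddCommGroup L] (B : LinearMap.BilinForm ℤ L)

lemma gram_mul {n m : ℕ} (U : Matrix (Fin m) (Fin n) ℤ) (v : Fin n → L) (i j : Fin m) :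
    B (∑ k, U i k • v k) (∑ l, U j l • v l) = (U * (Matrix.of fun a b => B (v a) (v b)) * Uᵀ) i j := by
  rw [bil_sum, Matrix.mul_apply]
  simp only [Matrix.mul_apply, Matrix.transpose_apply, Matrix.of_apply, Finset.sum_mul]
  rw [Finset.sum_comm]
  exact Finset.sum_congr rfl fun k _ => Finset.sum_congr rfl fun l _ => by ring

lemma bounded_case (n : ℕ) (D : ℤ) : ∃ Λ : Set L, Λ.Finite ∧ ∀ v : Fin n → L, (∀ i j, |B (v i) (v j)| ≤ D) →
    ∃ w : Fin n → L, (∀ i, w i ∈ Submodule.span ℤ Λ) ∧ ∀ i j, B (w i) (w j) = B (v i) (v j) := by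
  have : ∀ M : Fin n → Fin n → ℤ, ∃ w : Fin n → L, (∃ w : Fin n → L, ∀ i j, B (w i) (w j) = M i j) → ∀ i j, B (w i) (w j) = M i j := by
    intro M
    by_cases h : ∃ w : Fin n → L, ∀ i j, B (w i) (w j) = M i j
    · obtain ⟨w, hw⟩ := h; exact ⟨w, fun _ => hw⟩
    · exact ⟨fun _ => 0, fun h' => absurd h' h⟩
  choose W hW using this
  refine ⟨⋃ M ∈ (Set.Icc (fun _ _ => -D) (fun _ _ => D) : Set (Fin n → Fin n → ℤ)), Set.range (W M),
    (Set.finite_Icc _ _).biUnion fun M _ => Set.finite_range _, fun v hv => ?_⟩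
  refine ⟨W (fun i j => B (v i) (v j)), fun i => Submodule.subset_span (Set.mem_biUnion (x := fun i j => B (v i) (v j)) ?_ ⟨i, rfl⟩), hW _ ⟨v, fun _ _ => rfl⟩⟩
  exact ⟨fun i j => (abs_le.mp (hv i j)).1, fun i j => (abs_le.mp (hv i j)).2⟩

lemma claim (hs : ∀ x y, B x y = B y x) (hp : ∀ x, 0 ≤ B x x)
    (hfr : ∀ K, ∃ (c : ℕ) (f : Fin K → L), IsFrame B c f) (n : ℕ) (A : ℝ) (hA : 0 ≤ A) (k : ℕ) (hk : k ≤ n) :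
    ∃ (τ : ℝ) (Λ : Set L), Λ.Finite ∧ ∀ (v : Fin n → L) (h : Fin n → ℝ), RedCl A h (fun i j => B (v i) (v j)) →
      (∃ w : Fin n → L, (∀ i, w i ∈ Submodule.span ℤ Λ) ∧ ∀ i j, B (w i) (w j) = B (v i) (v j)) ∨
      ∀ i : Fin n, (i:ℕ) < k → h i ≤ τ := by
  induction k with
  | zero => exact ⟨0, ∅, Set.finite_empty, fun v h _ => Or.inr fun i hi => absurd hi (by omega)⟩
  | succ k ih =>
    obtain ⟨τ, Λ, hΛ, H⟩ := ih (by omega)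
    obtain ⟨l, rfl⟩ := Nat.exists_eq_add_of_le (show k ≤ n by omega)
    obtain ⟨T, Λ', hΛ', H'⟩ := stepC B hs hp hfr k l A hA τ
    refine ⟨max τ T, Λ ∪ Λ', hΛ.union hΛ', fun v h hv => ?_⟩
    rcases H v h hv with ⟨w, hw1, hw2⟩ | h1
    · exact Or.inl ⟨w, fun i => Submodule.span_mono Set.subset_union_left (hw1 i), hw2⟩
    · by_cases h2 : h ⟨k, by omega⟩ ≤ T
      · right
        intro i hi
        rcases Nat.lt_succ_iff_lt_or_eq.mp hi with h3 | h3
        · exact (h1 i h3).trans (le_max_left _ _)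
        · have : i = ⟨k, by omega⟩ := Fin.ext h3
          rw [this]; exact h2.trans (le_max_right _ _)
      · left
        obtain ⟨w, hw1, hw2⟩ := H' v h hv (fun i => h1 _ (by simp)) (fun i => (not_le.mp h2).le.trans (hv.2.2.1 (by simp [Fin.le_def])))
        exact ⟨w, fun i => Submodule.span_mono Set.subset_union_right (hw1 i), hw2⟩

lemma caseI (hs : ∀ x y, B x y = B y x) (hp : ∀ x, 0 ≤ B x x)
    (hfr : ∀ K, ∃ (c : ℕ) (f : Fin K → L), IsFrame B c f) (n : ℕ) :
    ∃ Λ : Set L, Λ.Finite ∧ ∀ v : Fin n → L, PDM (Matrix.of fun i j => B (v i) (v j)) →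
    ∃ w : Fin n → L, (∀ i, w i ∈ Submodule.span ℤ Λ) ∧ ∀ i j, B (w i) (w j) = B (v i) (v j) := by
  obtain ⟨A, hA1, hred⟩ := red n
  have hA : 0 ≤ A := by linarith
  obtain ⟨τ, Λ, hΛ, H⟩ := claim B hs hp hfr n A hA n le_rfl
  obtain ⟨Λ', hΛ', H'⟩ := bounded_case B n ⌈A * τ⌉
  have main : ∀ (v : Fin n → L) (h : Fin n → ℝ), RedCl A h (fun i j => B (v i) (v j)) →
      ∃ w : Fin n → L, (∀ i, w i ∈ Submodule.span ℤ (Λ ∪ Λ')) ∧ ∀ i j, B (w i) (w j) = B (v i) (v j) := by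
    intro v h hv
    rcases H v h hv with ⟨w, hw1, hw2⟩ | h1
    · exact ⟨w, fun i => Submodule.span_mono Set.subset_union_left (hw1 i), hw2⟩
    · have aux : ∀ i j, i ≤ j → |B (v i) (v j)| ≤ ⌈A * τ⌉ := by
        intro i j hij
        have h2 := hv.2.2.2.1 i j hij
        have h3 : |(B (v i) (v j) : ℝ)| ≤ ⌈A * τ⌉ := h2.trans ((mul_le_mul_of_nonneg_left (h1 i i.2) hA).trans (Int.le_ceil _))
        exact_mod_cast h3
      obtain ⟨w, hw1, hw2⟩ := H' v (fun i j => by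
        rcases le_total i j with h | h
        · exact aux i j h
        · rw [hs]; exact aux j i h)
      exact ⟨w, fun i => Submodule.span_mono Set.subset_union_right (hw1 i), hw2⟩
  refine ⟨Λ ∪ Λ', hΛ.union hΛ', fun v hv => ?_⟩
  obtain ⟨U, h, hU, hUr⟩ := hred _ hv
  obtain ⟨V, hV⟩ := hU.exists_left_inv
  obtain ⟨w', hw1, hw2⟩ := main (fun i => ∑ k, U i k • v k) h (by
    have : (fun i j => B (∑ k, U i k • v k) (∑ k, U j k • v k)) = U * (Matrix.of fun a b => B (v a) (v b)) * Uᵀ := by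
      funext i j; exact gram_mul B U v i j
    rw [this]; exact hUr)
  refine ⟨fun i => ∑ k, V i k • w' k, fun i => Submodule.sum_mem _ fun k _ => Submodule.smul_mem _ _ (hw1 k), fun i j => ?_⟩
  rw [gram_mul]
  have e : (Matrix.of fun a b => B (w' a) (w' b)) = U * (Matrix.of fun a b => B (v a) (v b)) * Uᵀ := by
    ext i j; rw [← gram_mul]; exact hw2 i j
  rw [e]
  have : V * (U * (Matrix.of fun a b => B (v a) (v b)) * Uᵀ) * Vᵀ = (V * U) * (Matrix.of fun a b => B (v a) (v b)) * (V * U)ᵀ := by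
    rw [Matrix.transpose_mul]; simp only [Matrix.mul_assoc]
  rw [this, hV]
  simp

lemma psd_rad (hs : ∀ x y, B x y = B y x) (hp : ∀ x, 0 ≤ B x x) (x : L) (hx : B x x ≤ 0) (y : L) : B x y = 0 := by
  by_contra hb
  have h1 := hp (y + (-(B x y * (B y y + 1))) • x)
  simp only [map_add, LinearMap.add_apply, map_smul, LinearMap.smul_apply, smul_eq_mul] at h1
  have h2 : B x x = 0 := le_antisymm hx (hp x)
  rw [h2, hs y x] at h1
  have h3 : 1 ≤ (B x y)^2 := by have : 0 < (B x y)^2 := by positivity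
                                omega
  have h4 := hp y
  nlinarith

lemma caseF (hs : ∀ x y, B x y = B y x) (hp : ∀ x, 0 ≤ B x x) (s : Finset L)
    (hsx : ∀ y, (∀ x ∈ s, B x y = 0) → B y y ≤ 0) (n : ℕ) :
    ∃ Λ : Set L, Λ.Finite ∧ ∀ v : Fin n → L,
    ∃ w : Fin n → L, (∀ i, w i ∈ Submodule.span ℤ Λ) ∧ ∀ i j, B (w i) (w j) = B (v i) (v j) := by
  let φ : L →ₗ[ℤ] (s → ℤ) := LinearMap.pi fun x => B x.1
  obtain ⟨G, hG⟩ := IsNoetherian.noetherian (LinearMap.range φ)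
  have hpre : ∀ g : s → ℤ, ∃ x : L, g ∈ LinearMap.range φ → φ x = g := by
    intro g
    by_cases h : g ∈ LinearMap.range φ
    · obtain ⟨x, hx⟩ := h; exact ⟨x, fun _ => hx⟩
    · exact ⟨0, fun h' => absurd h' h⟩
  choose ψ hψ using hpre
  have hmap : Submodule.map φ (Submodule.span ℤ (ψ '' (G : Set (s → ℤ)))) = LinearMap.range φ := by
    rw [Submodule.map_span, Set.image_image]
    have : (fun g => φ (ψ g)) '' (G : Set (s → ℤ)) = G := by
      rw [Set.image_congr (g := id), Set.image_id]
      intro g hg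
      exact hψ g (by rw [← hG]; exact Submodule.subset_span hg)
    rw [this, hG]
  refine ⟨ψ '' (G : Set (s → ℤ)), G.finite_toSet.image _, fun v => ?_⟩
  have : ∀ i, ∃ w ∈ Submodule.span ℤ (ψ '' (G : Set (s → ℤ))), φ w = φ (v i) := by
    intro i
    have : φ (v i) ∈ Submodule.map φ (Submodule.span ℤ (ψ '' (G : Set (s → ℤ)))) := by rw [hmap]; exact ⟨_, rfl⟩
    exact this
  choose w hw1 hw2 using this
  refine ⟨w, hw1, fun i j => ?_⟩
  have hrad : ∀ i y, B (w i - v i) y = 0 := by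
    intro i y
    refine psd_rad B hs hp _ (hsx _ fun x hx => ?_) y
    have := congrFun (hw2 i) ⟨x, hx⟩
    rw [map_sub, sub_eq_zero]
    exact this
  have e1 : B (w i) (w j) = B (v i) (w j) := by
    have := hrad i (w j); rw [map_sub, LinearMap.sub_apply, sub_eq_zero] at this; exact this
  have e2 : B (w j) (v i) = B (v j) (v i) := by
    have := hrad j (v i); rw [map_sub, LinearMap.sub_apply, sub_eq_zero] at this; exact this
  rw [e1, hs, e2, hs]

theorem mainStar (hs : ∀ x y, B x y = B y x) (hp : ∀ x, 0 ≤ B x x) (n : ℕ) :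
    ∃ Λ : Set L, Λ.Finite ∧ ∀ v : Fin n → L, PDM (Matrix.of fun i j => B (v i) (v j)) →
    ∃ w : Fin n → L, (∀ i, w i ∈ Submodule.span ℤ Λ) ∧ ∀ i j, B (w i) (w j) = B (v i) (v j) := by
  by_cases h : ∀ s : Finset L, (∀ x ∈ s, 0 < B x x) → ∃ y, 0 < B y y ∧ ∀ x ∈ s, B x y = 0
  · obtain ⟨e, he1, he2⟩ := exists_seq_of_forall_finset_exists (fun x => 0 < B x x) (fun x y => B x y = 0) h
    refine caseI B hs hp (fun K => ?_) n
    obtain ⟨c, f, h1, h2, h3⟩ := frames B e (fun i j hij => by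
      rcases lt_or_gt_of_ne hij with h | h
      · exact he2 _ _ h
      · rw [hs]; exact he2 _ _ h) he1 K
    exact ⟨c, f, h1, h2, h3⟩
  · push Not at h
    obtain ⟨s, -, hs2⟩ := h
    obtain ⟨Λ, hΛ, H⟩ := caseF B hs hp s (fun y hy => by
      by_contra hc
      obtain ⟨x, hx, hxy⟩ := hs2 y (not_le.mp hc)
      exact hxy (hy x hx)) n
    exact ⟨Λ, hΛ, fun v _ => H v⟩

end


lemma ultra_lim (U : Ultrafilter ℕ) (g : ℕ → ℤ) (D : ℤ) (hg : ∀ j, |g j| ≤ D) : ∃ a, ∀ᶠ j in (U : Filter ℕ), g j = a := by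
  have h1 : (⋃ a ∈ Set.Icc (-D) D, {j | g j = a}) ∈ U := by
    have : (⋃ a ∈ Set.Icc (-D) D, {j | g j = a}) = Set.univ := by
      ext j
      simp only [Set.mem_iUnion, Set.mem_univ, iff_true]
      exact ⟨g j, abs_le.mp (hg j), rfl⟩
    rw [this]; exact Filter.univ_mem
  rw [Ultrafilter.finite_biUnion_mem_iff (Set.finite_Icc _ _)] at h1
  obtain ⟨a, -, ha⟩ := h1
  exact ⟨a, ha⟩

lemma represents_of_cls {r n : ℕ} {L : QLat r} {c : Cls n} (N : QLat n) (hN : cls N = c) (h : RepCls L c) : Represents L.1 N.1 := by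
  obtain ⟨N', h1, h2⟩ := h
  have : Isom N'.1 N.1 := Quotient.exact (h1.trans hN.symm)
  exact h2.trans' this.1

/-- bilinear form of a Gram matrix -/
noncomputable def gramForm {r : ℕ} (G : Mat r) : LinearMap.BilinForm ℤ (Fin r → ℤ) := Matrix.toBilin' G

lemma gramForm_apply {r : ℕ} (G : Mat r) (x y : Fin r → ℤ) : gramForm G x y = x ⬝ᵥ (G *ᵥ y) := by
  rw [gramForm, Matrix.toBilin'_apply']

lemma gram_rows {r n : ℕ} (G : Mat r) (T : Matrix (Fin n) (Fin r) ℤ) (i j : Fin n) :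
    gramForm G (T i) (T j) = (T * G * Tᵀ) i j := by
  rw [gramForm_apply, Matrix.mul_assoc, Matrix.mul_apply]
  rfl

theorem kko (n : ℕ) (S : Set (Cls n)) : ∃ S0 : Set (Cls n), S0 ⊆ S ∧ S0.Finite ∧
    ∀ (r : ℕ) (L : QLat r), (∀ c ∈ S0, RepCls L c) → ∀ c ∈ S, RepCls L c := by
  by_contra hcon
  push Not at hcon
  rcases S.eq_empty_or_nonempty with hS | hS
  · obtain ⟨r, L, -, c, hc, -⟩ := hcon ∅ (Set.empty_subset _) Set.finite_empty
    rw [hS] at hc; exact hc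
  haveI : Countable (Mat n) := inferInstanceAs (Countable (Fin n → Fin n → ℤ))
  haveI : Countable (QLat n) := inferInstanceAs (Countable {G : Mat n // PosDefInt G})
  haveI : Countable (Cls n) := by unfold Cls; infer_instance
  obtain ⟨c, hc⟩ := (Set.to_countable S).exists_eq_range hS
  have hex : ∀ j : ℕ, ∃ (r : ℕ) (L : QLat r), (∀ i ≤ j, RepCls L (c i)) ∧ ∃ a ∈ S, ¬ RepCls L a := by
    intro j
    obtain ⟨r, L, h1, h2⟩ := hcon (c '' Set.Iic j) (by rw [hc]; exact Set.image_subset_range _ _) ((Set.finite_Iic j).image _)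
    exact ⟨r, L, fun i hi => h1 _ ⟨i, hi, rfl⟩, h2⟩
  choose r Lj hL1 hL2 using hex
  have hN : ∀ i, ∃ N : QLat n, cls N = c i := fun i => Quotient.exists_rep (c i)
  choose N hN using hN
  have hT : ∀ j i, ∃ T : Matrix (Fin n) (Fin (r j)) ℤ, (i ≤ j → T * (Lj j).1 * Tᵀ = (N i).1) ∧ (¬ i ≤ j → T = 0) := by
    intro j i
    by_cases h : i ≤ j
    · obtain ⟨T, hT⟩ := represents_of_cls (N i) (hN i) (hL1 j i h)
      exact ⟨T, fun _ => hT, fun h' => absurd h h'⟩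
    · exact ⟨0, fun h' => absurd h' h, fun _ => rfl⟩
  choose T hT1 hT2 using hT
  let Bj : ∀ j, LinearMap.BilinForm ℤ (Fin (r j) → ℤ) := fun j => gramForm (Lj j).1
  have hBs : ∀ j x y, Bj j x y = Bj j y x := by
    intro j x y
    simp only [Bj, gramForm_apply]
    rw [Matrix.dotProduct_mulVec, dotProduct_comm, ← Matrix.mulVec_transpose, (Lj j).2.1]
  have hBp : ∀ j x, 0 ≤ Bj j x x := by
    intro j x
    simp only [Bj, gramForm_apply]
    by_cases h : x = 0
    · simp [h]
    · exact ((Lj j).2.2 x h).le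
  let X : ∀ j, ℕ × Fin n → Fin (r j) → ℤ := fun j p => T j p.1 p.2
  have hXn : ∀ j p, Bj j (X j p) (X j p) ≤ |(N p.1).1 p.2 p.2| := by
    intro j p
    by_cases h : p.1 ≤ j
    · have := gram_rows (Lj j).1 (T j p.1) p.2 p.2
      rw [hT1 j p.1 h] at this
      exact this.le.trans (le_abs_self _)
    · have : X j p = 0 := by simp only [X]; rw [hT2 j p.1 h]; rfl
      rw [this]; simp
  let U : Ultrafilter ℕ := Filter.hyperfilter ℕ
  have hU : ∀ i, ∀ᶠ j in (U : Filter ℕ), i ≤ j := by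
    intro i
    have h1 : (U : Filter ℕ) ≤ Filter.cofinite := Filter.hyperfilter_le_cofinite
    rw [Nat.cofinite_eq_atTop] at h1
    exact h1 (Filter.eventually_ge_atTop i)
  have hg : ∀ p q : ℕ × Fin n, ∃ a : ℤ, ∀ᶠ j in (U : Filter ℕ), Bj j (X j p) (X j q) = a := fun p q =>
    ultra_lim U _ (|(N p.1).1 p.2 p.2| + |(N q.1).1 q.2 q.2|) fun j =>
      (bil_bound (Bj j) (hBs j) (hBp j) _ _).trans (add_le_add (hXn j p) (hXn j q))
  choose g hg using hg
  let B : LinearMap.BilinForm ℤ ((ℕ × Fin n) →₀ ℤ) :=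
    Finsupp.linearCombination ℤ (fun p => (Finsupp.linearCombination ℤ (g p) : ((ℕ × Fin n) →₀ ℤ) →ₗ[ℤ] ℤ))
  let φ : ∀ j, ((ℕ × Fin n) →₀ ℤ) →ₗ[ℤ] (Fin (r j) → ℤ) := fun j => Finsupp.linearCombination ℤ (X j)
  have hlim : ∀ x y, ∀ᶠ j in (U : Filter ℕ), Bj j (φ j x) (φ j y) = B x y := by
    intro x y
    induction x using Finsupp.induction_linear with
    | zero => simp
    | add x1 x2 h1 h2 =>
      filter_upwards [h1, h2] with j e1 e2
      simp only [map_add, LinearMap.add_apply, e1, e2]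
    | single p a =>
      induction y using Finsupp.induction_linear with
      | zero => simp
      | add x1 x2 h1 h2 =>
        filter_upwards [h1, h2] with j e1 e2
        simp only [map_add, e1, e2]
      | single q b =>
        filter_upwards [hg p q] with j e
        simp only [φ, B, Finsupp.linearCombination_single, map_smul, LinearMap.smul_apply, e, smul_eq_mul]
        ring
  have hsym : ∀ x y, B x y = B y x := by
    intro x y
    obtain ⟨j, h1, h2⟩ := ((hlim x y).and (hlim y x)).exists
    rw [← h1, ← h2, hBs]
  have hpsd : ∀ x, 0 ≤ B x x := by
    intro x
    obtain ⟨j, h1⟩ := (hlim x x).exists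
    rw [← h1]; exact hBp j _
  obtain ⟨Λ, hΛ, hmain⟩ := mainStar B hsym hpsd n
  have hw : ∀ i, ∃ w : Fin n → ((ℕ × Fin n) →₀ ℤ), (∀ a, w a ∈ Submodule.span ℤ Λ) ∧ ∀ a b, B (w a) (w b) = (N i).1 a b := by
    intro i
    have hgr : ∀ a b, B (Finsupp.single (i, a) 1) (Finsupp.single (i, b) 1) = (N i).1 a b := by
      intro a b
      obtain ⟨j, h1, h2⟩ := ((hlim (Finsupp.single (i, a) 1) (Finsupp.single (i, b) 1)).and (hU i)).exists
      rw [← h1]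
      simp only [φ, Finsupp.linearCombination_single, one_smul]
      have := gram_rows (Lj j).1 (T j i) a b
      rw [hT1 j i h2] at this
      exact this
    obtain ⟨w, hw1, hw2⟩ := hmain (fun a => Finsupp.single (i, a) 1) (by
      have e : (Matrix.of fun a b => B (Finsupp.single (i, a) 1) (Finsupp.single (i, b) 1)) = (N i).1 := by
        ext a b; exact hgr a b
      rw [e]
      refine ⟨fun a b => (congrFun (congrFun (N i).2.1 b) a), fun x hx => ?_⟩
      rw [quad_eq]; exact (N i).2.2 x hx)
    exact ⟨w, hw1, fun a b => (hw2 a b).trans (hgr a b)⟩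
  have hev : ∀ᶠ j in (U : Filter ℕ), ∀ x ∈ Λ, ∀ y ∈ Λ, Bj j (φ j x) (φ j y) = B x y := by
    rw [Filter.eventually_all_finite hΛ]
    intro x _
    rw [Filter.eventually_all_finite hΛ]
    intro y _
    exact hlim x y
  obtain ⟨j, hj⟩ := hev.exists
  have hspan : ∀ x y, x ∈ Submodule.span ℤ Λ → y ∈ Submodule.span ℤ Λ → Bj j (φ j x) (φ j y) = B x y := by
    intro x y hx hy
    have := span_orth ((Bj j).compl₁₂ (φ j) (φ j) - B) Λ Λ (fun x hx y hy => by
      simp only [LinearMap.sub_apply, LinearMap.compl₁₂_apply]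
      rw [hj x hx y hy, sub_self]) hx hy
    simp only [LinearMap.sub_apply, LinearMap.compl₁₂_apply] at this
    exact sub_eq_zero.mp this
  obtain ⟨a, haS, ha⟩ := hL2 j
  apply ha
  rw [hc] at haS
  obtain ⟨i, rfl⟩ := haS
  obtain ⟨w, hw1, hw2⟩ := hw i
  refine ⟨N i, hN i, ⟨Matrix.of fun a => φ j (w a), ?_⟩⟩
  ext a b
  rw [← gram_rows, ← hw2, ← hspan _ _ (hw1 a) (hw1 b)]
  rfl

lemma exc_induct (n k : ℕ) : ∀ F : Set (Cls n),
    {E : Set (Cls n) | F ⊆ E ∧ E.Finite ∧ (E \ F).ncard = k ∧ ∃ (r : ℕ) (L : QLat r), E = ExcSet n L}.Finite := by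
  induction k with
  | zero =>
    intro F
    refine (Set.finite_singleton F).subset ?_
    rintro E ⟨h1, h2, h3, -⟩
    rw [Set.ncard_eq_zero (h2.subset Set.diff_subset), Set.diff_eq_empty] at h3
    exact Set.Subset.antisymm h3 h1
  | succ k ih =>
    intro F
    obtain ⟨S0, hS0, hfin, H⟩ := kko n Fᶜ
    refine (hfin.biUnion fun c _ => ih (insert c F)).subset ?_
    rintro E ⟨h1, h2, h3, r, L, hE⟩
    have hne : (E \ F).Nonempty := Set.nonempty_of_ncard_ne_zero (by omega)
    obtain ⟨a, haE, haF⟩ := hne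
    have : ∃ c ∈ S0, ¬ RepCls L c := by
      by_contra hcon
      push Not at hcon
      have h4 := H r L hcon a haF
      rw [hE] at haE
      exact haE h4
    obtain ⟨c, hc, hcL⟩ := this
    have hcE : c ∈ E := by rw [hE]; exact hcL
    have hcF : c ∉ F := hS0 hc
    refine Set.mem_biUnion hc ⟨Set.insert_subset hcE h1, h2, ?_, r, L, hE⟩
    have h5 : E \ insert c F = (E \ F) \ {c} := by
      ext x; simp only [Set.mem_diff, Set.mem_insert_iff, Set.mem_singleton_iff]; tauto
    rw [h5, Set.ncard_diff_singleton_of_mem (show c ∈ E \ F from ⟨hcE, hcF⟩), h3]; rfl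

/-- For any positive integers `m` and `n`, there are only finitely
many `n`-exceptional sets of size `m`: the collection of sets `S` of isometry
classes of rank-`n` positive definite integral lattices with `|S| = m` which arise
as the `n`-exceptional set of some positive definite integral lattice is finite. -/
theorem finitely_many_exceptional_sets (m n : ℕ) (hm : 0 < m) (hn : 0 < n) :
    {S : Set (Cls n) | S.ncard = m ∧ ∃ (r : ℕ) (L : QLat r), S = ExcSet n L}.Finite := by
  refine (exc_induct n m ∅).subset ?_
  rintro E ⟨h1, h2⟩
  refine ⟨Set.empty_subset _, Set.finite_of_ncard_ne_zero (by omega), ?_, h2⟩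
  rw [Set.diff_empty, h1]
end

section
/- Let L be a positive definite integral lattice of rank n+1 containing D_n as a primitive sublattice. Then L is isometric to D_n ⊥ ⟨a⟩, or to (D_n ⊥ ℤz) + ℤ([1] + z/4) with Q(z) = 16a − 4n, or to (D_n ⊥ ℤz) + ℤ([2] + z/2) with Q(z) = 4a, for some positive integer a. -/
open Matrix

/-- Gram matrix of the orthogonal sum of two lattices. -/
def sumGram {a b : ℕ} (A : Mat a) (B : Mat b) : Mat (a + b) :=
  Matrix.reindex finSumFinEquiv finSumFinEquiv (Matrix.fromBlocks A 0 0 B)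

/-- `L` primitively represents `N`: there is a representation whose image is a
primitive sublattice (equivalently, the coordinate matrix `T` has an integral
right inverse). -/
def PrimRep {m n : ℕ} (L : Mat m) (N : Mat n) : Prop :=
  ∃ T : Matrix (Fin n) (Fin m) ℤ,
    T * L * T.transpose = N ∧ ∃ S : Matrix (Fin m) (Fin n) ℤ, T * S = 1

/-- Gram matrix of the root lattice `D_n` with respect to the basis
`b_0 = e_0 + e_1`, `b_j = e_{j-1} - e_j` for `1 ≤ j ≤ n-1`. -/
def Dgram (n : ℕ) : Mat n :=
  Matrix.of fun i j =>
    if i = j then 2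
    else if ((i : ℕ) = 0 ∧ (j : ℕ) = 2) ∨ ((i : ℕ) = 2 ∧ (j : ℕ) = 0) then 1
    else if (1 ≤ (i : ℕ) ∧ (i : ℕ) + 1 = (j : ℕ)) ∨ (1 ≤ (j : ℕ) ∧ (j : ℕ) + 1 = (i : ℕ)) then -1
    else 0


/-- Gram matrix of the lattice `(D_n ⊥ ℤz) + ℤ([1] + z/4)` with `Q(z) = 16a - 4n`:
`Dgram n` bordered by `B(b_j, [1]) = δ_{j,0}` with corner `Q([1] + z/4) = a`. -/
def Dglue1 (n : ℕ) (a : ℤ) : Mat (n + 1) :=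
  Matrix.of fun r c =>
    if hr : (r : ℕ) < n then
      if hc : (c : ℕ) < n then Dgram n ⟨r, hr⟩ ⟨c, hc⟩
      else if (r : ℕ) = 0 then 1 else 0
    else
      if hc : (c : ℕ) < n then (if (c : ℕ) = 0 then 1 else 0)
      else a

/-- Gram matrix of the lattice `(D_n ⊥ ℤz) + ℤ([2] + z/2)` with `Q(z) = 4a`:
`Dgram n` bordered by `B(b_j, [2]) = -δ_{j,n-1}` with corner `Q([2] + z/2) = 1 + a`. -/
def Dglue2 (n : ℕ) (a : ℤ) : Mat (n + 1) :=
  Matrix.of fun r c =>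
    if hr : (r : ℕ) < n then
      if hc : (c : ℕ) < n then Dgram n ⟨r, hr⟩ ⟨c, hc⟩
      else if (r : ℕ) = n - 1 then -1 else 0
    else
      if hc : (c : ℕ) < n then (if (c : ℕ) = n - 1 then -1 else 0)
      else 1 + a


namespace DnAux

/-- Unimodular equivalence of Gram matrices. -/
def SI {m k : Type} [Fintype m] [DecidableEq m] [Fintype k] [DecidableEq k]
    (A : Matrix m m ℤ) (B : Matrix k k ℤ) : Prop :=
  ∃ (U : Matrix k m ℤ) (V : Matrix m k ℤ), V * U = 1 ∧ U * V = 1 ∧ U * A * Uᵀ = B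

section
variable {m k l : Type} [Fintype m] [DecidableEq m] [Fintype k] [DecidableEq k]
  [Fintype l] [DecidableEq l]

theorem SI.trans {A : Matrix m m ℤ} {B : Matrix k k ℤ} {C : Matrix l l ℤ}
    (h1 : SI A B) (h2 : SI B C) : SI A C := by
  obtain ⟨U, V, a, b, c⟩ := h1
  obtain ⟨U', V', a', b', c'⟩ := h2
  refine ⟨U' * U, V * V', ?_, ?_, ?_⟩
  · calc V * V' * (U' * U) = V * (V' * U') * U := by simp only [Matrix.mul_assoc]
      _ = 1 := by rw [a', Matrix.mul_one, a]
  · calc U' * U * (V * V') = U' * (U * V) * V' := by simp only [Matrix.mul_assoc]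
      _ = 1 := by rw [b, Matrix.mul_one, b']
  · rw [← c', ← c, Matrix.transpose_mul]; simp only [Matrix.mul_assoc]

theorem SI.back {A : Matrix m m ℤ} {B : Matrix k k ℤ} (h : SI A B) :
    ∃ V : Matrix m k ℤ, V * B * Vᵀ = A := by
  obtain ⟨U, V, a, b, c⟩ := h
  refine ⟨V, ?_⟩
  calc V * B * Vᵀ = (V * U) * A * (V * U)ᵀ := by
        rw [← c, Matrix.transpose_mul]; simp only [Matrix.mul_assoc]
    _ = A := by rw [a]; simp

theorem SI.pos {A : Matrix m m ℤ} {B : Matrix k k ℤ} (h : SI A B)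
    (hA : ∀ v : m → ℤ, v ≠ 0 → 0 < v ⬝ᵥ A.mulVec v) (v : k → ℤ) (hv : v ≠ 0) :
    0 < v ⬝ᵥ B.mulVec v := by
  obtain ⟨U, V, a, b, c⟩ := h
  have h1 : v ᵥ* U ≠ 0 := by
    intro h0
    apply hv
    have : (v ᵥ* U) ᵥ* V = v := by rw [Matrix.vecMul_vecMul, b, Matrix.vecMul_one]
    rw [← this, h0, Matrix.zero_vecMul]
  have := hA _ h1
  rw [← c, ← Matrix.mulVec_mulVec, ← Matrix.mulVec_mulVec, Matrix.mulVec_transpose,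
    Matrix.dotProduct_mulVec]
  exact this

theorem SI.reindex (A : Matrix m m ℤ) (e : m ≃ k) : SI A (Matrix.reindex e e A) := by
  refine ⟨(1 : Matrix m m ℤ).submatrix e.symm id, (1 : Matrix m m ℤ).submatrix id e.symm,
    ?_, ?_, ?_⟩
  · rw [Matrix.submatrix_mul_equiv]; simp
  · rw [← Matrix.submatrix_mul _ _ _ _ _ Function.bijective_id]; simp
  · ext i j
    simp [Matrix.mul_apply, Matrix.one_apply]
end

/-- Bordered `D_n` Gram matrix. -/
def BM (n : ℕ) (v : Fin n → ℤ) (c : ℤ) : Matrix (Fin n ⊕ Fin 1) (Fin n ⊕ Fin 1) ℤ :=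
  Matrix.fromBlocks (Dgram n) (Matrix.of fun i _ => v i) (Matrix.of fun _ j => v j)
    (Matrix.of fun _ _ => c)

theorem Dsymm (n : ℕ) : (Dgram n)ᵀ = Dgram n := by
  ext i j
  simp only [Matrix.transpose_apply, Dgram, Matrix.of_apply]
  grind

theorem shift (n : ℕ) (v x : Fin n → ℤ) (c : ℤ) :
    ∃ c', SI (BM n v c) (BM n (v + (Dgram n).mulVec x) c') := by
  let X : Matrix (Fin 1) (Fin n) ℤ := Matrix.of fun _ j => x j
  let R : Matrix (Fin 1) (Fin n) ℤ := Matrix.of fun _ j => v j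
  let C : Matrix (Fin 1) (Fin 1) ℤ := Matrix.of fun _ _ => c
  refine ⟨((X * Dgram n + R) * Xᵀ + (X * Rᵀ + C)) 0 0, Matrix.fromBlocks 1 0 X 1,
    Matrix.fromBlocks 1 0 (-X) 1, ?_, ?_, ?_⟩
  · simp [Matrix.fromBlocks_multiply]
  · simp [Matrix.fromBlocks_multiply]
  · have hb : BM n v c = Matrix.fromBlocks (Dgram n) Rᵀ R C := rfl
    rw [hb, Matrix.fromBlocks_transpose, Matrix.fromBlocks_multiply, Matrix.fromBlocks_multiply]
    unfold BM
    congr 1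
    · simp
    · ext i j
      simp [R, X, Matrix.mul_apply, Matrix.mulVec, dotProduct, add_comm]
    · ext i j
      have : X * Dgram n = (Dgram n * Xᵀ)ᵀ := by rw [Matrix.transpose_mul, Dsymm]; simp
      simp only [Matrix.one_mul, Matrix.transpose_one, Matrix.mul_one, Matrix.transpose_zero,
        Matrix.mul_zero, add_zero, this]
      simp [R, X, Matrix.mul_apply, Matrix.mulVec, dotProduct, add_comm, mul_comm]
    · ext i j
      fin_cases i; fin_cases j
      simp

theorem neg (n : ℕ) (v : Fin n → ℤ) (c : ℤ) : SI (BM n v c) (BM n (-v) c) := by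
  refine ⟨Matrix.fromBlocks 1 0 0 (-1), Matrix.fromBlocks 1 0 0 (-1), ?_, ?_, ?_⟩
  · simp [Matrix.fromBlocks_multiply]
  · simp [Matrix.fromBlocks_multiply]
  · unfold BM
    rw [Matrix.fromBlocks_transpose, Matrix.fromBlocks_multiply, Matrix.fromBlocks_multiply]
    congr 1
    · simp
    · ext i j; simp
    · ext i j; simp
    · ext i j; simp

theorem act (n : ℕ) (P : Matrix (Fin n) (Fin n) ℤ) (hP : P * P = 1)
    (hD : P * Dgram n * Pᵀ = Dgram n) (v : Fin n → ℤ) (c : ℤ) :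
    SI (BM n v c) (BM n (P.mulVec v) c) := by
  refine ⟨Matrix.fromBlocks P 0 0 1, Matrix.fromBlocks P 0 0 1, ?_, ?_, ?_⟩
  · simp [Matrix.fromBlocks_multiply, hP]
  · simp [Matrix.fromBlocks_multiply, hP]
  · unfold BM
    rw [Matrix.fromBlocks_transpose, Matrix.fromBlocks_multiply, Matrix.fromBlocks_multiply]
    congr 1
    · simpa using hD
    · ext i j; simp [Matrix.mul_apply, Matrix.mulVec, dotProduct]
    · ext i j; simp [Matrix.mul_apply, Matrix.mulVec, dotProduct, mul_comm]
    · ext i j; simp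

/-- Unit vectors with natural index. -/
def d (n j : ℕ) : Fin n → ℤ := fun i => if (i : ℕ) = j then 1 else 0

theorem d_dot (n j : ℕ) (hj : j < n) (u : Fin n → ℤ) : d n j ⬝ᵥ u = u ⟨j, hj⟩ := by
  simp only [d, dotProduct, ite_mul, one_mul, zero_mul]
  rw [Finset.sum_eq_single ⟨j, hj⟩]
  · simp
  · intro b _ hb
    rw [if_neg]
    intro h; exact hb (Fin.ext h)
  · simp

theorem d_n (n : ℕ) : d n n = 0 := by
  ext i; have := i.2; simp [d]; omega

theorem D_mul_d (n j : ℕ) (hj : j < n) (i : Fin n) :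
    (Dgram n).mulVec (d n j) i = Dgram n i ⟨j, hj⟩ := by
  rw [Matrix.mulVec, dotProduct_comm, d_dot n j hj]

theorem col0 (n : ℕ) (hn : 4 ≤ n) :
    (Dgram n).mulVec (d n 0) = 2 • d n 0 + d n 2 := by
  ext i
  rw [D_mul_d n 0 (by omega)]
  simp [Dgram, d, Fin.ext_iff]
  grind

theorem col1 (n : ℕ) (hn : 4 ≤ n) :
    (Dgram n).mulVec (d n 1) = 2 • d n 1 - d n 2 := by
  ext i
  rw [D_mul_d n 1 (by omega)]
  simp [Dgram, d, Fin.ext_iff]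
  grind

theorem col2 (n : ℕ) (hn : 4 ≤ n) :
    (Dgram n).mulVec (d n 2) = d n 0 - d n 1 + 2 • d n 2 - d n 3 := by
  ext i
  rw [D_mul_d n 2 (by omega)]
  simp [Dgram, d, Fin.ext_iff]
  grind

theorem colj (n j : ℕ) (hj : j + 3 < n) :
    (Dgram n).mulVec (d n (j + 3)) = - d n (j + 2) + 2 • d n (j + 3) - d n (j + 4) := by
  ext i
  rw [D_mul_d n (j + 3) (by omega)]
  simp [Dgram, d, Fin.ext_iff]
  grind

/-- index swap -/
def sg {n : ℕ} (hn : 4 ≤ n) (i : Fin n) : Fin n :=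
  if (i : ℕ) = 0 then ⟨1, by omega⟩ else if (i : ℕ) = 1 then ⟨0, by omega⟩ else i

/-- sign -/
def sn {n : ℕ} (i : Fin n) : ℤ := if (i : ℕ) ≤ 1 then -1 else 1

/-- The reflection exchanging the two spinor cosets. -/
def P {n : ℕ} (hn : 4 ≤ n) : Matrix (Fin n) (Fin n) ℤ :=
  Matrix.of fun i j => if sg hn i = j then sn i else 0

theorem P_mul {n : ℕ} (hn : 4 ≤ n) (M : Matrix (Fin n) (Fin n) ℤ) (i j : Fin n) :
    (P hn * M) i j = sn i * M (sg hn i) j := by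
  simp [P, Matrix.mul_apply]

theorem P_P {n : ℕ} (hn : 4 ≤ n) : P hn * P hn = 1 := by
  ext i j
  rw [P_mul, Matrix.one_apply]
  simp only [P, Matrix.of_apply, sg, sn, Fin.ext_iff]
  grind

theorem P_D {n : ℕ} (hn : 4 ≤ n) : P hn * Dgram n * (P hn)ᵀ = Dgram n := by
  ext i j
  rw [Matrix.mul_assoc, P_mul, ← Matrix.transpose_apply (Dgram n * (P hn)ᵀ),
    Matrix.transpose_mul, Matrix.transpose_transpose, P_mul, Dsymm]
  by_cases i0 : (i : ℕ) = 0 <;> by_cases i1 : (i : ℕ) = 1 <;>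
    by_cases j0 : (j : ℕ) = 0 <;> by_cases j1 : (j : ℕ) = 1 <;>
    first
    | omega
    | (have ci : (i : ℕ) ≤ 1 ↔ ((i : ℕ) = 0 ∨ (i : ℕ) = 1) := by omega
       have cj : (j : ℕ) ≤ 1 ↔ ((j : ℕ) = 0 ∨ (j : ℕ) = 1) := by omega
       simp only [Dgram, Matrix.of_apply, sg, sn, Fin.ext_iff, ci, cj, i0, i1, j0, j1, if_true,
         if_false, or_true, true_or, or_false]
       grind)

theorem P_d1 {n : ℕ} (hn : 4 ≤ n) : (P hn).mulVec (d n 1) = - d n 0 := by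
  ext i
  rw [Matrix.mulVec, dotProduct_comm, d_dot n 1 (by omega)]
  simp only [P, Matrix.of_apply, sg, sn, Fin.ext_iff, d, Pi.neg_apply]
  grind

/-- The image of `D_n` in its dual, in coordinates. -/
def H (n : ℕ) : Submodule ℤ (Fin n → ℤ) := LinearMap.range (Dgram n).mulVecLin

theorem mem_H (n : ℕ) (x : Fin n → ℤ) : (Dgram n).mulVec x ∈ H n := ⟨x, rfl⟩

theorem red (n k j : ℕ) (hj : 2 ≤ j) (hjk : j + k = n) (hn : 4 ≤ n) :
    d n j - (k : ℤ) • d n (n - 1) ∈ H n := by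
  induction k using Nat.strong_induction_on generalizing j with
  | _ k ih =>
    match k with
    | 0 =>
      obtain rfl : j = n := by omega
      simp [d_n]
    | 1 =>
      obtain rfl : j = n - 1 := by omega
      simp
    | k + 2 =>
      have h1 := ih (k + 1) (by omega) (j + 1) (by omega) (by omega)
      have h2 := ih k (by omega) (j + 2) (by omega) (by omega)
      have h3 := mem_H n (d n (j + 1))
      obtain ⟨i, rfl⟩ : ∃ i, j = i + 2 := ⟨j - 2, by omega⟩
      rw [colj n i (by omega)] at h3
      have := (H n).sub_mem ((H n).sub_mem ((H n).smul_mem (2 : ℤ) h1) h2) h3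
      convert this using 1
      push_cast
      module

theorem classes (n : ℕ) (hn : 4 ≤ n) (v : Fin n → ℤ) :
    v ∈ H n ∨ v + d n (n - 1) ∈ H n ∨ v - d n 0 ∈ H n ∨ v + d n 0 ∈ H n ∨
      v - d n 1 ∈ H n := by
  set g := d n (n - 1) with hg
  have h2 : d n 2 - ((n - 2 : ℕ) : ℤ) • g ∈ H n := red n _ 2 le_rfl (by omega) hn
  have h3 : d n 3 - ((n - 3 : ℕ) : ℤ) • g ∈ H n := red n _ 3 (by omega) (by omega) hn
  have c0 := mem_H n (d n 0)
  have c1 := mem_H n (d n 1)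
  have c2 := mem_H n (d n 2)
  rw [col0 n hn] at c0
  rw [col1 n hn] at c1
  rw [col2 n hn] at c2
  push_cast [show 2 ≤ n by omega, show 3 ≤ n by omega] at h2 h3
  -- d1 - d0 - (n-1) g
  have e1 : d n 1 - d n 0 - ((n : ℤ) - 1) • g ∈ H n := by
    have := (H n).sub_mem ((H n).sub_mem ((H n).smul_mem (2 : ℤ) h2) h3) c2
    convert this using 1
    module
  have e0 : (2 : ℤ) • d n 0 + ((n : ℤ) - 2) • g ∈ H n := by
    have := (H n).sub_mem c0 h2
    convert this using 1
    module
  have eg : (2 : ℤ) • g ∈ H n := by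
    have := (H n).sub_mem ((H n).add_mem ((H n).sub_mem c1 ((H n).smul_mem (2 : ℤ) e1)) h2) e0
    convert this using 1
    module
  have hv : ∃ a b : ℤ, v - a • d n 0 - b • g ∈ H n := by
    have hall : ∀ j : Fin n, ∃ a b : ℤ, d n j - a • d n 0 - b • g ∈ H n := by
      intro j
      by_cases hj0 : (j : ℕ) = 0
      · exact ⟨1, 0, by rw [hj0]; simp⟩
      by_cases hj1 : (j : ℕ) = 1
      · exact ⟨1, (n : ℤ) - 1, by rw [hj1]; simpa using e1⟩
      · have hj := j.2
        exact ⟨0, ((n - j : ℕ) : ℤ), by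
          simpa using red n (n - j) j (by omega) (by omega) hn⟩
    choose a b hab using hall
    refine ⟨∑ j, v j * a j, ∑ j, v j * b j, ?_⟩
    have := (H n).sum_mem (t := Finset.univ) (fun j _ => (H n).smul_mem (v j) (hab j))
    convert this using 1
    have hvs : v = ∑ j : Fin n, v j • d n j := by
      ext i
      simp [d, ← Fin.ext_iff]
    simp only [smul_sub, Finset.sum_sub_distrib, ← hvs, smul_smul, Finset.sum_smul]
  obtain ⟨a, b, hab⟩ := hv
  obtain ⟨m, hm⟩ := Int.even_or_odd' n
  obtain ⟨p, hp⟩ := Int.even_or_odd' a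
  obtain ⟨q, hq⟩ := Int.even_or_odd' (b - p * ((n : ℤ) - 2))
  have key : v - (a - 2 * p) • d n 0 - (b - p * ((n : ℤ) - 2) - 2 * q) • g ∈ H n := by
    have := (H n).add_mem ((H n).add_mem hab ((H n).smul_mem p e0)) ((H n).smul_mem q eg)
    convert this using 1
    module
  rcases hp with hp | hp <;> rcases hq with hq | hq
  · left
    rw [hq, hp] at key
    simpa using key
  · right; left
    rw [hq, hp] at key
    have := (H n).add_mem key eg
    convert this using 1
    module
  · right; right; left
    rw [hq, hp] at key
    convert key using 1
    module
  · right; right; right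
    rw [hq, hp] at key
    rcases hm with hm | hm
    · right
      have := (H n).sub_mem ((H n).sub_mem key e1) ((H n).smul_mem (m - 1) eg)
      convert this using 1
      rw [hm]
      module
    · left
      have := (H n).sub_mem ((H n).add_mem key e0) ((H n).smul_mem (m - 1) eg)
      convert this using 1
      rw [hm]
      module

theorem special (n : ℕ) (hn : 4 ≤ n) : ∃ u : Fin n → ℤ,
    (Dgram n).mulVec u = (-2 : ℤ) • d n (n - 1) ∧ u ⟨n - 1, by omega⟩ = -2 := by
  refine ⟨fun i => if (i : ℕ) = 0 then 1 else if (i : ℕ) = 1 then -1 else -2, ?_, ?_⟩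
  · set u : Fin n → ℤ := fun i => if (i : ℕ) = 0 then 1 else if (i : ℕ) = 1 then -1 else -2
      with hu
    have hdu : ∀ j (hj : j < n), d n j ⬝ᵥ u = u ⟨j, hj⟩ := fun j hj => d_dot n j hj u
    ext ⟨i, hi⟩
    have h1 : (Dgram n).mulVec u ⟨i, hi⟩ = (Dgram n).mulVec (d n i) ⬝ᵥ u := by
      rw [← d_dot n i hi ((Dgram n).mulVec u), Matrix.dotProduct_mulVec, ← Matrix.mulVec_transpose, Dsymm]
    rw [h1]
    match i, hi with
    | 0, hi =>
      rw [col0 n hn, add_dotProduct, smul_dotProduct, hdu 0 (by omega), hdu 2 (by omega)]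
      simp [hu, d]; omega
    | 1, hi =>
      rw [col1 n hn, sub_dotProduct, smul_dotProduct, hdu 1 (by omega), hdu 2 (by omega)]
      simp [hu, d]; omega
    | 2, hi =>
      rw [col2 n hn, sub_dotProduct, add_dotProduct, sub_dotProduct, smul_dotProduct,
        hdu 0 (by omega), hdu 1 (by omega), hdu 2 (by omega), hdu 3 (by omega)]
      simp [hu, d]; omega
    | i + 3, hi =>
      rw [colj n i hi, sub_dotProduct, add_dotProduct, neg_dotProduct, smul_dotProduct,
        hdu (i + 2) (by omega), hdu (i + 3) (by omega)]
      by_cases h4 : i + 4 < n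
      · rw [hdu (i + 4) h4]
        simp [hu, d]; omega
      · obtain rfl : n = i + 4 := by omega
        rw [d_n]
        simp [hu, d]
  · simp; omega

theorem complete (n : ℕ) (A : Mat (n + 1)) (hA : A.IsSymm) (h : PrimRep A (Dgram n)) :
    ∃ v c, SI A (BM n v c) := by
  obtain ⟨T, hT, S, hS⟩ := h
  let f : (Fin (n + 1) → ℤ) →ₗ[ℤ] (Fin n → ℤ) := S.vecMulLinear
  have hf : Function.Surjective f := by
    intro y
    refine ⟨y ᵥ* T, ?_⟩
    simp [f, Matrix.vecMul_vecMul, hS]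
  have hr : Module.finrank ℤ (LinearMap.ker f) = 1 := by
    have := Submodule.finrank_quotient_add_finrank (LinearMap.ker f)
    rw [(f.quotKerEquivOfSurjective hf).finrank_eq] at this
    simp at this
    omega
  let b := Module.finBasisOfFinrankEq ℤ (LinearMap.ker f) hr
  let w : Fin (n + 1) → ℤ := (b 0 : LinearMap.ker f)
  have hw : w ᵥ* S = 0 := (b 0).2
  have hx : ∀ x : Fin (n + 1) → ℤ, ∃ k : ℤ, x = (x ᵥ* S) ᵥ* T + k • w := by
    intro x
    have hk : x - (x ᵥ* S) ᵥ* T ∈ LinearMap.ker f := by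
      simp [f, Matrix.sub_vecMul, Matrix.vecMul_vecMul, hS, Matrix.mul_assoc]
    have := b.sum_repr ⟨_, hk⟩
    have h2 := congrArg Subtype.val this
    simp only [Finset.univ_unique, Fin.default_eq_zero, Finset.sum_singleton,
      Submodule.coe_smul] at h2
    refine ⟨b.repr ⟨_, hk⟩ 0, ?_⟩
    rw [show w = ((b 0 : LinearMap.ker f) : Fin (n + 1) → ℤ) from rfl, h2]
    simp
  choose k hk using fun i : Fin (n + 1) => hx (Pi.single i 1)
  let W : Matrix (Fin 1) (Fin (n + 1)) ℤ := Matrix.of fun _ j => w j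
  let K : Matrix (Fin (n + 1)) (Fin 1) ℤ := Matrix.of fun i _ => k i
  have hVU : Matrix.fromCols S K * Matrix.fromRows T W = 1 := by
    rw [Matrix.fromCols_mul_fromRows]
    ext i j
    have := congrFun (hk i) j
    simp only [Matrix.single_one_vecMul] at this
    rw [Matrix.one_apply, Matrix.add_apply]
    simp only [Pi.single_apply, Pi.add_apply, Pi.smul_apply, smul_eq_mul] at this
    rw [eq_comm, if_congr eq_comm rfl rfl, this]
    simp [W, K, Matrix.mul_apply, Matrix.vecMul, dotProduct]
  have hUV : Matrix.fromRows T W * Matrix.fromCols S K = 1 := by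
    exact (Matrix.mul_eq_one_comm_of_equiv finSumFinEquiv.symm).1 hVU
  refine ⟨fun i => (T * A * Wᵀ) i 0, (W * A * Wᵀ) 0 0, Matrix.fromRows T W,
    Matrix.fromCols S K, hVU, hUV, ?_⟩
  rw [Matrix.fromRows_mul, Matrix.transpose_fromRows, Matrix.fromRows_mul_fromCols, hT]
  unfold BM
  congr 1
  · ext i j
    obtain rfl : i = 0 := Subsingleton.elim _ _
    have : W * A * Tᵀ = (T * A * Wᵀ)ᵀ := by
      simp only [Matrix.transpose_mul, Matrix.transpose_transpose, hA.eq, Matrix.mul_assoc]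
    rw [this]; rfl

theorem to_isom {n : ℕ} {A : Mat (n + 1)} {v c} (h : SI A (BM n v c)) {B : Mat (n + 1)}
    (hB : B = Matrix.reindex finSumFinEquiv finSumFinEquiv (BM n v c)) : Isom A B := by
  have := h.trans (SI.reindex _ finSumFinEquiv)
  rw [← hB] at this
  exact ⟨let ⟨U, _, _, _, h⟩ := this; ⟨U, h⟩, this.back⟩

theorem corner_pos {n : ℕ} {A : Mat (n + 1)} (hA : PosDefInt A) {v c} (h : SI A (BM n v c)) :
    0 < c := by
  have := h.pos hA.2 (Sum.elim 0 (fun _ => 1)) (by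
    intro h0; simpa using congrFun h0 (Sum.inr 0))
  simpa [BM, Matrix.fromBlocks_mulVec, Matrix.mulVec, dotProduct] using this

theorem corner_pos2 {n : ℕ} (hn : 4 ≤ n) {A : Mat (n + 1)} (hA : PosDefInt A) {c}
    (h : SI A (BM n (-d n (n - 1)) c)) : 1 < c := by
  obtain ⟨u, hu, hu'⟩ := special n hn
  have := h.pos hA.2 (Sum.elim (-u) (fun _ => 2)) (by
    intro h0; simpa using congrFun h0 (Sum.inr 0))
  have e : (Sum.elim (-u) (fun _ => 2) : Fin n ⊕ Fin 1 → ℤ) ⬝ᵥ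
      (BM n (-d n (n - 1)) c).mulVec (Sum.elim (-u) (fun _ => 2)) = 4 * c - 4 := by
    have hd : d n (n - 1) ⬝ᵥ u = -2 := by rw [d_dot n (n - 1) (by omega), hu']
    have hd' : u ⬝ᵥ d n (n - 1) = -2 := by rw [dotProduct_comm, hd]
    have m1 : (Matrix.of fun (i : Fin n) (_ : Fin 1) => (-d n (n - 1)) i).mulVec (fun _ => (2:ℤ))
        = (-2 : ℤ) • d n (n - 1) := by
      ext i; simp [Matrix.mulVec, dotProduct]; ring
    have m2 : (Matrix.of fun (_ : Fin 1) (j : Fin n) => (-d n (n - 1)) j).mulVec (-u)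
        = fun _ => -2 := by
      ext i
      change (-d n (n - 1)) ⬝ᵥ (-u) = -2
      simp [hd]
    have m3 : (Matrix.of fun (_ : Fin 1) (_ : Fin 1) => c).mulVec (fun _ => (2:ℤ))
        = fun _ => c * 2 := by
      ext i; simp [Matrix.mulVec, dotProduct]
    unfold BM
    rw [Matrix.fromBlocks_mulVec]
    simp only [Sum.elim_comp_inl, Sum.elim_comp_inr, m1, m2, m3, Matrix.mulVec_neg, hu,
      sumElim_dotProduct_sumElim]
    simp [dotProduct]
    ring
  rw [e] at this
  omega

end DnAux

/-- A positive definite integral lattice `L` of rank `n+1`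
containing `D_n` as a primitive sublattice is isometric to `D_n ⊥ ⟨a⟩`, or to
`(D_n ⊥ ℤz) + ℤ([1] + z/4)` with `Q(z) = 16a - 4n`, or to
`(D_n ⊥ ℤz) + ℤ([2] + z/2)` with `Q(z) = 4a`, for some positive integer `a`. -/
theorem primrep_Dn_classification (n : ℕ) (hn : 4 ≤ n) (L : QLat (n + 1))
    (h : PrimRep L.1 (Dgram n)) :
    ∃ a : ℤ, 0 < a ∧
      (Isom L.1 (sumGram (Dgram n) (Matrix.of fun _ _ : Fin 1 => a)) ∨
        Isom L.1 (Dglue1 n a) ∨ Isom L.1 (Dglue2 n a)) := by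
  obtain ⟨v, c, h0⟩ := DnAux.complete n L.1 L.2.1 h
  have hshift : ∀ v', v - v' ∈ DnAux.H n → ∃ c', DnAux.SI L.1 (DnAux.BM n v' c') := by
    rintro v' ⟨x, hx⟩
    obtain ⟨c', hc'⟩ := DnAux.shift n v (-x) c
    refine ⟨c', h0.trans ?_⟩
    convert hc' using 2
    rw [Matrix.mulVec_neg]
    simp only [Matrix.mulVecLin_apply] at hx
    rw [hx]; simp
  have h1 : ∀ c', DnAux.SI L.1 (DnAux.BM n (DnAux.d n 0) c') → Isom L.1 (Dglue1 n c') := by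
    intro c' hc'
    refine DnAux.to_isom hc' ?_
    ext i j
    refine Fin.addCases (fun i => ?_) (fun i => ?_) i <;>
      refine Fin.addCases (fun j => ?_) (fun j => ?_) j <;>
      simp [Dglue1, DnAux.BM, DnAux.d, -Fin.val_eq_zero_iff]
  rcases DnAux.classes n hn v with hv | hv | hv | hv | hv
  · obtain ⟨c', hc'⟩ := hshift 0 (by simpa using hv)
    refine ⟨c', DnAux.corner_pos L.2 hc', Or.inl (DnAux.to_isom hc' ?_)⟩
    rfl
  · obtain ⟨c', hc'⟩ := hshift (-DnAux.d n (n - 1)) (by simpa using hv)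
    have := DnAux.corner_pos2 hn L.2 hc'
    refine ⟨c' - 1, by omega, Or.inr (Or.inr (DnAux.to_isom hc' ?_))⟩
    ext i j
    refine Fin.addCases (fun i => ?_) (fun i => ?_) i <;>
      refine Fin.addCases (fun j => ?_) (fun j => ?_) j <;>
      simp [Dglue2, DnAux.BM, DnAux.d, neg_ite]
  · obtain ⟨c', hc'⟩ := hshift _ hv
    exact ⟨c', DnAux.corner_pos L.2 hc', Or.inr (Or.inl (h1 _ hc'))⟩
  · obtain ⟨c', hc'⟩ := hshift (-DnAux.d n 0) (by simpa using hv)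
    have hc' := hc'.trans (DnAux.neg n _ c')
    rw [neg_neg] at hc'
    exact ⟨c', DnAux.corner_pos L.2 hc', Or.inr (Or.inl (h1 _ hc'))⟩
  · obtain ⟨c', hc'⟩ := hshift _ hv
    have hc' := (hc'.trans (DnAux.act n _ (DnAux.P_P hn) (DnAux.P_D hn) _ c')).trans
      (DnAux.neg n _ c')
    rw [DnAux.P_d1 hn, neg_neg] at hc'
    exact ⟨c', DnAux.corner_pos L.2 hc', Or.inr (Or.inl (h1 _ hc'))⟩
end
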